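/- Let q be a 'good' modulus, meaning L(s,χ) ≠ 0 for all Dirichlet characters χ mod q and all s = σ + it with σ > 1 - C_2/log(q(|t|+1)). Then π(x; q, a) ≫ x/(φ(q) log x) uniformly for (a,q) = 1 and x ≥ q^D, where D depends only on C_2. -/

import Mathlib

/-- A modulus `q` is *good* (relative to `C₂`) if no Dirichlet `L`-function mod `q`
vanishes in the region `Re s > 1 - C₂ / log(q(|Im s|+1))`. -/
def IsGoodModulus (C₂ : ℝ) (q : ℕ) [NeZero q] : Prop :=
  ∀ χ : DirichletCharacter ℂ q, ∀ s : ℂ,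
    1 - C₂ / Real.log (q * (|s.im| + 1)) < s.re →
      DirichletCharacter.LFunction χ s ≠ 0

section

open Finset

namespace Gall

lemma sum_log_prime_div_le_aux (n : ℕ) (hn : 1 ≤ n) :
    ∑ p ∈ (Finset.Icc 1 n).filter Nat.Prime, Real.log p / p ≤ Real.log n + Real.log 4 := by
  have hn0 : (0 : ℝ) < n := by exact_mod_cast hn
  have h1 : ∑ p ∈ (Finset.Icc 1 n).filter Nat.Prime, Real.log p * (n / p : ℕ) ≤
      Real.log (n.factorial) := by
    have e1 : Real.log (n.factorial) = ∑ m ∈ Finset.Ioc 0 n, Real.log m := by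
      clear hn hn0
      induction n with
      | zero => simp
      | succ k ih =>
        rw [Nat.factorial_succ, ← Finset.insert_Ioc_right_eq_Ioc_add_one (by omega), Finset.sum_insert (by simp), ← ih]
        push_cast
        rw [Real.log_mul (by positivity) (by positivity)]
    rw [e1]
    have e2 : ∀ m ∈ Finset.Ioc 0 n, ∑ p ∈ (Finset.Icc 1 n).filter Nat.Prime,
        (if p ∣ m then Real.log p else 0) ≤ Real.log m := by
      intro m hm
      rw [Finset.mem_Ioc] at hm
      rw [← Finset.sum_filter]
      have : ((Finset.Icc 1 n).filter Nat.Prime).filter (fun p => p ∣ m) ⊆ m.primeFactors := by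
        intro p hp
        simp only [Finset.mem_filter, Nat.mem_primeFactors] at hp ⊢
        exact ⟨hp.1.2, hp.2, by omega⟩
      refine (Finset.sum_le_sum_of_subset_of_nonneg this (fun p hp _ => Real.log_natCast_nonneg p)).trans ?_
      rw [← Real.log_prod (by
        intro p hp
        have := (Nat.prime_of_mem_primeFactors hp).pos
        positivity)]
      have h3 : ∏ p ∈ m.primeFactors, p ≤ m := Nat.le_of_dvd hm.1 (Nat.prod_primeFactors_dvd m)
      apply Real.log_le_log
      · apply Finset.prod_pos
        intro p hp
        have := (Nat.prime_of_mem_primeFactors hp).pos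
        positivity
      · rw [← Nat.cast_prod]; exact_mod_cast h3
    refine le_trans (le_of_eq ?_) (Finset.sum_le_sum e2)
    rw [Finset.sum_comm]
    apply Finset.sum_congr rfl
    intro p hp
    rw [← Finset.sum_filter, Finset.sum_const, Nat.Ioc_filter_dvd_card_eq_div, nsmul_eq_mul, mul_comm]
  have h2 : Real.log (n.factorial) ≤ n * Real.log n := by
    rw [← Real.log_pow]
    apply Real.log_le_log (by positivity)
    exact_mod_cast Nat.factorial_le_pow n
  have h3 : ∑ p ∈ (Finset.Icc 1 n).filter Nat.Prime, Real.log p ≤ Real.log 4 * n := by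
    have := Chebyshev.theta_le_log4_mul_x (x := n) (by positivity)
    rw [Chebyshev.theta] at this
    convert this using 3
    ext p
    simp
    omega
  have h4 : n * ∑ p ∈ (Finset.Icc 1 n).filter Nat.Prime, Real.log p / p ≤
     ∑ p ∈ (Finset.Icc 1 n).filter Nat.Prime, Real.log p * (n / p : ℕ) +
      ∑ p ∈ (Finset.Icc 1 n).filter Nat.Prime, Real.log p := by
    rw [Finset.mul_sum, ← Finset.sum_add_distrib]
    apply Finset.sum_le_sum
    intro p hp
    have hlog := Real.log_natCast_nonneg p
    have : (n : ℝ) / p ≤ (n / p : ℕ) + 1 := by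
      rw [← Nat.floor_div_eq_div (K := ℝ)]
      exact (Nat.lt_floor_add_one _).le
    calc (n : ℝ) * (Real.log p / p) = Real.log p * (n / p) := by ring
      _ ≤ Real.log p * ((n / p : ℕ) + 1) := by gcongr
      _ = _ := by ring
  have h5 : n * ∑ p ∈ (Finset.Icc 1 n).filter Nat.Prime, Real.log p / p ≤ n * (Real.log n + Real.log 4) := by
    linarith
  exact le_of_mul_le_mul_left h5 hn0

/-- Mertens upper bound. -/
lemma mertens_upper (W : ℕ) (hW : 2 ≤ W) :
    ∑ p ∈ W.primesBelow, Real.log p / p ≤ 3 * Real.log W := by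
  have h := sum_log_prime_div_le_aux W (by omega)
  have h2 : ∑ p ∈ W.primesBelow, Real.log p / p ≤
      ∑ p ∈ (Finset.Icc 1 W).filter Nat.Prime, Real.log p / p := by
    apply Finset.sum_le_sum_of_subset_of_nonneg
    · intro p hp
      rw [Nat.mem_primesBelow] at hp
      simp only [Finset.mem_filter, Finset.mem_Icc]
      exact ⟨⟨hp.2.pos, hp.1.le⟩, hp.2⟩
    · intro p _ _
      have := Real.log_natCast_nonneg p
      positivity
  have h3 : Real.log 4 = 2 * Real.log 2 := by
    rw [show (4 : ℝ) = 2 ^ 2 by norm_num, Real.log_pow]; norm_num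
  have h4 : Real.log 2 ≤ Real.log W := Real.log_le_log (by norm_num) (by exact_mod_cast hW)
  linarith

/-- Rankin factor. -/
lemma rankin_factor (W : ℕ) (hW : 2 ≤ W) (s : Finset ℕ) (hs : s ⊆ W.primesBelow) :
    ∏ p ∈ s, (1 + ((p : ℝ) ^ (1 / Real.log W) - 1) / p) ≤ Real.exp (3 * Real.exp 1) := by
  have hlW : 0 < Real.log W := Real.log_pos (by exact_mod_cast (by omega : 1 < W))
  have key : ∀ p ∈ W.primesBelow, ((p : ℝ) ^ (1 / Real.log W) - 1) / p ≤
      Real.exp 1 / Real.log W * (Real.log p / p) := by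
    intro p hp
    rw [Nat.mem_primesBelow] at hp
    have hp0 : (0 : ℝ) < p := by exact_mod_cast hp.2.pos
    have hlp : 0 ≤ Real.log p := Real.log_natCast_nonneg p
    have hle : Real.log p ≤ Real.log W := Real.log_le_log hp0 (by exact_mod_cast hp.1.le)
    rw [Real.rpow_def_of_pos hp0]
    set t := Real.log p * (1 / Real.log W) with ht
    have ht0 : 0 ≤ t := by positivity
    have ht1 : t ≤ 1 := by rw [ht, mul_one_div, div_le_one hlW]; exact hle
    have h1 : Real.exp t - 1 ≤ t * Real.exp t := by
      have := Real.add_one_le_exp (-t)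
      have h2 : Real.exp (-t) * Real.exp t = 1 := by rw [← Real.exp_add]; simp
      nlinarith [Real.exp_pos t]
    have h2 : Real.exp t ≤ Real.exp 1 := Real.exp_le_exp.2 ht1
    calc (Real.exp t - 1) / p ≤ (t * Real.exp 1) / p := by
          gcongr; exact h1.trans (by gcongr)
      _ = _ := by rw [ht]; field_simp
  have nn : ∀ p ∈ W.primesBelow, 0 ≤ ((p : ℝ) ^ (1 / Real.log W) - 1) / p := by
    intro p hp
    rw [Nat.mem_primesBelow] at hp
    have : (1 : ℝ) ≤ (p : ℝ) ^ (1 / Real.log W) :=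
      Real.one_le_rpow (by exact_mod_cast hp.2.one_lt.le) (by positivity)
    have : 0 ≤ (p : ℝ) ^ (1 / Real.log W) - 1 := by linarith
    positivity
  calc ∏ p ∈ s, (1 + ((p : ℝ) ^ (1 / Real.log W) - 1) / p)
      ≤ ∏ p ∈ s, Real.exp (((p : ℝ) ^ (1 / Real.log W) - 1) / p) := by
        apply Finset.prod_le_prod
        · intro p hp; have := nn p (hs hp); linarith
        · intro p hp; rw [add_comm]; exact Real.add_one_le_exp _
    _ = Real.exp (∑ p ∈ s, ((p : ℝ) ^ (1 / Real.log W) - 1) / p) := (Real.exp_sum _ _).symm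
    _ ≤ _ := by
      apply Real.exp_le_exp.2
      calc _ ≤ ∑ p ∈ W.primesBelow, ((p : ℝ) ^ (1 / Real.log W) - 1) / p :=
            Finset.sum_le_sum_of_subset_of_nonneg hs (fun p hp _ => nn p hp)
        _ ≤ ∑ p ∈ W.primesBelow, Real.exp 1 / Real.log W * (Real.log p / p) := Finset.sum_le_sum key
        _ = Real.exp 1 / Real.log W * ∑ p ∈ W.primesBelow, (Real.log p / p) := by rw [Finset.mul_sum]
        _ ≤ Real.exp 1 / Real.log W * (3 * Real.log W) := by
          gcongr; exact mertens_upper W hW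
        _ = _ := by field_simp

end Gall

end

section

open Finset

namespace Gall

lemma log_le_prod_primesBelow (W : ℕ) (hW : 2 ≤ W) :
    Real.log W ≤ ∏ p ∈ W.primesBelow, (1 - 1 / (p : ℝ))⁻¹ := by
  let f : ℕ →* ℝ :=
    { toFun := fun n => 1 / (n : ℝ), map_one' := by simp
      map_mul' := by intro a b; push_cast; field_simp }
  have hf : ∀ {p : ℕ}, p.Prime → ‖f p‖ < 1 := by
    intro p hp
    have : (1 : ℝ) < p := by exact_mod_cast hp.one_lt
    simp only [f, MonoidHom.coe_mk, OneHom.coe_mk, one_div, norm_inv, RCLike.norm_natCast]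
    exact inv_lt_one_of_one_lt₀ this
  obtain ⟨h1, h2⟩ := EulerProduct.summable_and_hasSum_smoothNumbers_prod_primesBelow_geometric hf W
  have h3 : Real.log W ≤ ∑ n ∈ Finset.Icc 1 (W - 1), 1 / (n : ℝ) := by
    have := log_add_one_le_harmonic (W - 1)
    rw [harmonic_eq_sum_Icc] at this
    push_cast [Nat.cast_sub (by omega : 1 ≤ W)] at this
    simpa using this
  refine h3.trans ?_
  have hmem : ∀ n ∈ Finset.Icc 1 (W - 1), n ∈ W.smoothNumbers := by
    intro n hn
    rw [Finset.mem_Icc] at hn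
    exact Nat.mem_smoothNumbers_of_lt (by omega) (by omega)
  have := sum_le_hasSum (s := (Finset.Icc 1 (W - 1)).attach.map
      ⟨fun n => (⟨n.1, hmem n.1 n.2⟩ : W.smoothNumbers), by
        intro a b h; exact Subtype.ext (congrArg (fun z : W.smoothNumbers => z.1) h)⟩) (fun i _ => by
        simp only [f, MonoidHom.coe_mk, OneHom.coe_mk]; positivity) h2
  rw [Finset.sum_map] at this
  simp only [f, MonoidHom.coe_mk, OneHom.coe_mk] at this
  refine le_trans (le_of_eq ?_) this
  rw [← Finset.sum_attach]
  rfl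

/-- sieving primes -/
def sp (q W : ℕ) : Finset ℕ := W.primesBelow.filter (fun p => ¬ p ∣ q)

lemma mem_sp {q W p : ℕ} : p ∈ sp q W ↔ p < W ∧ p.Prime ∧ ¬ p ∣ q := by
  simp [sp, Nat.mem_primesBelow, and_assoc]

/-- product of sieving primes -/
def PP (q W : ℕ) : ℕ := ∏ p ∈ sp q W, p

noncomputable def VV (q W : ℕ) : ℝ := ∏ p ∈ sp q W, (1 - 1 / (p : ℝ))

lemma sp_prime {q W p : ℕ} (h : p ∈ sp q W) : p.Prime := (mem_sp.1 h).2.1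

lemma PP_pos (q W : ℕ) : 0 < PP q W := Finset.prod_pos fun _ h => (sp_prime h).pos

lemma PP_primeFactors (q W : ℕ) : (PP q W).primeFactors = sp q W :=
  Nat.primeFactors_prod fun _ h => sp_prime h

lemma PP_squarefree (q W : ℕ) : Squarefree (PP q W) := by
  unfold PP
  refine Finset.squarefree_prod_of_pairwise_isCoprime ?_ ?_
  · intro a ha b hb hab
    simp only [Function.onFun]
    rw [← Nat.coprime_iff_isRelPrime]
    exact (Nat.coprime_primes (sp_prime ha) (sp_prime hb)).2 hab
  · intro p hp
    exact (sp_prime hp).squarefree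

lemma PP_coprime (q W : ℕ) : Nat.Coprime (PP q W) q := by
  apply Nat.Coprime.prod_left
  intro p hp
  rw [(sp_prime hp).coprime_iff_not_dvd]
  exact (mem_sp.1 hp).2.2

lemma one_sub_pos {p : ℕ} (hp : p.Prime) : 0 < 1 - 1 / (p : ℝ) := by
  have : (1 : ℝ) < p := by exact_mod_cast hp.one_lt
  rw [sub_pos, div_lt_one (by linarith)]
  exact this

lemma VV_pos (q W : ℕ) : 0 < VV q W := Finset.prod_pos fun _ h => one_sub_pos (sp_prime h)

lemma VV_le_one (q W : ℕ) : VV q W ≤ 1 := by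
  apply Finset.prod_le_one
  · intro p hp; exact (one_sub_pos (sp_prime hp)).le
  · intro p hp
    have : (0:ℝ) ≤ 1 / p := by positivity
    linarith

lemma VV_le (q W : ℕ) (hq : 0 < q) (hW : 2 ≤ W) :
    VV q W ≤ (q / Nat.totient q) / Real.log W := by
  have hlW : 0 < Real.log W := Real.log_pos (by exact_mod_cast (by omega : 1 < W))
  have h1 := log_le_prod_primesBelow W hW
  rw [Finset.prod_inv_distrib] at h1
  have hφ : (0 : ℝ) < Nat.totient q := by exact_mod_cast Nat.totient_pos.2 hq
  have hq' : (0 : ℝ) < q := by exact_mod_cast hq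
  have h2 : ((Nat.totient q : ℝ)) = q * ∏ p ∈ q.primeFactors, (1 - 1 / (p : ℝ)) := by
    have := congrArg (fun x : ℚ => (x : ℝ)) (Nat.totient_eq_mul_prod_factors q)
    push_cast at this
    simpa using this
  have h3 : VV q W * ∏ p ∈ q.primeFactors, (1 - 1 / (p : ℝ)) ≤ ∏ p ∈ W.primesBelow, (1 - 1 / (p : ℝ)) := by
    have e : W.primesBelow.filter (fun p => ¬ ¬ p ∣ q) ⊆ q.primeFactors := by
      intro p hp
      simp only [Finset.mem_filter, not_not] at hp
      exact Nat.mem_primeFactors.2 ⟨Nat.prime_of_mem_primesBelow hp.1, hp.2, hq.ne'⟩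
    rw [← Finset.prod_filter_mul_prod_filter_not W.primesBelow (fun p => ¬ p ∣ q)]
    apply mul_le_mul_of_nonneg_left _ (VV_pos q W).le
    rw [← Finset.prod_sdiff e]
    apply mul_le_of_le_one_left
    · apply Finset.prod_nonneg
      intro p hp; exact (one_sub_pos (Nat.prime_of_mem_primeFactors (e hp))).le
    · apply Finset.prod_le_one
      · intro p hp; exact (one_sub_pos (Nat.prime_of_mem_primeFactors (Finset.mem_sdiff.1 hp).1)).le
      · intro p hp
        have : (0:ℝ) ≤ 1 / p := by positivity
        linarith
  have h4 : 0 < ∏ p ∈ W.primesBelow, (1 - 1 / (p : ℝ)) :=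
    Finset.prod_pos fun _ h => one_sub_pos (Nat.prime_of_mem_primesBelow h)
  have h5 : Real.log W * ∏ p ∈ W.primesBelow, (1 - 1 / (p : ℝ)) ≤ 1 := by
    rwa [le_inv_comm₀ hlW h4, ← one_div, le_div_iff₀ hlW, mul_comm] at h1
  rw [le_div_iff₀ hlW, le_div_iff₀ hφ, h2]
  calc VV q W * Real.log W * (q * ∏ p ∈ q.primeFactors, (1 - 1 / (p : ℝ)))
      = q * Real.log W * (VV q W * ∏ p ∈ q.primeFactors, (1 - 1 / (p : ℝ))) := by ring
    _ ≤ q * Real.log W * ∏ p ∈ W.primesBelow, (1 - 1 / (p : ℝ)) := by gcongr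
    _ = q * (Real.log W * ∏ p ∈ W.primesBelow, (1 - 1 / (p : ℝ))) := by ring
    _ ≤ q * 1 := by gcongr
    _ = q := mul_one _

/-- Selberg's G. -/
noncomputable def GG (P : ℕ) (y : ℝ) : ℝ := ∑ d ∈ P.divisors.filter (fun d : ℕ => (d : ℝ) ≤ y), 1 / (Nat.totient d : ℝ)

lemma sum_rpow_div_totient (q W : ℕ) (η : ℝ) :
    ∑ d ∈ (PP q W).divisors, (d : ℝ) ^ η / (Nat.totient d : ℝ) =
      ∏ p ∈ sp q W, (1 + (p : ℝ) ^ η / (p - 1)) := by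
  let f : ArithmeticFunction ℝ := ⟨fun d => (d : ℝ) ^ η / (Nat.totient d : ℝ), by simp⟩
  have hf : f.IsMultiplicative := by
    constructor
    · simp [f]
    · intro m n hmn
      simp only [f, ArithmeticFunction.coe_mk]
      rw [Nat.totient_mul hmn]
      push_cast
      rw [Real.mul_rpow (by positivity) (by positivity)]
      rw [div_mul_div_comm]
  have := hf.prodPrimeFactors_one_add_of_squarefree (PP_squarefree q W)
  rw [PP_primeFactors] at this
  simp only [f, ArithmeticFunction.coe_mk] at this
  rw [← this]
  apply Finset.prod_congr rfl
  intro p hp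
  rw [Nat.totient_prime (sp_prime hp), Nat.cast_sub (sp_prime hp).one_lt.le]
  simp

lemma sum_inv_totient (q W : ℕ) :
    ∑ d ∈ (PP q W).divisors, 1 / (Nat.totient d : ℝ) = (VV q W)⁻¹ := by
  have := sum_rpow_div_totient q W 0
  simp only [Real.rpow_zero] at this
  rw [this, VV, ← Finset.prod_inv_distrib]
  apply Finset.prod_congr rfl
  intro p hp
  have : (1 : ℝ) < p := by exact_mod_cast (sp_prime hp).one_lt
  have h2 : (p : ℝ) - 1 ≠ 0 := by linarith
  field_simp
  ring

noncomputable def C1 : ℝ := Real.exp (3 * Real.exp 1)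

/-- Rankin's lower bound for G. -/
lemma GG_lower (q W : ℕ) (hW : 2 ≤ W) (y : ℝ) (hy : 1 ≤ y) :
    (VV q W)⁻¹ * (1 - C1 * Real.exp (-(Real.log y / Real.log W))) ≤ GG (PP q W) y := by
  have hlW : 0 < Real.log W := Real.log_pos (by exact_mod_cast (by omega : 1 < W))
  set η := 1 / Real.log W with hη
  have hη0 : 0 ≤ η := by positivity
  have hsplit := Finset.sum_filter_add_sum_filter_not (PP q W).divisors (fun d : ℕ => (d : ℝ) ≤ y) (fun d => 1 / (Nat.totient d : ℝ))
  rw [sum_inv_totient] at hsplit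
  have hy0 : 0 < y := by linarith
  have htail : ∑ d ∈ (PP q W).divisors.filter (fun d : ℕ => ¬ (d : ℝ) ≤ y), 1 / (Nat.totient d : ℝ) ≤
      y ^ (-η) * ((VV q W)⁻¹ * C1) := by
    calc _ ≤ ∑ d ∈ (PP q W).divisors.filter (fun d : ℕ => ¬ (d : ℝ) ≤ y), y ^ (-η) * ((d : ℝ) ^ η / (Nat.totient d : ℝ)) := by
          apply Finset.sum_le_sum
          intro d hd
          simp only [Finset.mem_filter, not_le] at hd
          rw [← mul_div_assoc]
          gcongr
          rw [Real.rpow_neg hy0.le, inv_mul_eq_div, le_div_iff₀ (by positivity), one_mul]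
          exact Real.rpow_le_rpow hy0.le hd.2.le hη0
      _ ≤ ∑ d ∈ (PP q W).divisors, y ^ (-η) * ((d : ℝ) ^ η / (Nat.totient d : ℝ)) := by
          apply Finset.sum_le_sum_of_subset_of_nonneg (Finset.filter_subset _ _)
          intro d _ _
          positivity
      _ = y ^ (-η) * ∏ p ∈ sp q W, (1 + (p : ℝ) ^ η / (p - 1)) := by
          rw [← Finset.mul_sum, sum_rpow_div_totient]
      _ = y ^ (-η) * ((VV q W)⁻¹ * ∏ p ∈ sp q W, (1 + ((p : ℝ) ^ η - 1) / p)) := by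
          rw [VV, ← Finset.prod_inv_distrib, ← Finset.prod_mul_distrib]
          congr 1
          apply Finset.prod_congr rfl
          intro p hp
          have : (1 : ℝ) < p := by exact_mod_cast (sp_prime hp).one_lt
          have h2 : (p : ℝ) - 1 ≠ 0 := by linarith
          field_simp
          ring
      _ ≤ _ := by
          have := VV_pos q W
          gcongr
          exact rankin_factor W hW _ (Finset.filter_subset _ _)
  have e : y ^ (-η) = Real.exp (-(Real.log y / Real.log W)) := by
    rw [Real.rpow_def_of_pos hy0, hη]; congr 1; ring
  rw [e] at htail
  have : GG (PP q W) y = (VV q W)⁻¹ - ∑ d ∈ (PP q W).divisors.filter (fun d : ℕ => ¬ (d : ℝ) ≤ y), 1 / (Nat.totient d : ℝ) := by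
    rw [← hsplit, GG]; ring
  rw [this]
  linarith

end Gall

end

section

open Finset

namespace Gall

/-- integers up to u in a residue class -/
noncomputable def res (q : ℕ) (β : ZMod q) (u : ℝ) : Finset ℕ :=
  (Finset.Ioc 0 ⌊u⌋₊).filter (fun n => (n : ZMod q) = β)

lemma card_res_dvd (q : ℕ) [NeZero q] (β : ZMod q) (u : ℝ) (hu : 0 ≤ u) (m : ℕ) (hm : 0 < m)
    (hmq : Nat.Coprime m q) :
    |(((res q β u).filter (fun n => m ∣ n)).card : ℝ) - u / (q * m)| ≤ 2 := by
  have hq : 0 < q := Nat.pos_of_ne_zero (NeZero.ne q)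
  obtain ⟨c, hc1, hc2⟩ := Nat.chineseRemainder hmq.symm β.val 0
  have hset : (res q β u).filter (fun n => m ∣ n) =
      (Finset.Ioc 0 ⌊u⌋₊).filter (fun n => n ≡ c [MOD q * m]) := by
    ext n
    simp only [res, Finset.mem_filter, and_assoc]
    apply and_congr_right
    intro _
    rw [← Nat.modEq_and_modEq_iff_modEq_mul hmq.symm]
    apply and_congr
    · constructor
      · intro h
        refine Nat.ModEq.trans ?_ hc1.symm
        rw [← ZMod.natCast_eq_natCast_iff, h, ZMod.natCast_zmod_val]
      · intro h
        have := (ZMod.natCast_eq_natCast_iff _ _ _).2 (h.trans hc1)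
        rw [this, ZMod.natCast_zmod_val]
    · rw [← Nat.modEq_zero_iff_dvd]
      exact ⟨fun h => h.trans hc2.symm, fun h => h.trans hc2⟩
  rw [hset]
  have hr : 0 < q * m := Nat.mul_pos hq hm
  have hcard := Nat.Ioc_filter_modEq_card 0 ⌊u⌋₊ hr c
  have hrQ : (0 : ℚ) < (q * m : ℕ) := by exact_mod_cast hr
  set r := q * m with hrdef
  have h1 := Int.floor_le (((⌊u⌋₊ : ℕ) - (c : ℚ)) / (r : ℚ))
  have h2 := Int.lt_floor_add_one (((⌊u⌋₊ : ℕ) - (c : ℚ)) / (r : ℚ))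
  have h3 := Int.floor_le ((((0 : ℕ) : ℚ) - (c : ℚ)) / (r : ℚ))
  have h4 := Int.lt_floor_add_one ((((0 : ℕ) : ℚ) - (c : ℚ)) / (r : ℚ))
  set A := ⌊(((⌊u⌋₊ : ℕ) - (c : ℚ)) / (r : ℚ))⌋
  set B := ⌊((((0 : ℕ) : ℚ) - (c : ℚ)) / (r : ℚ))⌋
  have hmono : B ≤ A := by
    apply Int.floor_mono
    gcongr
    simp
  rw [max_eq_left (by omega)] at hcard
  have hd : ((⌊u⌋₊ : ℕ) - (c : ℚ)) / (r : ℚ) - (((0 : ℕ) : ℚ) - (c : ℚ)) / (r : ℚ) = (⌊u⌋₊ : ℕ) / (r : ℚ) := by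
    push_cast; ring
  have hQ1 : ((A - B : ℤ) : ℚ) ≤ (⌊u⌋₊ : ℕ) / (r : ℚ) + 1 := by push_cast; linarith
  have hQ2 : (⌊u⌋₊ : ℕ) / (r : ℚ) - 1 ≤ ((A - B : ℤ) : ℚ) := by push_cast; linarith
  have hR1 : ((A - B : ℤ) : ℝ) ≤ (⌊u⌋₊ : ℕ) / (r : ℝ) + 1 := by
    have := (Rat.cast_le (K := ℝ)).2 hQ1; push_cast at this ⊢; exact this
  have hR2 : (⌊u⌋₊ : ℕ) / (r : ℝ) - 1 ≤ ((A - B : ℤ) : ℝ) := by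
    have := (Rat.cast_le (K := ℝ)).2 hQ2; push_cast at this ⊢; exact this
  have hcR : (((Finset.Ioc 0 ⌊u⌋₊).filter (fun n => n ≡ c [MOD r])).card : ℝ) = ((A - B : ℤ) : ℝ) := by
    exact_mod_cast hcard
  rw [hcR]
  have hrR : (1 : ℝ) ≤ r := by exact_mod_cast hr
  have hfl := Nat.floor_le hu
  have hfl2 := Nat.lt_floor_add_one u
  have e1 : (⌊u⌋₊ : ℕ) / (r : ℝ) ≤ u / r := by gcongr
  have e2 : u / r ≤ (⌊u⌋₊ : ℕ) / (r : ℝ) + 1 := by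
    rw [div_add_one (by linarith)]
    gcongr
    linarith
  have e3 : (q : ℝ) * m = r := by rw [hrdef]; push_cast; ring
  rw [e3, abs_le]
  constructor <;> linarith

section selberg
variable (P : ℕ) (y : ℝ)

noncomputable def DD : Finset ℕ := P.divisors.filter (fun d : ℕ => (d : ℝ) ≤ y)

noncomputable def ww (d : ℕ) : ℝ :=
  (ArithmeticFunction.moebius d : ℝ) * d / GG P y * ∑ f ∈ (DD P y).filter (fun f => d ∣ f), 1 / (Nat.totient f : ℝ)

variable {P y}

lemma DD_dvd {d g : ℕ} (hg : g ∈ DD P y) (h : d ∣ g) : d ∈ DD P y := by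
  simp only [DD, Finset.mem_filter, Nat.mem_divisors] at hg ⊢
  have hgpos : 0 < g := Nat.pos_of_ne_zero (fun h0 => hg.1.2 (by rw [h0] at hg; exact Nat.eq_zero_of_zero_dvd hg.1.1))
  refine ⟨⟨h.trans hg.1.1, hg.1.2⟩, le_trans ?_ hg.2⟩
  exact_mod_cast Nat.le_of_dvd hgpos h

lemma DD_pos {g : ℕ} (hg : g ∈ DD P y) : 0 < g := by
  simp only [DD, Finset.mem_filter] at hg
  exact Nat.pos_of_mem_divisors hg.1

lemma moebius_inner (hP : Squarefree P) {f g : ℕ} (hf : f ∈ DD P y) (hg : g ∈ DD P y) :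
    ∑ d ∈ (DD P y).filter (fun d => f ∣ d ∧ d ∣ g), (ArithmeticFunction.moebius d : ℝ) =
      if g = f then (ArithmeticFunction.moebius f : ℝ) else 0 := by
  by_cases hfg : f ∣ g
  · obtain ⟨h, rfl⟩ := hfg
    have hgpos := DD_pos hg
    have hfpos := DD_pos hf
    have hhpos : 0 < h := Nat.pos_of_mul_pos_left hgpos
    have hsq : Squarefree (f * h) := by
      apply Squarefree.squarefree_of_dvd _ hP
      simp only [DD, Finset.mem_filter, Nat.mem_divisors] at hg
      exact hg.1.1
    have hcop := Nat.coprime_of_squarefree_mul hsq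
    have e : (DD P y).filter (fun d => f ∣ d ∧ d ∣ f * h) = h.divisors.image (fun e => f * e) := by
      ext d
      simp only [Finset.mem_filter, Finset.mem_image, Nat.mem_divisors]
      constructor
      · rintro ⟨_, ⟨e, rfl⟩, h2⟩
        exact ⟨e, ⟨Nat.dvd_of_mul_dvd_mul_left hfpos h2, hhpos.ne'⟩, rfl⟩
      · rintro ⟨e, ⟨he, _⟩, rfl⟩
        exact ⟨DD_dvd hg (Nat.mul_dvd_mul_left f he), Dvd.intro _ rfl, Nat.mul_dvd_mul_left f he⟩
    rw [e, Finset.sum_image (fun a _ b _ hab => Nat.eq_of_mul_eq_mul_left hfpos hab)]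
    have e2 : ∀ x ∈ h.divisors, (ArithmeticFunction.moebius (f * x) : ℝ) = (ArithmeticFunction.moebius f : ℝ) * (ArithmeticFunction.moebius x : ℝ) := by
      intro x hx
      rw [ArithmeticFunction.isMultiplicative_moebius.map_mul_of_coprime
        (Nat.Coprime.coprime_dvd_right (Nat.dvd_of_mem_divisors hx) hcop)]
      push_cast; rfl
    rw [Finset.sum_congr rfl e2, ← Finset.mul_sum]
    have e3 : ∑ x ∈ h.divisors, (ArithmeticFunction.moebius x : ℝ) = if h = 1 then 1 else 0 := by
      have : ∑ x ∈ h.divisors, ArithmeticFunction.moebius x = if h = 1 then 1 else 0 := by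
        rw [← ArithmeticFunction.coe_mul_zeta_apply, ArithmeticFunction.moebius_mul_coe_zeta,
          ArithmeticFunction.one_apply]
      exact_mod_cast this
    rw [e3]
    have : f * h = f ↔ h = 1 := by
      constructor
      · intro hh; exact Nat.eq_of_mul_eq_mul_left hfpos (by rw [hh, mul_one])
      · rintro rfl; simp
    simp only [this]
    split_ifs <;> simp
  · rw [if_neg (by rintro rfl; exact hfg dvd_rfl)]
    rw [Finset.filter_false_of_mem]
    · simp
    · rintro d _ ⟨h1, h2⟩
      exact hfg (h1.trans h2)

lemma ww_sum (hP : Squarefree P) {f : ℕ} (hf : f ∈ DD P y) :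
    ∑ d ∈ (DD P y).filter (fun d => f ∣ d), ww P y d / d =
      (ArithmeticFunction.moebius f : ℝ) / (Nat.totient f * GG P y) := by
  have h1 : ∀ d ∈ (DD P y).filter (fun d => f ∣ d), ww P y d / d =
      ∑ g ∈ DD P y, if d ∣ g then (1 / GG P y) * (ArithmeticFunction.moebius d : ℝ) * (1 / (Nat.totient g : ℝ)) else 0 := by
    intro d hd
    have hd0 : (d : ℝ) ≠ 0 := by
      have := DD_pos (Finset.mem_filter.1 hd).1
      positivity
    rw [← Finset.sum_filter, ← Finset.mul_sum, ww]
    field_simp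
  rw [Finset.sum_congr rfl h1, Finset.sum_comm]
  have h2 : ∀ g ∈ DD P y, (∑ d ∈ (DD P y).filter (fun d => f ∣ d),
      if d ∣ g then (1 / GG P y) * (ArithmeticFunction.moebius d : ℝ) * (1 / (Nat.totient g : ℝ)) else 0) =
      if g = f then (1 / GG P y) * (ArithmeticFunction.moebius f : ℝ) * (1 / (Nat.totient g : ℝ)) else 0 := by
    intro g hg
    rw [← Finset.sum_filter, Finset.filter_filter, ← Finset.sum_mul, ← Finset.mul_sum, moebius_inner hP hf hg]
    split_ifs <;> simp
  rw [Finset.sum_congr rfl h2, Finset.sum_ite_eq' , if_pos hf]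
  field_simp

lemma GG_pos (hP : P ≠ 0) (hy : 1 ≤ y) : 0 < GG P y := by
  unfold GG
  apply Finset.sum_pos
  · intro d hd
    have : 0 < Nat.totient d := Nat.totient_pos.2 (Nat.pos_of_mem_divisors (Finset.mem_filter.1 hd).1)
    positivity
  · exact ⟨1, by simp [hP, hy]⟩

lemma ww_one (hP : P ≠ 0) (hy : 1 ≤ y) : ww P y 1 = 1 := by
  have := (GG_pos hP hy).ne'
  have e : ∑ f ∈ (DD P y).filter (fun f => 1 ∣ f), 1 / (Nat.totient f : ℝ) = GG P y := by
    rw [Finset.filter_true_of_mem (by simp)]; rfl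
  rw [ww, e]
  simp [this]

lemma ww_abs (hP : P ≠ 0) (hy : 1 ≤ y) (d : ℕ) : |ww P y d| ≤ d := by
  have hG := GG_pos hP hy
  have h1 : ∑ f ∈ (DD P y).filter (fun f => d ∣ f), 1 / (Nat.totient f : ℝ) ≤ GG P y :=
    Finset.sum_le_sum_of_subset_of_nonneg (Finset.filter_subset _ _) (fun _ _ _ => by positivity)
  have h0 : 0 ≤ ∑ f ∈ (DD P y).filter (fun f => d ∣ f), 1 / (Nat.totient f : ℝ) :=
    Finset.sum_nonneg (fun _ _ => by positivity)
  have hm : |(ArithmeticFunction.moebius d : ℝ)| ≤ 1 := by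
    exact_mod_cast ArithmeticFunction.abs_moebius_le_one (n := d)
  rw [ww, abs_mul, abs_div, abs_mul, abs_of_nonneg h0, abs_of_pos hG, Nat.abs_cast, div_mul_eq_mul_div, div_le_iff₀ hG]
  calc _ ≤ 1 * (d : ℝ) * GG P y := by gcongr
    _ = _ := by ring

lemma quad_form (hP : Squarefree P) (hy : 1 ≤ y) :
    ∑ d ∈ DD P y, ∑ e ∈ DD P y, ww P y d * ww P y e / (Nat.lcm d e : ℝ) = 1 / GG P y := by
  have hG := GG_pos hP.ne_zero hy
  have h1 : ∀ d ∈ DD P y, ∀ e ∈ DD P y, ww P y d * ww P y e / (Nat.lcm d e : ℝ) =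
      ∑ f ∈ DD P y, (Nat.totient f : ℝ) * ((if f ∣ d then ww P y d / d else 0) * (if f ∣ e then ww P y e / e else 0)) := by
    intro d hd e he
    have hd0 := DD_pos hd
    have he0 := DD_pos he
    have hgcd : (Nat.gcd d e : ℝ) = ∑ f ∈ DD P y, if f ∣ d ∧ f ∣ e then (Nat.totient f : ℝ) else 0 := by
      rw [← Finset.sum_filter]
      conv_lhs => rw [← Nat.sum_totient (Nat.gcd d e)]
      push_cast
      apply Finset.sum_congr _ (fun _ _ => rfl)
      ext f
      simp only [Nat.mem_divisors, Finset.mem_filter, Nat.dvd_gcd_iff]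
      constructor
      · rintro ⟨h, _⟩; exact ⟨DD_dvd hd h.1, h⟩
      · rintro ⟨_, h⟩; exact ⟨h, (Nat.gcd_pos_of_pos_left _ hd0).ne'⟩
    have hl : (Nat.gcd d e : ℝ) * (Nat.lcm d e : ℝ) = d * e := by exact_mod_cast Nat.gcd_mul_lcm d e
    have hl0 : (0 : ℝ) < Nat.lcm d e := by exact_mod_cast Nat.lcm_pos hd0 he0
    have e1 : ww P y d * ww P y e / (Nat.lcm d e : ℝ) = (Nat.gcd d e : ℝ) * (ww P y d / d * (ww P y e / e)) := by
      have : (d : ℝ) ≠ 0 := by positivity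
      have : (e : ℝ) ≠ 0 := by positivity
      field_simp
      linear_combination (- ww P y d * ww P y e) * hl
    rw [e1, hgcd, Finset.sum_mul]
    apply Finset.sum_congr rfl
    intro f _
    by_cases hA : f ∣ d <;> by_cases hB : f ∣ e <;> simp [hA, hB]
  rw [Finset.sum_congr rfl (fun d hd => Finset.sum_congr rfl (h1 d hd))]
  have h2 : ∑ d ∈ DD P y, ∑ e ∈ DD P y, ∑ f ∈ DD P y, (Nat.totient f : ℝ) * ((if f ∣ d then ww P y d / d else 0) * (if f ∣ e then ww P y e / e else 0)) =
      ∑ f ∈ DD P y, (Nat.totient f : ℝ) * (∑ d ∈ (DD P y).filter (fun d => f ∣ d), ww P y d / d) ^ 2 := by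
    have : ∀ d ∈ DD P y, ∑ e ∈ DD P y, ∑ f ∈ DD P y, (Nat.totient f : ℝ) * ((if f ∣ d then ww P y d / d else 0) * (if f ∣ e then ww P y e / e else 0)) = ∑ f ∈ DD P y, ∑ e ∈ DD P y, (Nat.totient f : ℝ) * ((if f ∣ d then ww P y d / d else 0) * (if f ∣ e then ww P y e / e else 0)) := fun d _ => Finset.sum_comm
    rw [Finset.sum_congr rfl this, Finset.sum_comm]
    apply Finset.sum_congr rfl
    intro f _
    rw [Finset.sum_filter, sq, Finset.sum_mul_sum, Finset.mul_sum]
    apply Finset.sum_congr rfl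
    intro d _
    rw [Finset.mul_sum]
  rw [h2]
  have h3 : ∀ f ∈ DD P y, (Nat.totient f : ℝ) * (∑ d ∈ (DD P y).filter (fun d => f ∣ d), ww P y d / d) ^ 2 =
      (1 / GG P y ^ 2) * (1 / (Nat.totient f : ℝ)) := by
    intro f hf
    have hft : 0 < Nat.totient f := Nat.totient_pos.2 (DD_pos hf)
    have hft' : (Nat.totient f : ℝ) ≠ 0 := by positivity
    have hsq : Squarefree f := by
      apply Squarefree.squarefree_of_dvd _ hP
      simp only [DD, Finset.mem_filter, Nat.mem_divisors] at hf
      exact hf.1.1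
    have hmu : (ArithmeticFunction.moebius f : ℝ) ^ 2 = 1 := by
      exact_mod_cast ArithmeticFunction.moebius_sq_eq_one_of_squarefree hsq
    rw [ww_sum hP hf, div_pow, hmu]
    field_simp
  rw [Finset.sum_congr rfl h3, ← Finset.mul_sum]
  change 1 / GG P y ^ 2 * GG P y = _
  field_simp

lemma sum_DD_le (hy : 1 ≤ y) : ∑ d ∈ DD P y, (d : ℝ) ≤ y ^ 2 := by
  have hsub : DD P y ⊆ Finset.Ioc 0 ⌊y⌋₊ := by
    intro d hd
    rw [Finset.mem_Ioc]
    exact ⟨DD_pos hd, Nat.le_floor (Finset.mem_filter.1 hd).2⟩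
  calc ∑ d ∈ DD P y, (d : ℝ) ≤ ∑ d ∈ DD P y, y := Finset.sum_le_sum (fun d hd => (Finset.mem_filter.1 hd).2)
    _ = (DD P y).card * y := by rw [Finset.sum_const, nsmul_eq_mul]
    _ ≤ y * y := by
      have h1 : (DD P y).card ≤ ⌊y⌋₊ := by simpa using Finset.card_le_card hsub
      have h2 : ((DD P y).card : ℝ) ≤ y := by
        refine le_trans (by exact_mod_cast h1) (Nat.floor_le (by linarith))
      gcongr
    _ = y ^ 2 := by ring

/-- Selberg's upper bound sieve. -/
lemma selberg_upper (q : ℕ) [NeZero q] (β : ZMod q) (u : ℝ) (hu : 0 ≤ u) (hP : Squarefree P)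
    (hPq : Nat.Coprime P q) (hy : 1 ≤ y) :
    (((res q β u).filter (fun n => Nat.Coprime n P)).card : ℝ) ≤ (u / q) / GG P y + 2 * y ^ 4 := by
  have hP0 := hP.ne_zero
  have h1 : (((res q β u).filter (fun n => Nat.Coprime n P)).card : ℝ) ≤
      ∑ n ∈ res q β u, (∑ d ∈ (DD P y).filter (fun d => d ∣ n), ww P y d) ^ 2 := by
    rw [Finset.card_eq_sum_ones]
    push_cast
    refine le_trans ?_ (Finset.sum_le_sum_of_subset_of_nonneg (Finset.filter_subset (fun n => Nat.Coprime n P) _) (fun _ _ _ => sq_nonneg _))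
    apply Finset.sum_le_sum
    intro n hn
    rw [Finset.mem_filter] at hn
    have : (DD P y).filter (fun d => d ∣ n) = {1} := by
      ext d
      simp only [Finset.mem_filter, Finset.mem_singleton]
      constructor
      · rintro ⟨h1, h2⟩
        have h3 : d ∣ P := Nat.dvd_of_mem_divisors (Finset.mem_filter.1 h1).1
        exact Nat.eq_one_of_dvd_coprimes hn.2 h2 h3
      · rintro rfl
        simp [DD, hP0, hy]
    rw [this, Finset.sum_singleton, ww_one hP0 hy]; norm_num
  have h2 : ∑ n ∈ res q β u, (∑ d ∈ (DD P y).filter (fun d => d ∣ n), ww P y d) ^ 2 =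
      ∑ d ∈ DD P y, ∑ e ∈ DD P y, ww P y d * ww P y e * (((res q β u).filter (fun n => Nat.lcm d e ∣ n)).card : ℝ) := by
    have e1 : ∀ n ∈ res q β u, (∑ d ∈ (DD P y).filter (fun d => d ∣ n), ww P y d) ^ 2 =
        ∑ d ∈ DD P y, ∑ e ∈ DD P y, if Nat.lcm d e ∣ n then ww P y d * ww P y e else 0 := by
      intro n _
      rw [Finset.sum_filter, sq, Finset.sum_mul_sum]
      apply Finset.sum_congr rfl; intro d _
      apply Finset.sum_congr rfl; intro e _
      simp only [Nat.lcm_dvd_iff]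
      by_cases hA : d ∣ n <;> by_cases hB : e ∣ n <;> simp [hA, hB]
    rw [Finset.sum_congr rfl e1, Finset.sum_comm]
    apply Finset.sum_congr rfl; intro d _
    rw [Finset.sum_comm]
    apply Finset.sum_congr rfl; intro e _
    rw [← Finset.sum_filter, Finset.sum_const, nsmul_eq_mul, mul_comm]
  have h3 : ∀ d ∈ DD P y, ∀ e ∈ DD P y, ww P y d * ww P y e * (((res q β u).filter (fun n => Nat.lcm d e ∣ n)).card : ℝ)
      ≤ (u / q) * (ww P y d * ww P y e / (Nat.lcm d e : ℝ)) + 2 * ((d : ℝ) * e) := by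
    intro d hd e he
    have hd1 : d ∣ P := Nat.dvd_of_mem_divisors (Finset.mem_filter.1 hd).1
    have he1 : e ∣ P := Nat.dvd_of_mem_divisors (Finset.mem_filter.1 he).1
    have hl0 := Nat.lcm_pos (DD_pos hd) (DD_pos he)
    have hc := card_res_dvd q β u hu (Nat.lcm d e) hl0 (Nat.Coprime.coprime_dvd_left (Nat.lcm_dvd hd1 he1) hPq)
    have hw : |ww P y d * ww P y e| ≤ (d : ℝ) * e := by
      rw [abs_mul]; exact mul_le_mul (ww_abs hP0 hy d) (ww_abs hP0 hy e) (abs_nonneg _) (by positivity)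
    have h4 : |ww P y d * ww P y e * ((((res q β u).filter (fun n => Nat.lcm d e ∣ n)).card : ℝ) - u / (q * Nat.lcm d e))| ≤ ((d : ℝ) * e) * 2 := by
      rw [abs_mul]; exact mul_le_mul hw hc (abs_nonneg _) (by positivity)
    have h5 := (abs_le.1 h4).2
    have hq0 : (q : ℝ) ≠ 0 := by exact_mod_cast NeZero.ne q
    have e1 : (u / q) * (ww P y d * ww P y e / (Nat.lcm d e : ℝ)) = ww P y d * ww P y e * (u / (q * Nat.lcm d e)) := by
      field_simp
    rw [e1]
    linarith
  calc _ ≤ _ := h1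
    _ = _ := h2
    _ ≤ ∑ d ∈ DD P y, ∑ e ∈ DD P y, ((u / q) * (ww P y d * ww P y e / (Nat.lcm d e : ℝ)) + 2 * ((d : ℝ) * e)) :=
      Finset.sum_le_sum fun d hd => Finset.sum_le_sum (h3 d hd)
    _ = (u / q) * (∑ d ∈ DD P y, ∑ e ∈ DD P y, ww P y d * ww P y e / (Nat.lcm d e : ℝ)) + 2 * (∑ d ∈ DD P y, (d : ℝ)) ^ 2 := by
      rw [sq, Finset.sum_mul_sum]
      simp only [Finset.sum_add_distrib, Finset.mul_sum]
    _ ≤ _ := by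
      rw [quad_form hP hy]
      have h6 := sum_DD_le (P := P) hy
      have h7 : 0 ≤ ∑ d ∈ DD P y, (d : ℝ) := Finset.sum_nonneg (fun _ _ => by positivity)
      have h8 : (∑ d ∈ DD P y, (d : ℝ)) ^ 2 ≤ (y ^ 2) ^ 2 := by gcongr
      have h9 : (y ^ 2) ^ 2 = y ^ 4 := by ring
      rw [mul_one_div]
      linarith

end selberg
end Gall

end

section

open Finset

namespace Gall

noncomputable def SS (q : ℕ) (β : ZMod q) (W : ℕ) (u : ℝ) : ℝ :=
  (((res q β u).filter (fun n => Nat.Coprime n (PP q W))).card : ℝ)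

lemma SS_nonneg (q : ℕ) (β : ZMod q) (W : ℕ) (u : ℝ) : 0 ≤ SS q β W u := by
  unfold SS; positivity

lemma card_res (q : ℕ) [NeZero q] (β : ZMod q) (u : ℝ) (hu : 0 ≤ u) :
    |((res q β u).card : ℝ) - u / q| ≤ 2 := by
  have := card_res_dvd q β u hu 1 one_pos (Nat.coprime_one_left q)
  simpa using this

lemma SS_le_triv (q : ℕ) [NeZero q] (β : ZMod q) (W : ℕ) (u : ℝ) (hu : 0 ≤ u) :
    SS q β W u ≤ u / q + 2 := by
  have h1 := (abs_le.1 (card_res q β u hu)).2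
  have h2 : SS q β W u ≤ ((res q β u).card : ℝ) := by
    unfold SS; exact_mod_cast Finset.card_filter_le _ _
  linarith

lemma PP_dvd (q : ℕ) {W W' : ℕ} (h : W' ≤ W) : PP q W' ∣ PP q W := by
  apply Finset.prod_dvd_prod_of_subset
  intro p hp
  rw [mem_sp] at hp ⊢
  exact ⟨by omega, hp.2⟩

lemma SS_anti (q : ℕ) (β : ZMod q) {W W' : ℕ} (h : W' ≤ W) (u : ℝ) : SS q β W u ≤ SS q β W' u := by
  unfold SS
  have : (res q β u).filter (fun n => Nat.Coprime n (PP q W)) ⊆ (res q β u).filter (fun n => Nat.Coprime n (PP q W')) := by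
    intro n hn
    rw [Finset.mem_filter] at hn ⊢
    exact ⟨hn.1, Nat.Coprime.coprime_dvd_right (PP_dvd q h) hn.2⟩
  exact_mod_cast Finset.card_le_card this

noncomputable def KK : ℝ := 3 * Real.exp 1 + 1

lemma KK_one : 1 ≤ KK := by unfold KK; have := Real.exp_pos 1; linarith

lemma C1_pos : 0 < C1 := Real.exp_pos _

lemma C1_exp_KK {v : ℝ} (hv : KK ≤ v) : C1 * Real.exp (-v) ≤ 1 / 2 := by
  have h1 : C1 * Real.exp (-v) ≤ Real.exp (-1) := by
    rw [C1, ← Real.exp_add]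
    apply Real.exp_le_exp.2
    unfold KK at hv; linarith
  refine h1.trans ?_
  rw [Real.exp_neg, ← one_div]
  apply one_div_le_one_div_of_le (by norm_num)
  have := Real.add_one_le_exp 1
  linarith

/-- (U) -/
lemma SS_upper (q : ℕ) [NeZero q] (β : ZMod q) (W : ℕ) (hW : 2 ≤ W) (u : ℝ) (hX : 1 ≤ u / q)
    (hv : KK ≤ Real.log (u / q) / (8 * Real.log W)) :
    SS q β W u ≤ (u / q) * VV q W * (1 + 2 * C1 * Real.exp (-(Real.log (u / q) / (8 * Real.log W))))
      + 2 * (u / q) ^ (1 / 2 : ℝ) := by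
  have hq0 : (0 : ℝ) < q := by exact_mod_cast Nat.pos_of_ne_zero (NeZero.ne q)
  set X := u / q with hXd
  have hX0 : 0 < X := by linarith
  have hu : 0 ≤ u := by
    have : u = X * q := by rw [hXd]; field_simp
    rw [this]; positivity
  set y := X ^ (1 / 8 : ℝ) with hy
  have hy1 : 1 ≤ y := Real.one_le_rpow hX (by norm_num)
  have h1 := selberg_upper (P := PP q W) (y := y) q β u hu (PP_squarefree q W) (PP_coprime q W) hy1
  have h2 := GG_lower q W hW y hy1
  have e1 : Real.log y / Real.log W = Real.log X / (8 * Real.log W) := by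
    rw [hy, Real.log_rpow hX0]; field_simp
  rw [e1] at h2
  have e2 : y ^ 4 = X ^ (1 / 2 : ℝ) := by
    rw [hy, ← Real.rpow_natCast, ← Real.rpow_mul hX0.le]; norm_num
  rw [e2] at h1
  set ε := C1 * Real.exp (-(Real.log X / (8 * Real.log W))) with hε
  have hε0 : 0 < ε := mul_pos C1_pos (Real.exp_pos _)
  have hε1 : ε ≤ 1 / 2 := C1_exp_KK hv
  have hV := VV_pos q W
  have h3 : X / GG (PP q W) y ≤ X * VV q W * (1 + 2 * ε) := by
    have hG : 0 < GG (PP q W) y := GG_pos (PP_pos q W).ne' hy1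
    rw [div_le_iff₀ hG]
    have h4 : (1 : ℝ) ≤ (1 + 2 * ε) * (1 - ε) := by nlinarith
    calc X = X * 1 := (mul_one _).symm
      _ ≤ X * ((1 + 2 * ε) * (1 - ε)) := by gcongr
      _ = X * VV q W * (1 + 2 * ε) * ((VV q W)⁻¹ * (1 - ε)) := by field_simp
      _ ≤ _ := by gcongr
  have h5 : X * VV q W * (1 + 2 * C1 * Real.exp (-(Real.log X / (8 * Real.log W)))) = X * VV q W * (1 + 2 * ε) := by
    rw [hε]; ring
  rw [h5]
  unfold SS
  linarith

lemma XV_le (q : ℕ) [NeZero q] (W : ℕ) (hW : 2 ≤ W) (u : ℝ) (hu : 0 ≤ u) :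
    (u / q) * VV q W ≤ u / (Nat.totient q * Real.log W) := by
  have hq : 0 < q := Nat.pos_of_ne_zero (NeZero.ne q)
  have hq0 : (0 : ℝ) < q := by exact_mod_cast hq
  have := VV_le q W hq hW
  have hlW : 0 < Real.log W := Real.log_pos (by exact_mod_cast (by omega : 1 < W))
  have hφ : (0 : ℝ) < Nat.totient q := by exact_mod_cast Nat.totient_pos.2 hq
  calc (u / q) * VV q W ≤ (u / q) * ((q / Nat.totient q) / Real.log W) := by gcongr
    _ = _ := by field_simp

lemma totient_le' (q : ℕ) : (Nat.totient q : ℝ) ≤ q := by exact_mod_cast Nat.totient_le q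

lemma log_le_rpow_inv {x : ℝ} (hx : 0 < x) {a : ℝ} (ha : 0 < a) : Real.log x ≤ x ^ a / a := by
  exact Real.log_le_rpow_div hx.le ha

/-- Brun-Titchmarsh type bound -/
lemma SS_BT : ∃ C : ℝ, 0 < C ∧ ∀ (q : ℕ) [NeZero q] (β : ZMod q) (W : ℕ) (u : ℝ), 2 ≤ W →
    (q : ℝ) ^ 2 ≤ u → (W : ℝ) ≤ u → SS q β W u ≤ C * (u / (Nat.totient q * Real.log W)) := by
  refine ⟨96 * KK + 100, by have := KK_one; linarith, ?_⟩
  intro q _ β W u hW hqu hWu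
  have hK := KK_one
  have hq : 0 < q := Nat.pos_of_ne_zero (NeZero.ne q)
  have hq0 : (0 : ℝ) < q := by exact_mod_cast hq
  have hq1 : (1 : ℝ) ≤ q := by exact_mod_cast hq
  have hφ : (0 : ℝ) < Nat.totient q := by exact_mod_cast Nat.totient_pos.2 hq
  have hlW : 0 < Real.log W := Real.log_pos (by exact_mod_cast (by omega : 1 < W))
  have hW2 : (2 : ℝ) ≤ W := by exact_mod_cast hW
  have hu2 : 2 ≤ u := by linarith
  have hu0 : 0 < u := by linarith
  have hlWu : Real.log W ≤ Real.log u := Real.log_le_log (by linarith) hWu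
  have hqX : (q : ℝ) ≤ u / q := by rw [le_div_iff₀ hq0]; nlinarith
  have hX1 : 1 ≤ u / q := hq1.trans hqX
  have hX0 : 0 < u / q := by linarith
  have hlX : Real.log u ≤ 2 * Real.log (u / q) := by
    rw [show (2 : ℝ) * Real.log (u / q) = Real.log ((u / q) ^ 2) by rw [Real.log_pow]; norm_num]
    apply Real.log_le_log hu0
    have e : u = q * (u / q) := by field_simp
    calc u = q * (u / q) := e
      _ ≤ (u / q) * (u / q) := by gcongr
      _ = _ := by ring
  have hXφ : u / q ≤ u / Nat.totient q := by
    gcongr; exact Nat.totient_le q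
  set Q := u / (Nat.totient q * Real.log W) with hQ
  have hQ0 : 0 < Q := by positivity
  have hQe : u / Nat.totient q = Q * Real.log W := by rw [hQ]; field_simp
  set t := (W : ℝ) ^ (1 / (16 * KK)) with ht
  have ht0 : 0 < t := by positivity
  have hlt : Real.log t = Real.log W / (16 * KK) := by
    rw [ht, Real.log_rpow (by linarith)]; ring
  by_cases h4 : t < 4
  · have h1 : Real.log t < Real.log 4 := Real.log_lt_log ht0 h4
    have h2 : Real.log 4 ≤ 2 := by
      rw [show (4 : ℝ) = 2 ^ 2 by norm_num, Real.log_pow]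
      have := Real.log_two_lt_d9
      push_cast; linarith
    have h3 : Real.log W < 32 * KK := by
      have : Real.log W / (16 * KK) < 2 := by rw [← hlt]; linarith
      rw [div_lt_iff₀ (by linarith)] at this
      linarith
    have h5 := SS_le_triv q β W u hu0.le
    calc SS q β W u ≤ 3 * (u / q) := by linarith
      _ ≤ 3 * (Q * Real.log W) := by rw [← hQe]; linarith
      _ ≤ 3 * (Q * (32 * KK)) := by gcongr
      _ ≤ _ := by nlinarith
  · push Not at h4
    set W' := ⌊t⌋₊ with hW'
    have hfl : (W' : ℝ) ≤ t := Nat.floor_le ht0.le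
    have hfl2 : t < W' + 1 := Nat.lt_floor_add_one t
    have hW'2 : 2 ≤ W' := by
      apply Nat.le_floor; push_cast; linarith
    have hW'2' : (2 : ℝ) ≤ W' := by exact_mod_cast hW'2
    have hlW'0 : 0 < Real.log W' := Real.log_pos (by linarith)
    have htW : t ≤ W := by
      calc t ≤ (W : ℝ) ^ (1 : ℝ) := by
            apply Real.rpow_le_rpow_of_exponent_le (by linarith)
            rw [div_le_one (by linarith)]; linarith
        _ = W := Real.rpow_one _
    have hWW : W' ≤ W := by exact_mod_cast hfl.trans htW
    have hle : Real.log W' ≤ Real.log W / (16 * KK) := by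
      rw [← hlt]; exact Real.log_le_log (by linarith) hfl
    have hge : Real.log W ≤ 32 * KK * Real.log W' := by
      have h1 : t ≤ (W' : ℝ) ^ 2 := by nlinarith
      have h2 : Real.log t ≤ 2 * Real.log W' := by
        have := Real.log_le_log ht0 h1
        rwa [Real.log_pow] at this
      rw [hlt, div_le_iff₀ (by linarith)] at h2
      linarith
    have hv : KK ≤ Real.log (u / q) / (8 * Real.log W') := by
      rw [le_div_iff₀ (by positivity)]
      rw [le_div_iff₀ (by linarith)] at hle
      nlinarith
    have h6 := SS_upper q β W' hW'2 u hX1 hv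
    have h7 := C1_exp_KK hv
    have h8 := XV_le q W' hW'2 u hu0.le
    have h9 : u / (Nat.totient q * Real.log W') ≤ 32 * KK * Q := by
      rw [div_le_iff₀ (by positivity)]
      calc u = (u / Nat.totient q) * Nat.totient q := by field_simp
        _ = Q * Real.log W * Nat.totient q := by rw [hQe]
        _ ≤ Q * (32 * KK * Real.log W') * Nat.totient q := by gcongr
        _ = _ := by ring
    have hV := VV_pos q W'
    have h10 : (u / q) * VV q W' * (1 + 2 * C1 * Real.exp (-(Real.log (u / q) / (8 * Real.log W')))) ≤ (32 * KK * Q) * 2 := by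
      have h11 : 1 + 2 * C1 * Real.exp (-(Real.log (u / q) / (8 * Real.log W'))) ≤ 2 := by linarith
      have := C1_pos
      have := Real.exp_pos (-(Real.log (u / q) / (8 * Real.log W')))
      apply mul_le_mul (h8.trans h9) h11 (by positivity) (by positivity)
    have h12 : (u / q) ^ (1 / 2 : ℝ) ≤ 4 * Q := by
      have h13 : Real.log (u / q) ≤ (u / q) ^ (1 / 2 : ℝ) / (1 / 2) := log_le_rpow_inv hX0 (by norm_num)
      have h14 : (u / q) ^ (1 / 2 : ℝ) * (u / q) ^ (1 / 2 : ℝ) = u / q := by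
        rw [← Real.rpow_add hX0]; norm_num
      set R := (u / q) ^ (1 / 2 : ℝ) with hR
      have hR0 : 0 < R := by positivity
      have h15 : Real.log W ≤ 4 * R := by
        have : Real.log u ≤ 2 * (R / (1 / 2)) := by linarith
        linarith
      have h16 : R * R ≤ Q * Real.log W := by rw [h14, ← hQe]; exact hXφ
      have h17 : R * R ≤ (4 * Q) * R := by
        calc R * R ≤ Q * Real.log W := h16
          _ ≤ Q * (4 * R) := by gcongr
          _ = _ := by ring
      exact le_of_mul_le_mul_right h17 hR0
    have h18 := SS_anti q β hWW u
    nlinarith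

end Gall

end

section

open Finset

namespace Gall

lemma VV_telescope (q z : ℕ) : ∑ p ∈ sp q z, VV q p / p = 1 - VV q z := by
  induction z with
  | zero => simp [sp, VV]
  | succ n ih =>
    by_cases hn : n.Prime ∧ ¬ n ∣ q
    · have e : sp q (n + 1) = insert n (sp q n) := by
        ext p
        simp only [mem_sp, Finset.mem_insert]
        constructor
        · rintro ⟨h1, h2⟩
          by_cases h : p = n
          · exact Or.inl h
          · exact Or.inr ⟨by omega, h2⟩
        · rintro (rfl | ⟨h1, h2⟩)
          · exact ⟨by omega, hn⟩
          · exact ⟨by omega, h2⟩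
      have hnot : n ∉ sp q n := by simp [mem_sp]
      have e2 : VV q (n + 1) = (1 - 1 / (n : ℝ)) * VV q n := by
        rw [VV, e, Finset.prod_insert hnot]; rfl
      rw [e2, e, Finset.sum_insert hnot, ih]
      ring
    · have e : sp q (n + 1) = sp q n := by
        ext p
        simp only [mem_sp]
        constructor
        · rintro ⟨h1, h2⟩
          refine ⟨?_, h2⟩
          rcases Nat.lt_succ_iff_lt_or_eq.1 h1 with h | rfl
          · exact h
          · exact absurd h2 hn
        · rintro ⟨h1, h2⟩
          exact ⟨by omega, h2⟩
      rw [VV, e, ih]; rfl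

lemma buchstab (q : ℕ) [NeZero q] (β : ZMod q) (z : ℕ) (u : ℝ) :
    ((res q β u).card : ℝ) - ∑ p ∈ sp q z, SS q (β * (p : ZMod q)⁻¹) p (u / p) ≤ SS q β z u := by
  have h1 : res q β u ⊆ (res q β u).filter (fun n => Nat.Coprime n (PP q z)) ∪
      (sp q z).biUnion (fun p => (res q (β * (p : ZMod q)⁻¹) (u / p)).filter (fun n => Nat.Coprime n (PP q p)) |>.image (fun m => p * m)) := by
    intro n hn
    rw [Finset.mem_union, Finset.mem_filter]
    by_cases hc : Nat.Coprime n (PP q z)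
    · exact Or.inl ⟨hn, hc⟩
    right
    have hex : ∃ p, p ∈ sp q z ∧ p ∣ n := by
      rw [Nat.Prime.not_coprime_iff_dvd] at hc
      obtain ⟨p, hp, hpn, hpP⟩ := hc
      refine ⟨p, ?_, hpn⟩
      rw [← PP_primeFactors, Nat.mem_primeFactors]
      exact ⟨hp, hpP, (PP_pos q z).ne'⟩
    classical
    obtain ⟨hp1, hp2⟩ := Nat.find_spec hex
    set p := Nat.find hex with hpdef
    have hmin : ∀ r, r < p → ¬ (r ∈ sp q z ∧ r ∣ n) := fun r hr => Nat.find_min hex hr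
    clear_value p
    obtain ⟨m, rfl⟩ := hp2
    have hpp := sp_prime hp1
    rw [Finset.mem_biUnion]
    refine ⟨p, hp1, ?_⟩
    rw [Finset.mem_image]
    refine ⟨m, ?_, rfl⟩
    simp only [res, Finset.mem_filter, Finset.mem_Ioc] at hn ⊢
    have hp0 : (0 : ℝ) < p := by exact_mod_cast hpp.pos
    have hpu : IsUnit (p : ZMod q) := by
      rw [ZMod.isUnit_iff_coprime]
      exact (hpp.coprime_iff_not_dvd).2 (mem_sp.1 hp1).2.2
    refine ⟨⟨⟨Nat.pos_of_mul_pos_left hn.1.1, ?_⟩, ?_⟩, ?_⟩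
    · apply Nat.le_floor
      rw [le_div_iff₀ hp0]
      have := (Nat.le_floor_iff' hn.1.1.ne').1 hn.1.2
      push_cast at this; linarith
    · rw [← hn.2]; push_cast
      rw [mul_comm (p : ZMod q) m, mul_assoc, ZMod.mul_inv_of_unit _ hpu, mul_one]
    · by_contra hc2
      rw [Nat.Prime.not_coprime_iff_dvd] at hc2
      obtain ⟨r, hr, hrm, hrP⟩ := hc2
      have hr2 : r ∈ sp q p := by
        rw [← PP_primeFactors, Nat.mem_primeFactors]
        exact ⟨hr, hrP, (PP_pos q p).ne'⟩
      rw [mem_sp] at hr2 hp1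
      exact hmin r hr2.1 ⟨mem_sp.2 ⟨by omega, hr2.2⟩, Dvd.dvd.mul_left hrm p⟩
  have h2 := (Finset.card_le_card h1).trans (Finset.card_union_le _ _)
  have h3 := h2.trans (Nat.add_le_add_left (Finset.card_biUnion_le.trans (Finset.sum_le_sum (fun p _ => Finset.card_image_le))) _)
  have h4 : ((res q β u).card : ℝ) ≤ SS q β z u + ∑ p ∈ sp q z, SS q (β * (p : ZMod q)⁻¹) p (u / p) := by
    unfold SS; exact_mod_cast h3
  linarith

lemma exp_neg_le_sq {t : ℝ} (ht : 0 < t) : Real.exp (-t) ≤ 2 / t ^ 2 := by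
  rw [Real.exp_neg, ← one_div, div_le_div_iff₀ (Real.exp_pos _) (by positivity)]
  have := Real.quadratic_le_exp_of_nonneg ht.le
  linarith

/-- small power saving absorbed -/
lemma absorb {u ℓ : ℝ} (hu : 0 < u) (hℓ : 1 / 2 ≤ ℓ) (hℓu : ℓ ≤ Real.log u) :
    u ^ (-(1 / 4) : ℝ) ≤ (8 / ℓ) * Real.exp (-(1 / 64 * (Real.log u / ℓ))) := by
  have h1 : u ^ (-(1 / 4) : ℝ) = u ^ (-(1 / 8) : ℝ) * u ^ (-(1 / 8) : ℝ) := by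
    rw [← Real.rpow_add hu]; norm_num
  have hℓ0 : 0 < ℓ := by linarith
  rw [h1]
  apply mul_le_mul _ _ (by positivity) (by positivity)
  · rw [Real.rpow_neg hu.le, ← one_div, div_le_div_iff₀ (by positivity) hℓ0]
    have := log_le_rpow_inv hu (a := 1 / 8) (by norm_num)
    linarith
  · rw [Real.rpow_def_of_pos hu]
    apply Real.exp_le_exp.2
    have : Real.log u / ℓ ≤ 2 * Real.log u := by
      rw [div_le_iff₀ hℓ0]; nlinarith
    have h3 : 0 < Real.log u := by linarith
    linarith

/-- Lower bound, main range -/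
lemma FL_lower (q : ℕ) [NeZero q] (β : ZMod q) (z : ℕ) (u : ℝ) (hz : 2 ≤ z) (hqz : (q : ℝ) ^ 4 ≤ z)
    (hzu : (z : ℝ) ≤ u) (hK : 16 * KK * Real.log z ≤ Real.log (u / q)) :
    (u / q) * VV q z - (20000 * C1 + 32) * (u / (Nat.totient q * Real.log z) * Real.exp (-(1 / 64 * (Real.log u / Real.log z)))) ≤ SS q β z u := by
  have hKK := KK_one
  have hq : 0 < q := Nat.pos_of_ne_zero (NeZero.ne q)
  have hq0 : (0 : ℝ) < q := by exact_mod_cast hq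
  have hq1 : (1 : ℝ) ≤ q := by exact_mod_cast hq
  have hφ : (0 : ℝ) < Nat.totient q := by exact_mod_cast Nat.totient_pos.2 hq
  have hz2 : (2 : ℝ) ≤ z := by exact_mod_cast hz
  have hℓ : 1 / 2 ≤ Real.log z := by
    have h1 := Real.log_two_gt_d9
    have h2 := Real.log_le_log (by norm_num) hz2
    linarith
  have hu0 : 0 < u := by linarith
  have hℓu : Real.log z ≤ Real.log u := Real.log_le_log (by linarith) hzu
  set ℓ := Real.log z with hℓd
  set X := u / q with hX
  have hX0 : 0 < X := by positivity
  have hlX : Real.log X = Real.log u - Real.log q := by rw [hX, Real.log_div hu0.ne' hq0.ne']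
  have hlq : 4 * Real.log q ≤ ℓ := by
    have := Real.log_le_log (by positivity) hqz
    rw [Real.log_pow] at this; exact_mod_cast this
  have hlXu : 3 / 4 * Real.log u ≤ Real.log X := by linarith
  have hlXpos : 0 < Real.log X := by linarith
  have hlX16 : 16 * ℓ ≤ Real.log X := by nlinarith
  set F := Real.exp (-(1 / 64 * (Real.log u / ℓ))) with hF
  have hF0 : 0 < F := Real.exp_pos _
  -- bound for each prime
  have hp_bound : ∀ p ∈ sp q z, SS q (β * (p : ZMod q)⁻¹) p (u / p) ≤
      X * (VV q p / p) + 4096 * C1 * F * (u / Nat.totient q) * (1 / (Real.log X) ^ 2) * (Real.log p / p) + 2 * X ^ (1 / 2 : ℝ) := by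
    intro p hp
    have hpp := sp_prime hp
    have hp2 : (2 : ℝ) ≤ p := by exact_mod_cast hpp.two_le
    have hp0 : (0 : ℝ) < p := by linarith
    have hpz : (p : ℝ) ≤ z := by exact_mod_cast (mem_sp.1 hp).1.le
    have hlp0 : 0 < Real.log p := Real.log_pos (by linarith)
    have hlpz : Real.log p ≤ ℓ := Real.log_le_log hp0 hpz
    have eX : u / p / q = X / p := by rw [hX]; field_simp
    have hlXp : Real.log (X / p) = Real.log X - Real.log p := Real.log_div hX0.ne' hp0.ne'
    have hXp : Real.log X / 2 ≤ Real.log (X / p) := by linarith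
    have hXp1 : 1 ≤ u / p / q := by
      rw [eX]
      have : 0 < Real.log (X / p) := by linarith
      exact ((Real.log_pos_iff (by positivity)).1 this).le
    have hvp : Real.log X / (16 * Real.log p) ≤ Real.log (X / p) / (8 * Real.log p) := by
      rw [div_le_div_iff₀ (by positivity) (by positivity)]
      nlinarith
    have hv : KK ≤ Real.log (u / p / q) / (8 * Real.log p) := by
      rw [eX]
      refine le_trans ?_ hvp
      rw [le_div_iff₀ (by positivity)]
      nlinarith
    have h := SS_upper q (β * (p : ZMod q)⁻¹) p hpp.two_le (u / p) hXp1 hv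
    rw [eX] at h
    have hV := VV_pos q p
    have hVle : X * VV q p ≤ u / (Nat.totient q * Real.log p) := XV_le q p hpp.two_le u hu0.le
    have hexp : Real.exp (-(Real.log (X / p) / (8 * Real.log p))) ≤ F * (2048 * (Real.log p) ^ 2 / (Real.log X) ^ 2) := by
      have h1 : Real.exp (-(Real.log (X / p) / (8 * Real.log p))) ≤
          Real.exp (-(Real.log X / (32 * Real.log p))) * Real.exp (-(Real.log X / (32 * Real.log p))) := by
        rw [← Real.exp_add]
        apply Real.exp_le_exp.2
        have : Real.log X / (16 * Real.log p) = Real.log X / (32 * Real.log p) + Real.log X / (32 * Real.log p) := by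
          field_simp; norm_num
        linarith
      refine h1.trans ?_
      apply mul_le_mul _ _ (Real.exp_pos _).le hF0.le
      · apply Real.exp_le_exp.2
        have : 1 / 64 * (Real.log u / ℓ) ≤ Real.log X / (32 * Real.log p) := by
          rw [← mul_div_assoc, div_le_div_iff₀ (by linarith) (by positivity)]
          nlinarith
        linarith
      · refine (exp_neg_le_sq (by positivity)).trans (le_of_eq ?_)
        field_simp
        norm_num
    have hsq : (X / p) ^ (1 / 2 : ℝ) ≤ X ^ (1 / 2 : ℝ) := by
      apply Real.rpow_le_rpow (by positivity) _ (by norm_num)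
      apply div_le_self hX0.le; linarith
    have hmid : X / p * VV q p * (2 * C1 * Real.exp (-(Real.log (X / p) / (8 * Real.log p)))) ≤
        4096 * C1 * F * (u / Nat.totient q) * (1 / (Real.log X) ^ 2) * (Real.log p / p) := by
      have hC := C1_pos
      calc X / p * VV q p * (2 * C1 * Real.exp (-(Real.log (X / p) / (8 * Real.log p))))
          = (X * VV q p) * (1 / p) * (2 * C1 * Real.exp (-(Real.log (X / p) / (8 * Real.log p)))) := by ring
        _ ≤ (u / (Nat.totient q * Real.log p)) * (1 / p) * (2 * C1 * (F * (2048 * (Real.log p) ^ 2 / (Real.log X) ^ 2))) := by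
            gcongr
        _ = _ := by field_simp; ring
    calc _ ≤ _ := h
      _ = X * (VV q p / p) + X / p * VV q p * (2 * C1 * Real.exp (-(Real.log (X / p) / (8 * Real.log p)))) + 2 * (X / p) ^ (1 / 2 : ℝ) := by ring
      _ ≤ _ := by linarith
  have hsum := Finset.sum_le_sum hp_bound
  rw [Finset.sum_add_distrib, Finset.sum_add_distrib, ← Finset.mul_sum, ← Finset.mul_sum, VV_telescope, Finset.sum_const, nsmul_eq_mul] at hsum
  have hM : ∑ p ∈ sp q z, Real.log p / p ≤ 3 * ℓ := by
    refine le_trans ?_ (mertens_upper z hz)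
    apply Finset.sum_le_sum_of_subset_of_nonneg (Finset.filter_subset _ _)
    intro p _ _
    have := Real.log_natCast_nonneg p
    positivity
  have hcard : ((sp q z).card : ℝ) ≤ z := by
    have : (sp q z).card ≤ (Finset.range z).card := by
      apply Finset.card_le_card
      intro p hp
      exact Finset.mem_range.2 (mem_sp.1 hp).1
    simpa using this
  have hC := C1_pos
  set Q := u / (Nat.totient q * ℓ) with hQ
  have hℓ0 : 0 < ℓ := by linarith
  have hQ0 : 0 < Q := by positivity
  have hE1 : 4096 * C1 * F * (u / Nat.totient q) * (1 / (Real.log X) ^ 2) * ∑ p ∈ sp q z, Real.log p / p ≤ 20000 * C1 * (Q * F) := by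
    calc _ ≤ 4096 * C1 * F * (u / Nat.totient q) * (1 / ℓ ^ 2) * (3 * ℓ) := by
          gcongr; linarith
      _ = 12288 * C1 * (Q * F) := by rw [hQ]; field_simp; norm_num
      _ ≤ _ := by
        have : 0 < C1 * (Q * F) := by positivity
        linarith
  have hz16 : (z : ℝ) ≤ X ^ (1 / 16 : ℝ) := by
    rw [Real.rpow_def_of_pos hX0, ← Real.log_le_iff_le_exp (by linarith)]
    linarith
  have hX1 : 1 ≤ X ^ (9 / 16 : ℝ) := by
    apply Real.one_le_rpow _ (by norm_num)
    exact ((Real.log_pos_iff hX0.le).1 hlXpos).le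
  have hE2 : 2 + (z : ℝ) * (2 * X ^ (1 / 2 : ℝ)) ≤ 32 * (Q * F) := by
    have h1 : (z : ℝ) * X ^ (1 / 2 : ℝ) ≤ X ^ (9 / 16 : ℝ) := by
      calc (z : ℝ) * X ^ (1 / 2 : ℝ) ≤ X ^ (1 / 16 : ℝ) * X ^ (1 / 2 : ℝ) := by gcongr
        _ = _ := by rw [← Real.rpow_add hX0]; norm_num
    have h2 : X ^ (9 / 16 : ℝ) = X * X ^ (-(7 / 16) : ℝ) := by
      rw [show X * X ^ (-(7 / 16) : ℝ) = X ^ (1 : ℝ) * X ^ (-(7 / 16) : ℝ) by rw [Real.rpow_one], ← Real.rpow_add hX0]; norm_num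
    have h3 : X ^ (-(7 / 16) : ℝ) ≤ u ^ (-(1 / 4) : ℝ) := by
      rw [Real.rpow_def_of_pos hX0, Real.rpow_def_of_pos hu0]
      apply Real.exp_le_exp.2
      linarith
    have h4 := absorb hu0 hℓ hℓu
    have h5 : X ≤ Q * ℓ := by
      have : Q * ℓ = u / Nat.totient q := by rw [hQ]; field_simp
      rw [this, hX]
      gcongr; exact Nat.totient_le q
    have h6 : X ^ (9 / 16 : ℝ) ≤ 8 * (Q * F) := by
      rw [h2]
      calc X * X ^ (-(7 / 16) : ℝ) ≤ (Q * ℓ) * ((8 / ℓ) * F) := by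
            apply mul_le_mul h5 (h3.trans h4) (by positivity) (by positivity)
        _ = _ := by field_simp
    linarith
  have hb := buchstab q β z u
  have hc := (abs_le.1 (card_res q β u hu0.le)).1
  have hXh : 0 ≤ 2 * X ^ (1 / 2 : ℝ) := by positivity
  have hE3 : ((sp q z).card : ℝ) * (2 * X ^ (1 / 2 : ℝ)) ≤ (z : ℝ) * (2 * X ^ (1 / 2 : ℝ)) := by gcongr
  have : X * (1 - VV q z) = X - X * VV q z := by ring
  have hd : (20000 * C1 + 32) * (Q * F) = 20000 * C1 * (Q * F) + 32 * (Q * F) := by ring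
  rw [hd]
  linarith

end Gall

end

section

open Finset
namespace Gall

lemma FL : ∃ C > (0:ℝ), ∀ (q : ℕ) [NeZero q] (β : ZMod q) (z : ℕ) (u : ℝ), 2 ≤ z → (q:ℝ)^4 ≤ z →
    (z:ℝ) ≤ u → |SS q β z u - (u / q) * VV q z| ≤
      C * (u / (Nat.totient q * Real.log z) * Real.exp (-(1/64 * (Real.log u / Real.log z)))) := by
  obtain ⟨C2, hC2, hBT⟩ := SS_BT
  have hK := KK_one
  have hC1 := C1_pos
  refine ⟨(20000*C1+32) + (C2 + 1) * Real.exp KK, by positivity, ?_⟩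
  intro q _ β z u hz hqz hzu
  have hq : 0 < q := Nat.pos_of_ne_zero (NeZero.ne q)
  have hq0 : (0 : ℝ) < q := by exact_mod_cast hq
  have hq1 : (1 : ℝ) ≤ q := by exact_mod_cast hq
  have hz2 : (2:ℝ) ≤ z := by exact_mod_cast hz
  have hu0 : 0 < u := by linarith
  have hφ : (0 : ℝ) < Nat.totient q := by exact_mod_cast Nat.totient_pos.2 hq
  have hℓ : 1/2 ≤ Real.log z := by
    have := Real.log_le_log (by norm_num) hz2
    have := Real.log_two_gt_d9
    linarith
  have hℓ0 : 0 < Real.log z := by linarith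
  have hℓu : Real.log z ≤ Real.log u := Real.log_le_log (by linarith) hzu
  have hlq : 4 * Real.log q ≤ Real.log u := by
    have := Real.log_le_log (by positivity) (hqz.trans hzu)
    rw [Real.log_pow] at this; exact_mod_cast this
  have hlX : Real.log (u/q) = Real.log u - Real.log q := Real.log_div hu0.ne' hq0.ne'
  set F := u / (Nat.totient q * Real.log z) * Real.exp (-(1/64 * (Real.log u / Real.log z))) with hF
  have hF0 : 0 < F := by positivity
  have hXV := XV_le q z hz u hu0.le
  have hVp := VV_pos q z
  have hXV0 : 0 ≤ (u/q) * VV q z := by positivity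
  by_cases hc : 16 * KK * Real.log z ≤ Real.log (u/q)
  · have h1 := FL_lower q β z u hz hqz hzu hc
    have hX1 : 1 ≤ u / q := by
      rw [le_div_iff₀ hq0, one_mul]
      calc (q:ℝ) ≤ q^4 := le_self_pow₀ hq1 (by norm_num)
        _ ≤ u := hqz.trans hzu
    have hX0 : 0 < u / q := by linarith
    have h2 := SS_upper q β z hz u hX1 (by rw [le_div_iff₀ (by positivity)]; nlinarith)
    have hab := absorb hu0 hℓ hℓu
    have he : Real.exp (-(Real.log (u / q) / (8 * Real.log z))) ≤ Real.exp (-(1/64 * (Real.log u / Real.log z))) := by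
      apply Real.exp_le_exp.2
      have : 1/64 * (Real.log u / Real.log z) ≤ Real.log (u / q) / (8 * Real.log z) := by
        rw [le_div_iff₀ (by positivity)]
        have : 1/64 * (Real.log u / Real.log z) * (8 * Real.log z) = Real.log u / 8 := by
          field_simp; ring
        rw [this]; linarith
      linarith
    have h3 : (u / q) * VV q z * (2 * C1 * Real.exp (-(Real.log (u / q) / (8 * Real.log z)))) ≤ 2 * C1 * F := by
      calc _ ≤ u / (Nat.totient q * Real.log z) * (2 * C1 * Real.exp (-(1/64 * (Real.log u / Real.log z)))) := by
            gcongr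
        _ = _ := by rw [hF]; ring
    have h4 : 2 * (u / q) ^ (1 / 2 : ℝ) ≤ 16 * F := by
      have e1 : (u / q) ^ (1 / 2 : ℝ) = (u/q) * (u/q)^(-(1/2):ℝ) := by
        nth_rw 2 [← Real.rpow_one (u/q)]
        rw [← Real.rpow_add hX0]; norm_num
      have e2 : (u/q)^(-(1/2):ℝ) ≤ u ^ (-(1/4):ℝ) := by
        rw [Real.rpow_def_of_pos hX0, Real.rpow_def_of_pos hu0]
        apply Real.exp_le_exp.2
        linarith
      have e3 : u / q ≤ u / Nat.totient q := by
        gcongr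
        exact Nat.totient_le q
      calc 2 * (u / q) ^ (1 / 2 : ℝ) = 2 * ((u/q) * (u/q)^(-(1/2):ℝ)) := by rw [e1]
        _ ≤ 2 * ((u / Nat.totient q) * ((8/Real.log z) * Real.exp (-(1/64*(Real.log u/Real.log z))))) := by
            gcongr
            exact e2.trans hab
        _ = 16 * F := by rw [hF]; field_simp; norm_num
    have h5 : 0 ≤ (C2 + 1) * Real.exp KK * F := by positivity
    have h6 : 0 ≤ C1 * F := by positivity
    rw [abs_le]
    constructor
    · nlinarith
    · nlinarith
  · push Not at hc
    have hlu : Real.log u ≤ 64 * KK * Real.log z := by nlinarith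
    have hq2 : (q:ℝ)^2 ≤ u := (pow_le_pow_right₀ hq1 (by norm_num)).trans (hqz.trans hzu)
    have h1 := hBT q β z u hz hq2 hzu
    have h0 := SS_nonneg q β z u
    have he : 1 ≤ Real.exp KK * Real.exp (-(1/64 * (Real.log u / Real.log z))) := by
      rw [← Real.exp_add]
      apply Real.one_le_exp
      have : Real.log u / Real.log z ≤ 64 * KK := by rw [div_le_iff₀ hℓ0]; exact hlu
      linarith
    have h2 : u / (Nat.totient q * Real.log z) ≤ Real.exp KK * F := by
      have : 0 < u / (Nat.totient q * Real.log z) := by positivity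
      rw [hF]; nlinarith
    have h6 : 0 ≤ C1 * F := by positivity
    have h7 : C2 * (u / (Nat.totient q * Real.log z)) ≤ C2 * (Real.exp KK * F) := by gcongr
    have h8 : 0 ≤ Real.exp KK * F := by positivity
    have h9 : 0 ≤ C2 * (Real.exp KK * F) := by positivity
    rw [abs_le]
    constructor
    · nlinarith
    · nlinarith



def Rough (z n : ℕ) : Prop := 1 < n ∧ ∀ p : ℕ, p.Prime → p < z → ¬ p ∣ n

lemma Rough.le {z n : ℕ} (h : Rough z n) : z ≤ n := by
  by_contra hlt
  push Not at hlt
  exact h.2 n.minFac (Nat.minFac_prime (by have := h.1; omega)) ((Nat.minFac_le (by have := h.1; omega)).trans_lt hlt)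
    (Nat.minFac_dvd n)

lemma Rough.coprime {q z n : ℕ} (hq : 0 < q) (hqz : q < z) (h : Rough z n) : Nat.Coprime n q := by
  rw [Nat.coprime_iff_gcd_eq_one]
  by_contra hg
  have hp := Nat.minFac_prime hg
  exact h.2 _ hp (((Nat.minFac_le (Nat.gcd_pos_of_pos_right _ hq)).trans
    (Nat.le_of_dvd hq (Nat.gcd_dvd_right n q))).trans_lt hqz) ((Nat.minFac_dvd _).trans (Nat.gcd_dvd_left _ _))

lemma coprime_PP_iff (q z n : ℕ) : Nat.Coprime n (PP q z) ↔ ∀ p : ℕ, p.Prime → p < z → ¬ p ∣ q → ¬ p ∣ n := by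
  unfold PP
  rw [Nat.coprime_prod_right_iff]
  constructor
  · intro h p hp hpz hpq hpn
    have := h p (mem_sp.2 ⟨hpz, hp, hpq⟩)
    exact (Nat.Prime.coprime_iff_not_dvd hp).1 this.symm hpn
  · intro h p hp
    rw [mem_sp] at hp
    exact ((Nat.Prime.coprime_iff_not_dvd hp.2.1).2 (h p hp.2.1 hp.1 hp.2.2)).symm

lemma rough_iff {q z n : ℕ} (hn : Nat.Coprime n q) : Rough z n ↔ 1 < n ∧ Nat.Coprime n (PP q z) := by
  rw [coprime_PP_iff]
  constructor
  · rintro ⟨h1, h2⟩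
    exact ⟨h1, fun p hp hpz _ => h2 p hp hpz⟩
  · rintro ⟨h1, h2⟩
    refine ⟨h1, fun p hp hpz hpn => h2 p hp hpz ?_ hpn⟩
    intro hpq
    exact hp.one_lt.ne' (Nat.dvd_one.1 (hn ▸ Nat.dvd_gcd hpn hpq))

open Classical in
noncomputable def NN (q z : ℕ) (β : ZMod q) (u : ℝ) : ℝ :=
  (((Icc 1 ⌊u⌋₊).filter (fun n : ℕ => Rough z n ∧ (n : ZMod q) = β)).card : ℝ)

lemma NN_nonneg (q z : ℕ) (β : ZMod q) (u : ℝ) : 0 ≤ NN q z β u := by unfold NN; positivity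

lemma NN_SS (q z : ℕ) (β : (ZMod q)ˣ) (u : ℝ) : NN q z β u ≤ SS q β z u ∧ SS q β z u ≤ NN q z β u + 1 := by
  classical
  have key : ∀ n : ℕ, (n : ZMod q) = β → Nat.Coprime n q := by
    intro n hn
    rw [← ZMod.isUnit_iff_coprime, hn]; exact β.isUnit
  unfold NN SS res
  constructor
  · norm_cast
    apply Finset.card_le_card
    intro n hn
    simp only [mem_filter, mem_Icc, mem_Ioc] at hn ⊢
    exact ⟨⟨⟨hn.1.1, hn.1.2⟩, hn.2.2⟩, ((rough_iff (key n hn.2.2)).1 hn.2.1).2⟩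
  · norm_cast
    rw [← Finset.card_singleton 1]
    refine (Finset.card_le_card ?_).trans (Finset.card_union_le _ _)
    intro n hn
    simp only [mem_filter, mem_Icc, mem_Ioc, mem_union, mem_singleton] at hn ⊢
    by_cases h1 : n = 1
    · exact Or.inr h1
    · left
      exact ⟨⟨hn.1.1.1, hn.1.1.2⟩, (rough_iff (key n hn.1.2)).2 ⟨by omega, hn.2⟩, hn.1.2⟩

lemma NN_zero (q z : ℕ) (β : ZMod q) (u : ℝ) (hu : u < z) : NN q z β u = 0 := by
  classical
  unfold NN
  norm_cast
  rw [Finset.card_eq_zero, Finset.filter_eq_empty_iff]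
  rintro n hn ⟨h1, -⟩
  have h2 := h1.le
  rw [mem_Icc] at hn
  have : (n:ℝ) ≤ u := (Nat.le_floor_iff' (by omega)).1 hn.2
  have h3 : (z:ℝ) ≤ n := by exact_mod_cast h2
  linarith

open Classical in
noncomputable def cE (q z : ℕ) (β : ZMod q) (n : ℕ) : ℝ :=
  if Rough z n then ((if (n : ZMod q) = β then 1 else 0) - 1 / (Nat.totient q : ℝ)) else 0

noncomputable def EE (q z : ℕ) (β : ZMod q) (u : ℝ) : ℝ := ∑ n ∈ Icc 1 ⌊u⌋₊, cE q z β n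

lemma EE_eq (q z : ℕ) [NeZero q] (hqz : q < z) (β : ZMod q) (u : ℝ) :
    EE q z β u = NN q z β u - 1 / (Nat.totient q : ℝ) * ∑ γ : (ZMod q)ˣ, NN q z γ u := by
  classical
  unfold EE NN
  have hq : 0 < q := Nat.pos_of_ne_zero (NeZero.ne q)
  have e : ∀ n : ℕ, cE q z β n = (if Rough z n ∧ (n : ZMod q) = β then 1 else 0) -
      1 / (Nat.totient q : ℝ) * ∑ γ : (ZMod q)ˣ, (if Rough z n ∧ (n : ZMod q) = γ then 1 else 0) := by
    intro n
    unfold cE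
    by_cases h : Rough z n
    · have hu := (ZMod.isUnit_iff_coprime n q).2 (h.coprime hq hqz)
      obtain ⟨γ0, hγ0⟩ := hu
      have : ∑ γ : (ZMod q)ˣ, (if Rough z n ∧ (n : ZMod q) = γ then (1:ℝ) else 0) = 1 := by
        rw [Finset.sum_eq_single γ0]
        · simp [h, hγ0]
        · intro b _ hb
          rw [if_neg]
          rintro ⟨_, h2⟩
          exact hb (Units.ext (h2.symm.trans hγ0.symm))
        · simp
      rw [this]
      simp [h]
    · simp [h]
  rw [Finset.sum_congr rfl (fun n _ => e n), Finset.sum_sub_distrib, ← Finset.mul_sum, Finset.sum_comm]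
  simp only [Finset.card_filter]
  push_cast
  rfl

lemma EE_bound : ∃ C > (0:ℝ), ∀ (q : ℕ) [NeZero q] (β : (ZMod q)ˣ) (z : ℕ) (u : ℝ), 2 ≤ q → (q:ℝ)^4 ≤ z →
    (u < z → EE q z β u = 0) ∧ ((z:ℝ) ≤ u → |EE q z β u| ≤
      C * (u / (Nat.totient q * Real.log z) * Real.exp (-(1/64 * (Real.log u / Real.log z))))) := by
  obtain ⟨C, hC, hFL⟩ := FL
  refine ⟨2 * C + 16, by positivity, ?_⟩
  intro q _ β z u hq2 hqz
  have hq0 : 0 < q := by omega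
  have hqr : (2:ℝ) ≤ q := by exact_mod_cast hq2
  have hqz' : q < z := by
    have : (q:ℝ) < q^4 := lt_self_pow₀ (by linarith) (by norm_num)
    exact_mod_cast this.trans_le hqz
  have hz2 : 2 ≤ z := by omega
  have hz2r : (2:ℝ) ≤ z := by exact_mod_cast hz2
  constructor
  · intro hu
    rw [EE_eq q z hqz', NN_zero q z _ u hu]
    simp [NN_zero q z _ u hu]
  · intro hzu
    have hu0 : 0 < u := by linarith
    have hφ : (0 : ℝ) < Nat.totient q := by exact_mod_cast Nat.totient_pos.2 hq0
    have hℓ : 1/2 ≤ Real.log z := by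
      have := Real.log_le_log (by norm_num) hz2r
      have := Real.log_two_gt_d9
      linarith
    have hℓ0 : 0 < Real.log z := by linarith
    have hℓu : Real.log z ≤ Real.log u := Real.log_le_log (by linarith) hzu
    set F := u / (Nat.totient q * Real.log z) * Real.exp (-(1/64 * (Real.log u / Real.log z))) with hF
    have h1F : 1 ≤ 8 * F := by
      have hab := absorb hu0 hℓ hℓu
      have h1 : (q:ℝ) ≤ u ^ (1/4:ℝ) := by
        calc (q:ℝ) = ((q:ℝ)^4)^(1/4:ℝ) := by
              rw [← Real.rpow_natCast, ← Real.rpow_mul (by positivity)]; norm_num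
          _ ≤ u ^ (1/4:ℝ) := by gcongr; exact hqz.trans hzu
      have h2 : (Nat.totient q:ℝ) ≤ u ^ (1/4:ℝ) := (totient_le' q).trans h1
      have h3 : u ^ (1/4:ℝ) ≤ u * u ^ (-(1/4):ℝ) := by
        nth_rw 2 [← Real.rpow_one u]
        rw [← Real.rpow_add hu0]
        exact Real.rpow_le_rpow_of_exponent_le (by linarith) (by norm_num)
      calc (1:ℝ) = Nat.totient q / Nat.totient q := (div_self hφ.ne').symm
        _ ≤ u * u ^ (-(1/4):ℝ) / Nat.totient q := by gcongr; exact h2.trans h3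
        _ ≤ u * ((8 / Real.log z) * Real.exp (-(1 / 64 * (Real.log u / Real.log z)))) / Nat.totient q := by gcongr
        _ = 8 * F := by rw [hF]; field_simp
    have hdiff : ∀ γ : (ZMod q)ˣ, |NN q z β u - NN q z γ u| ≤ (2 * C + 16) * F := by
      intro γ
      have a1 := NN_SS q z β u
      have a2 := NN_SS q z γ u
      have a3 := abs_le.1 (hFL q β z u hz2 hqz hzu)
      have a4 := abs_le.1 (hFL q γ z u hz2 hqz hzu)
      rw [abs_le]; constructor <;> nlinarith
    rw [EE_eq q z hqz']
    have hcard : (Fintype.card (ZMod q)ˣ : ℝ) = Nat.totient q := by rw [ZMod.card_units_eq_totient]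
    have e : NN q z β u - 1 / (Nat.totient q : ℝ) * ∑ γ : (ZMod q)ˣ, NN q z γ u =
        1 / (Nat.totient q : ℝ) * ∑ γ : (ZMod q)ˣ, (NN q z β u - NN q z γ u) := by
      rw [Finset.sum_sub_distrib, Finset.sum_const, Finset.card_univ, nsmul_eq_mul, hcard]
      field_simp
    rw [e, abs_mul, abs_of_pos (by positivity)]
    calc 1 / (Nat.totient q : ℝ) * |∑ γ : (ZMod q)ˣ, (NN q z β u - NN q z γ u)|
        ≤ 1 / (Nat.totient q : ℝ) * ∑ γ : (ZMod q)ˣ, (2 * C + 16) * F := by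
          gcongr
          exact (Finset.abs_sum_le_sum_abs _ _).trans (Finset.sum_le_sum fun γ _ => hdiff γ)
      _ = (2 * C + 16) * F := by
          rw [Finset.sum_const, Finset.card_univ, nsmul_eq_mul, hcard]
          field_simp

/-- Normalised remainder. -/
noncomputable def hE (q z : ℕ) (β : ZMod q) (v : ℝ) : ℝ := EE q z β (Real.exp v) * Real.exp (-v)

lemma hE_measurable (q z : ℕ) (β : ZMod q) : Measurable (hE q z β) := by
  have h1 : Measurable (fun v : ℝ => EE q z β (Real.exp v)) := by
    have h2 : Measurable (fun n : ℕ => ∑ n ∈ Icc 1 n, cE q z β n) := measurable_from_nat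
    exact h2.comp (Nat.measurable_floor.comp Real.measurable_exp)
  exact h1.mul (Real.measurable_exp.comp measurable_neg)

lemma hE_bound : ∃ C > (0:ℝ), ∀ (q : ℕ) [NeZero q] (β : (ZMod q)ˣ) (z : ℕ), 2 ≤ q → (q:ℝ)^4 ≤ z →
    ∀ v : ℝ, (v < Real.log z → hE q z β v = 0) ∧ |hE q z β v| ≤
      C / (Nat.totient q * Real.log z) * Real.exp (-(1 / (64 * Real.log z) * v)) := by
  obtain ⟨C, hC, hEE⟩ := EE_bound
  refine ⟨C, hC, ?_⟩
  intro q _ β z hq hqz v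
  obtain ⟨h1, h2⟩ := hEE q β z (Real.exp v) hq hqz
  have hz0 : (0:ℝ) < z := lt_of_lt_of_le (by have : (0:ℝ) < q := by exact_mod_cast (by omega : 0 < q)
                                             positivity) hqz
  have hz1 : (1:ℝ) ≤ z := by exact_mod_cast Nat.one_le_iff_ne_zero.2 (by rintro rfl; simp at hz0)
  have hz : v < Real.log z → hE q z β v = 0 := by
    intro hv
    unfold hE
    rw [h1 (by rwa [← Real.lt_log_iff_exp_lt hz0]), zero_mul]
  refine ⟨hz, ?_⟩
  by_cases hv : v < Real.log z
  · rw [hz hv, abs_zero]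
    have : 0 ≤ Real.log z := Real.log_nonneg hz1
    positivity
  · push Not at hv
    have := h2 (by rwa [← Real.log_le_iff_le_exp hz0])
    unfold hE
    rw [abs_mul, abs_of_pos (Real.exp_pos (-v))]
    calc _ ≤ C * (Real.exp v / (Nat.totient q * Real.log z) * Real.exp (-(1/64 * (Real.log (Real.exp v) / Real.log z)))) * Real.exp (-v) := by gcongr
      _ = C / (Nat.totient q * Real.log z) * Real.exp (-(1/64 * (v / Real.log z))) * (Real.exp v * Real.exp (-v)) := by
          rw [Real.log_exp]; ring
      _ = _ := by
          rw [← Real.exp_add, add_neg_cancel, Real.exp_zero, mul_one]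
          congr 3; rw [div_mul_eq_mul_div, one_mul, ← div_div]; ring

end Gall

end

section

open Finset MeasureTheory
namespace Gall

/-- `j`-th derivative of the Laplace transform of `h`. -/
noncomputable def Lp (h : ℝ → ℂ) (j : ℕ) (w : ℂ) : ℂ :=
  ∫ v in Set.Ioi (0:ℝ), (-(v:ℂ)) ^ j * h v * Complex.exp (-w * v)

lemma integrableOn_pow_exp (j : ℕ) {b : ℝ} (hb : 0 < b) :
    IntegrableOn (fun v : ℝ => v ^ j * Real.exp (-(b * v))) (Set.Ioi 0) := by
  have := integrableOn_rpow_mul_exp_neg_mul_rpow (p := 1) (s := j) (b := b)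
    (by have : (0:ℝ) ≤ j := Nat.cast_nonneg j
        linarith) (by norm_num) hb
  refine this.congr_fun ?_ measurableSet_Ioi
  intro v hv
  simp

lemma integral_pow_exp (j : ℕ) {b : ℝ} (hb : 0 < b) :
    ∫ v in Set.Ioi (0:ℝ), v ^ j * Real.exp (-(b * v)) = (Nat.factorial j) / b ^ (j+1) := by
  have := Real.integral_rpow_mul_exp_neg_mul_Ioi (a := j + 1) (r := b) (by positivity) hb
  rw [Real.Gamma_nat_eq_factorial] at this
  have e : ∫ t in Set.Ioi (0:ℝ), t ^ (((j:ℝ) + 1) - 1) * Real.exp (-(b * t)) =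
      ∫ v in Set.Ioi (0:ℝ), v ^ j * Real.exp (-(b * v)) := by
    apply setIntegral_congr_fun measurableSet_Ioi
    intro v hv
    simp
  rw [← e, this]
  rw [show ((j:ℝ) + 1) = ((j+1 : ℕ) : ℝ) by push_cast; ring, Real.rpow_natCast]
  rw [one_div, inv_pow]; field_simp

section
variable {h : ℝ → ℂ} {B a : ℝ}

lemma Lp_integrand_norm (j : ℕ) (w : ℂ) {v : ℝ} (hv : 0 < v) :
    ‖(-(v:ℂ)) ^ j * h v * Complex.exp (-w * v)‖ = v ^ j * ‖h v‖ * Real.exp (-(w.re * v)) := by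
  rw [norm_mul, norm_mul, norm_pow, norm_neg, Complex.norm_real, Real.norm_of_nonneg hv.le, Complex.norm_exp]
  simp

lemma Lp_integrand_le (hb : ∀ v, ‖h v‖ ≤ B * Real.exp (-(a * v))) (j : ℕ) (w : ℂ) {b : ℝ} (hbw : b ≤ a + w.re)
    {v : ℝ} (hv : 0 < v) :
    ‖(-(v:ℂ)) ^ j * h v * Complex.exp (-w * v)‖ ≤ B * (v ^ j * Real.exp (-(b * v))) := by
  rw [Lp_integrand_norm j w hv]
  have hB : 0 ≤ B := by
    by_contra hB
    push Not at hB
    have := (norm_nonneg _).trans (hb 0)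
    simp at this; linarith
  calc v ^ j * ‖h v‖ * Real.exp (-(w.re * v)) ≤ v ^ j * (B * Real.exp (-(a*v))) * Real.exp (-(w.re * v)) := by
        gcongr; exact hb v
    _ = B * (v ^ j * Real.exp (-((a + w.re) * v))) := by
        rw [show -((a + w.re) * v) = -(a*v) + -(w.re * v) by ring, Real.exp_add]; ring
    _ ≤ _ := by gcongr

lemma Lp_integrand_meas (hm : Measurable h) (j : ℕ) (w : ℂ) :
    Measurable (fun v : ℝ => (-(v:ℂ)) ^ j * h v * Complex.exp (-w * v)) := by
  fun_prop

lemma Lp_integrable (hm : Measurable h) (hb : ∀ v, ‖h v‖ ≤ B * Real.exp (-(a * v))) (j : ℕ) (w : ℂ)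
    (hw : -a < w.re) :
    IntegrableOn (fun v : ℝ => (-(v:ℂ)) ^ j * h v * Complex.exp (-w * v)) (Set.Ioi 0) := by
  have h1 := ((integrableOn_pow_exp j (b := a + w.re) (by linarith)).const_mul B)
  refine h1.mono' (Lp_integrand_meas hm j w).aestronglyMeasurable ?_
  filter_upwards [ae_restrict_mem measurableSet_Ioi] with v hv
  exact Lp_integrand_le hb j w le_rfl hv

lemma Lp_norm_le (hb : ∀ v, ‖h v‖ ≤ B * Real.exp (-(a * v))) (j : ℕ) (w : ℂ)
    (hw : -a < w.re) : ‖Lp h j w‖ ≤ B * ((Nat.factorial j) / (a + w.re) ^ (j+1)) := by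
  unfold Lp
  have h1 := ((integrableOn_pow_exp j (b := a + w.re) (by linarith)).const_mul B)
  have h2 := norm_integral_le_of_norm_le h1 (f := fun v : ℝ => (-(v:ℂ)) ^ j * h v * Complex.exp (-w * v)) (by
    filter_upwards [ae_restrict_mem measurableSet_Ioi] with v hv
    exact Lp_integrand_le hb j w le_rfl hv)
  refine h2.trans_eq ?_
  rw [integral_const_mul, integral_pow_exp j (by linarith)]

lemma Lp_hasDerivAt (hm : Measurable h) (hb : ∀ v, ‖h v‖ ≤ B * Real.exp (-(a * v))) (j : ℕ) (w : ℂ)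
    (hw : -a < w.re) : HasDerivAt (Lp h j) (Lp h (j+1) w) w := by
  unfold Lp
  have hr : 0 < (a + w.re) / 2 := by linarith
  refine (hasDerivAt_integral_of_dominated_loc_of_deriv_le (𝕜 := ℂ)
    (F := fun w v => (-(v:ℂ)) ^ j * h v * Complex.exp (-w * v))
    (F' := fun w v => (-(v:ℂ)) ^ (j+1) * h v * Complex.exp (-w * v))
    (bound := fun v => B * (v ^ (j+1) * Real.exp (-((a + w.re)/2 * v)))) (Metric.ball_mem_nhds w hr)
    ?_ ?_ ?_ ?_ ?_ ?_).2
  · exact Filter.Eventually.of_forall fun x => (Lp_integrand_meas hm j x).aestronglyMeasurable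
  · exact Lp_integrable hm hb j w hw
  · exact (Lp_integrand_meas hm (j+1) w).aestronglyMeasurable
  · filter_upwards [ae_restrict_mem measurableSet_Ioi] with v hv x hx
    apply Lp_integrand_le hb (j+1) x _ hv
    rw [Metric.mem_ball, dist_eq_norm] at hx
    have := (abs_le.1 ((Complex.abs_re_le_norm (x - w)).trans hx.le)).1
    rw [Complex.sub_re] at this
    linarith
  · exact (integrableOn_pow_exp (j+1) hr).const_mul B
  · refine Filter.Eventually.of_forall fun v x _ => ?_
    have h1 : HasDerivAt (fun x : ℂ => -x * v) (-1 * v) x := ((hasDerivAt_id x).neg).mul_const _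
    have h2 := (h1.cexp).const_mul ((-(v:ℂ)) ^ j * h v)
    exact h2.congr_deriv (by rw [pow_succ]; ring)

end

lemma integrable_sq_gauss {f : ℝ → ℂ} (hf2 : Integrable (fun v => ‖f v‖ ^ 2)) :
    Integrable (fun p : ℝ × ℝ => ‖f p.2‖ ^ 2 * Real.exp (-(1/4) * (p.1 - p.2) ^ 2)) (volume.prod volume) := by
  have hg : Integrable (fun x : ℝ => Real.exp (-(1/4) * x ^ 2)) := integrable_exp_neg_mul_sq (by norm_num)
  exact hf2.convolution_integrand (ContinuousLinearMap.mul ℝ ℝ) hg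

/-- Mean-square bound for Fourier integrals. -/
lemma fourier_mean_square {f : ℝ → ℂ} (hf : Integrable f)
    (hf2 : Integrable (fun v => ‖f v‖ ^ 2)) :
    ∫ t in (-1:ℝ)..1, ‖∫ v, f v * Complex.exp (-(Complex.I * t * v))‖ ^ 2 ≤ 18 * ∫ v, ‖f v‖ ^ 2 := by
  set F : ℝ → ℂ := fun t => ∫ v, f v * Complex.exp (-(Complex.I * t * v)) with hF
  have hun : ∀ t v : ℝ, ‖Complex.exp (-(Complex.I * t * v))‖ = 1 := by
    intro t v
    rw [Complex.norm_exp]; simp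
  have hFc : Continuous F := by
    apply continuous_of_dominated (bound := fun v => ‖f v‖)
    · intro t
      exact hf.aestronglyMeasurable.mul (by fun_prop)
    · intro t
      refine Filter.Eventually.of_forall fun v => ?_
      rw [norm_mul, hun, mul_one]
    · exact hf.norm
    · refine Filter.Eventually.of_forall fun v => ?_
      fun_prop
  have hg : Integrable (fun x : ℝ => Real.exp (-1 * x ^ 2)) := integrable_exp_neg_mul_sq (by norm_num)
  have hFb : ∀ t, ‖F t‖ ≤ ∫ v, ‖f v‖ := by
    intro t
    refine (norm_integral_le_integral_norm _).trans_eq ?_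
    congr 1; ext v; rw [norm_mul, hun, mul_one]
  have hgF : Integrable (fun t : ℝ => Real.exp (-1 * t ^ 2) * ‖F t‖ ^ 2) := by
    refine hg.mul_bdd (c := (∫ v, ‖f v‖)^2) ?_ ?_
    · exact (hFc.norm.pow 2).aestronglyMeasurable
    · refine Filter.Eventually.of_forall fun t => ?_
      rw [norm_pow, norm_norm]
      exact pow_le_pow_left₀ (norm_nonneg _) (hFb t) 2
  have step1 : ∫ t in (-1:ℝ)..1, ‖F t‖ ^ 2 ≤ Real.exp 1 * ∫ t : ℝ, Real.exp (-1 * t ^ 2) * ‖F t‖ ^ 2 := by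
    rw [← integral_const_mul]
    calc ∫ t in (-1:ℝ)..1, ‖F t‖ ^ 2 ≤ ∫ t in (-1:ℝ)..1, Real.exp 1 * (Real.exp (-1 * t ^ 2) * ‖F t‖ ^ 2) := by
          apply intervalIntegral.integral_mono_on (by norm_num)
          · exact (hFc.norm.pow 2).intervalIntegrable _ _
          · apply Continuous.intervalIntegrable
            have := hFc.norm
            fun_prop
          · intro t ht
            rw [← mul_assoc, ← Real.exp_add]
            have : 1 ≤ Real.exp (1 + -1 * t ^ 2) := Real.one_le_exp (by nlinarith [ht.1, ht.2])
            nlinarith [sq_nonneg ‖F t‖]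
      _ = ∫ t in Set.Ioc (-1:ℝ) 1, Real.exp 1 * (Real.exp (-1 * t ^ 2) * ‖F t‖ ^ 2) :=
          intervalIntegral.integral_of_le (by norm_num)
      _ ≤ _ := by
          apply setIntegral_le_integral (hgF.const_mul _)
          refine Filter.Eventually.of_forall fun t => ?_
          positivity
  -- Fubini
  have step2 : ((∫ t : ℝ, Real.exp (-1 * t ^ 2) * ‖F t‖ ^ 2 : ℝ) : ℂ) =
      ∫ p : ℝ × ℝ, f p.1 * starRingEnd ℂ (f p.2) *
        (((Real.pi : ℂ) / 1) ^ (1 / 2 : ℂ) * Complex.exp (-((p.2 - p.1 : ℝ) : ℂ) ^ 2 / (4 * 1)))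
        ∂(volume.prod volume) := by
    have e1 : ∀ t : ℝ, ((Real.exp (-1 * t ^ 2) * ‖F t‖ ^ 2 : ℝ) : ℂ) =
        ∫ p : ℝ × ℝ, f p.1 * starRingEnd ℂ (f p.2) *
          (Complex.exp (Complex.I * ((p.2 - p.1 : ℝ) : ℂ) * t) * Complex.exp (-1 * (t:ℂ) ^ 2)) ∂(volume.prod volume) := by
      intro t
      have e2 : ((‖F t‖ ^ 2 : ℝ) : ℂ) = F t * starRingEnd ℂ (F t) := by
        rw [Complex.mul_conj, Complex.normSq_eq_norm_sq]
      rw [Complex.ofReal_mul, e2]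
      have e3 : starRingEnd ℂ (F t) = ∫ v, starRingEnd ℂ (f v * Complex.exp (-(Complex.I * t * v))) :=
        integral_conj.symm
      rw [e3, hF, ← integral_prod_mul, ← integral_const_mul]
      congr 1; ext p
      rw [map_mul, ← Complex.exp_conj]
      simp only [map_neg, map_mul, Complex.conj_I, Complex.conj_ofReal]
      push_cast
      rw [show Complex.I * ((p.2:ℂ) - p.1) * t = -(Complex.I * t * p.1) + -(-Complex.I * t * p.2) by ring,
        Complex.exp_add]
      ring
    rw [← integral_complex_ofReal]
    rw [integral_congr_ae (Filter.Eventually.of_forall e1)]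
    rw [integral_integral_swap]
    · congr 1; ext p
      rw [integral_const_mul]
      congr 1
      exact fourierIntegral_gaussian (b := 1) (by simp) _
    · have hInteg : Integrable (fun p : ℝ × (ℝ × ℝ) => Complex.exp (-1 * (p.1:ℂ) ^ 2) *
          (f p.2.1 * starRingEnd ℂ (f p.2.2))) (volume.prod (volume.prod volume)) := by
        have i1 : Integrable (fun t : ℝ => Complex.exp (-1 * (t:ℂ) ^ 2)) := by
          have := hg.ofReal (𝕜 := ℂ)
          refine this.congr (Filter.Eventually.of_forall fun t => ?_)
          simp
        have i2 : Integrable (fun p : ℝ × ℝ => f p.1 * starRingEnd ℂ (f p.2)) (volume.prod volume) := by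
          have hcf : Integrable (fun v => starRingEnd ℂ (f v)) := by
            have := (Complex.conjCLE.toContinuousLinearMap).integrable_comp hf
            exact this
          exact hf.mul_prod hcf
        exact i1.mul_prod i2
      have := hInteg.bdd_mul (c := 1) (f := fun p : ℝ × (ℝ × ℝ) => Complex.exp (Complex.I * ((p.2.2 - p.2.1 : ℝ) : ℂ) * p.1)) (by
        apply Continuous.aestronglyMeasurable; fun_prop) (by
        refine Filter.Eventually.of_forall fun p => ?_
        rw [Complex.norm_exp]; simp)
      refine this.congr (Filter.Eventually.of_forall fun p => ?_)
      simp only [Function.uncurry]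
      ring
  have hG := integrable_sq_gauss hf2
  have hG' : Integrable (fun p : ℝ × ℝ => ‖f p.1‖ ^ 2 * Real.exp (-(1/4) * (p.1 - p.2) ^ 2)) (volume.prod volume) := by
    have := hG.swap
    refine this.congr (Filter.Eventually.of_forall fun p => ?_)
    simp only [Function.comp, Prod.fst_swap, Prod.snd_swap]
    congr 2; ring
  have hval : ∫ p : ℝ × ℝ, ‖f p.2‖ ^ 2 * Real.exp (-(1/4) * (p.1 - p.2) ^ 2) ∂(volume.prod volume) =
      Real.sqrt (Real.pi / (1/4)) * ∫ v, ‖f v‖ ^ 2 := by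
    rw [integral_prod_symm _ hG]
    rw [← integral_const_mul]
    congr 1; ext v
    simp only
    rw [integral_const_mul, mul_comm]
    congr 1
    rw [integral_sub_right_eq_self (fun x : ℝ => Real.exp (-(1/4) * x ^ 2)) v]
    exact integral_gaussian _
  have hval' : ∫ p : ℝ × ℝ, ‖f p.1‖ ^ 2 * Real.exp (-(1/4) * (p.1 - p.2) ^ 2) ∂(volume.prod volume) =
      Real.sqrt (Real.pi / (1/4)) * ∫ v, ‖f v‖ ^ 2 := by
    rw [← hval, ← integral_prod_swap]
    congr 1; ext p
    simp only [Prod.fst_swap, Prod.snd_swap]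
    congr 2; ring
  have step3 : ∫ t : ℝ, Real.exp (-1 * t ^ 2) * ‖F t‖ ^ 2 ≤ 2 * Real.pi * ∫ v, ‖f v‖ ^ 2 := by
    have h0 : 0 ≤ ∫ t : ℝ, Real.exp (-1 * t ^ 2) * ‖F t‖ ^ 2 := integral_nonneg fun t => by positivity
    rw [← Real.norm_of_nonneg h0, ← Complex.norm_real, step2]
    have hb := norm_integral_le_of_norm_le (μ := (volume.prod volume : Measure (ℝ × ℝ))) ((hG.add hG').const_mul (Real.sqrt Real.pi / 2)) (f := fun p : ℝ × ℝ => f p.1 * starRingEnd ℂ (f p.2) *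
        (((Real.pi : ℂ) / 1) ^ (1 / 2 : ℂ) * Complex.exp (-((p.2 - p.1 : ℝ) : ℂ) ^ 2 / (4 * 1)))) (by
      refine Filter.Eventually.of_forall fun p => ?_
      have n1 : ‖((Real.pi : ℂ) / 1) ^ (1 / 2 : ℂ)‖ = Real.sqrt Real.pi := by
        rw [div_one, Complex.norm_cpow_eq_rpow_re_of_pos Real.pi_pos, Real.sqrt_eq_rpow]
        norm_num
      have n2 : ‖Complex.exp (-((p.2 - p.1 : ℝ) : ℂ) ^ 2 / (4 * 1))‖ = Real.exp (-(1/4) * (p.1 - p.2) ^ 2) := by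
        rw [show (-((p.2 - p.1 : ℝ) : ℂ) ^ 2 / (4 * 1)) = ((-(1/4) * (p.1 - p.2) ^ 2 : ℝ) : ℂ) by push_cast; ring]
        rw [Complex.norm_exp, Complex.ofReal_re]
      rw [norm_mul, norm_mul, norm_mul, n1, n2, RCLike.norm_conj]
      simp only [Pi.add_apply]
      have : ‖f p.1‖ * ‖f p.2‖ ≤ (‖f p.2‖ ^ 2 + ‖f p.1‖ ^ 2) / 2 := by nlinarith [sq_nonneg (‖f p.1‖ - ‖f p.2‖)]
      calc _ ≤ (‖f p.2‖ ^ 2 + ‖f p.1‖ ^ 2) / 2 * (Real.sqrt Real.pi * Real.exp (-(1/4) * (p.1 - p.2) ^ 2)) := by gcongr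
        _ = _ := by ring)
    refine hb.trans_eq ?_
    rw [integral_const_mul]
    simp only [Pi.add_apply]
    rw [integral_add hG hG', hval, hval']
    have : Real.sqrt (Real.pi / (1/4)) = 2 * Real.sqrt Real.pi := by
      rw [show Real.pi / (1/4) = 2^2 * Real.pi by ring, Real.sqrt_mul (by norm_num), Real.sqrt_sq (by norm_num)]
    rw [this]
    have h4 := Real.mul_self_sqrt Real.pi_pos.le
    linear_combination (2 * ∫ v, ‖f v‖ ^ 2) * h4
  have h0 : 0 ≤ ∫ v, ‖f v‖ ^ 2 := integral_nonneg fun t => by positivity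
  have hπ := Real.pi_lt_d2
  have he := Real.exp_one_lt_d9
  have he0 := Real.exp_pos 1
  have hπ0 := Real.pi_pos
  calc _ ≤ Real.exp 1 * (2 * Real.pi * ∫ v, ‖f v‖ ^ 2) := step1.trans (by gcongr)
    _ = (Real.exp 1 * Real.pi * 2) * ∫ v, ‖f v‖ ^ 2 := by ring
    _ ≤ 18 * ∫ v, ‖f v‖ ^ 2 := by
        gcongr
        nlinarith

end Gall

end

section

open Finset MeasureTheory
namespace Gall

section
variable {h : ℝ → ℂ} {B a : ℝ}

lemma Lp_eq_fourier (h : ℝ → ℂ) (j : ℕ) (δ t : ℝ) :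
    Lp h j (δ + Complex.I * t) = ∫ v in Set.Ioi (0:ℝ), ((-(v:ℂ)) ^ j * h v * Complex.exp (-δ * v)) *
      Complex.exp (-(Complex.I * t * v)) := by
  unfold Lp
  congr 1; ext v
  rw [show (-((δ:ℂ) + Complex.I * t) * v) = (-δ * v) + (-(Complex.I * t * v)) by ring, Complex.exp_add]
  ring

lemma Lp_mean_square (hm : Measurable h) (hb : ∀ v, ‖h v‖ ≤ B * Real.exp (-(a * v))) (ha : 0 < a) (j : ℕ)
    {δ : ℝ} (hδ : 0 ≤ δ) :
    ∫ t in (-1:ℝ)..1, ‖Lp h j (δ + Complex.I * t)‖ ^ 2 ≤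
      18 * (B ^ 2 * ((Nat.factorial (2*j)) / (2 * a) ^ (2*j+1))) := by
  set f : ℝ → ℂ := fun v => (-(v:ℂ)) ^ j * h v * Complex.exp (-δ * v) with hf
  have hfi : IntegrableOn f (Set.Ioi 0) := Lp_integrable hm hb j δ (by simp; linarith)
  have hsq : ∀ v ∈ Set.Ioi (0:ℝ), ‖f v‖ ^ 2 ≤ B ^ 2 * (v ^ (2*j) * Real.exp (-((2*a) * v))) := by
    intro v hv
    have := Lp_integrand_le hb j (δ:ℂ) (b := a) (by simp; exact hδ) hv
    calc ‖f v‖ ^ 2 ≤ (B * (v ^ j * Real.exp (-(a * v)))) ^ 2 := pow_le_pow_left₀ (norm_nonneg _) this 2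
      _ = _ := by
        rw [mul_pow, mul_pow, ← pow_mul, ← Real.exp_nat_mul, mul_comm j 2]
        congr 3; push_cast; ring
  have hbi : IntegrableOn (fun v : ℝ => B ^ 2 * (v ^ (2*j) * Real.exp (-((2*a) * v)))) (Set.Ioi 0) :=
    (integrableOn_pow_exp (2*j) (b := 2 * a) (by linarith)).const_mul _
  have hf2 : IntegrableOn (fun v => ‖f v‖ ^ 2) (Set.Ioi 0) := by
    refine hbi.mono' ((Lp_integrand_meas hm j δ).norm.pow_const 2).aestronglyMeasurable ?_
    filter_upwards [ae_restrict_mem measurableSet_Ioi] with v hv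
    rw [norm_pow, norm_norm]
    exact hsq v hv
  have key := fourier_mean_square (f := (Set.Ioi (0:ℝ)).indicator f)
    ((integrable_indicator_iff measurableSet_Ioi).2 hfi) (by
      have := (integrable_indicator_iff measurableSet_Ioi).2 hf2
      refine this.congr (Filter.Eventually.of_forall fun v => ?_)
      by_cases hv : v ∈ Set.Ioi (0:ℝ) <;> simp [Set.indicator, hv])
  have e1 : ∀ t : ℝ, ∫ v, (Set.Ioi (0:ℝ)).indicator f v * Complex.exp (-(Complex.I * t * v)) =
      Lp h j (δ + Complex.I * t) := by
    intro t
    rw [Lp_eq_fourier, ← integral_indicator measurableSet_Ioi]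
    congr 1; ext v
    by_cases hv : v ∈ Set.Ioi (0:ℝ) <;> simp [Set.indicator, hv, hf]
  simp only [e1] at key
  refine key.trans ?_
  gcongr
  have e2 : ∫ v, ‖(Set.Ioi (0:ℝ)).indicator f v‖ ^ 2 = ∫ v in Set.Ioi (0:ℝ), ‖f v‖ ^ 2 := by
    rw [← integral_indicator measurableSet_Ioi]
    congr 1; ext v
    by_cases hv : v ∈ Set.Ioi (0:ℝ) <;> simp [Set.indicator, hv]
  rw [e2]
  calc _ ≤ ∫ v in Set.Ioi (0:ℝ), B ^ 2 * (v ^ (2*j) * Real.exp (-((2*a) * v))) :=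
        setIntegral_mono_on hf2 hbi measurableSet_Ioi hsq
    _ = _ := by rw [integral_const_mul, integral_pow_exp _ (by linarith)]

/-- Kernel of a weight. -/
noncomputable def ker (ψ : ℝ → ℂ) (y : ℝ) : ℂ := ∫ t in (-1:ℝ)..1, ψ t * Complex.exp (Complex.I * t * y)

lemma Lp_kernel (hm : Measurable h) (hb : ∀ v, ‖h v‖ ≤ B * Real.exp (-(a * v))) (j : ℕ)
    {δ : ℝ} (hδ : -a < δ) (ψ : ℝ → ℂ) (hψ : Continuous ψ) (L : ℝ) :
    ∫ t in (-1:ℝ)..1, ψ t * Complex.exp (Complex.I * t * L) * Lp h j (δ + Complex.I * t) =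
      ∫ v in Set.Ioi (0:ℝ), ((-(v:ℂ)) ^ j * h v * Complex.exp (-δ * v)) * ker ψ (L - v) := by
  unfold ker
  simp only [intervalIntegral.integral_of_le (show (-1:ℝ) ≤ 1 by norm_num)]
  set f : ℝ → ℂ := fun v => (-(v:ℂ)) ^ j * h v * Complex.exp (-δ * v) with hf
  have hfi : IntegrableOn f (Set.Ioi 0) := Lp_integrable hm hb j δ (by simpa using hδ)
  simp only [Lp_eq_fourier, ← integral_const_mul]
  rw [integral_integral_swap]
  · apply integral_congr_ae
    refine Filter.Eventually.of_forall fun v => ?_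
    simp only
    congr 1; ext t
    rw [show Complex.I * t * ((L - v : ℝ):ℂ) = Complex.I * t * L + -(Complex.I * t * v) by push_cast; ring, Complex.exp_add]
    ring
  · have i1 : Integrable ψ (volume.restrict (Set.Ioc (-1:ℝ) 1)) :=
      (hψ.integrableOn_Icc (a := -1) (b := 1)).mono_set Set.Ioc_subset_Icc_self
    have i2 := i1.mul_prod (show Integrable f (volume.restrict (Set.Ioi 0)) from hfi)
    have := i2.bdd_mul (c := 1) (f := fun p : ℝ × ℝ => Complex.exp (Complex.I * p.1 * L) *
        Complex.exp (-(Complex.I * p.1 * p.2))) (by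
        apply Continuous.aestronglyMeasurable; fun_prop) (by
        refine Filter.Eventually.of_forall fun p => ?_
        rw [norm_mul, Complex.norm_exp, Complex.norm_exp]; simp)
    refine this.congr (Filter.Eventually.of_forall fun p => ?_)
    simp only [Function.uncurry, hf]
    ring

end

lemma term_shift (c : ℕ → ℂ) (s : ℂ) (t : ℝ) (n : ℕ) :
    LSeries.term c (s + Complex.I * t) n = LSeries.term c s n * Complex.exp (-(Complex.I * t * Real.log n)) := by
  rcases Nat.eq_zero_or_pos n with rfl | hn
  · simp
  · have hn0 : (n:ℂ) ≠ 0 := by exact_mod_cast hn.ne'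
    rw [LSeries.term_of_ne_zero hn.ne', LSeries.term_of_ne_zero hn.ne', Complex.cpow_add _ _ hn0]
    have : (n:ℂ) ^ (Complex.I * t) = Complex.exp (Complex.I * t * Real.log n) := by
      rw [Complex.cpow_def_of_ne_zero hn0, ← Complex.natCast_log]; ring_nf
    rw [this, Complex.exp_neg, div_mul_eq_div_div, div_eq_mul_inv]

lemma LSeries_kernel {c : ℕ → ℂ} {s : ℂ} (hc : LSeriesSummable c s) (ψ : ℝ → ℂ) (hψ : Continuous ψ) (L : ℝ) :
    HasSum (fun n => LSeries.term c s n * ker ψ (L - Real.log n))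
      (∫ t in (-1:ℝ)..1, ψ t * Complex.exp (Complex.I * t * L) * LSeries c (s + Complex.I * t)) := by
  obtain ⟨K, hK⟩ := (isCompact_Icc (a := (-1:ℝ)) (b := 1)).exists_bound_of_continuousOn hψ.continuousOn
  have hs : Summable (fun n => ‖LSeries.term c s n‖) := hc.norm
  have hK0 : 0 ≤ K := (norm_nonneg _).trans (hK 0 (by simp))
  have hnorm : ∀ (t : ℝ) n, ‖LSeries.term c (s + Complex.I * t) n‖ = ‖LSeries.term c s n‖ := by
    intro t n
    rw [term_shift, norm_mul, show -(Complex.I * t * Real.log n) = ((-(t * Real.log n) : ℝ) : ℂ) * Complex.I by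
      push_cast; ring, Complex.norm_exp_ofReal_mul_I, mul_one]
  have key := intervalIntegral.hasSum_integral_of_dominated_convergence (μ := volume) (a := -1) (b := 1)
    (F := fun n t => ψ t * Complex.exp (Complex.I * t * L) * LSeries.term c (s + Complex.I * t) n)
    (f := fun t => ψ t * Complex.exp (Complex.I * t * L) * LSeries c (s + Complex.I * t))
    (fun n t => K * ‖LSeries.term c s n‖)
    (fun n => by
      simp only [term_shift]
      apply Continuous.aestronglyMeasurable
      fun_prop)
    (fun n => by
      refine Filter.Eventually.of_forall fun t ht => ?_
      rw [Set.uIoc_of_le (by norm_num)] at ht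
      rw [norm_mul, norm_mul, hnorm, Complex.norm_exp]
      have := hK t ⟨ht.1.le, ht.2⟩
      simp
      gcongr)
    (Filter.Eventually.of_forall fun t _ => hs.mul_left K)
    (by simp)
    (Filter.Eventually.of_forall fun t _ => by
      apply HasSum.mul_left
      exact (Summable.of_norm (by simpa only [hnorm] using hs)).hasSum)
  refine key.congr_fun ?_ |> fun h => h
  intro n
  unfold ker
  rw [← intervalIntegral.integral_const_mul]
  congr 1; ext t
  rw [term_shift, show Complex.I * t * ((L - Real.log n : ℝ):ℂ) = Complex.I * t * L + -(Complex.I * t * Real.log n) by push_cast; ring, Complex.exp_add]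
  ring

/-- Normalised partial sums. -/
noncomputable def hc (c : ℕ → ℂ) (v : ℝ) : ℂ := (∑ k ∈ Icc 1 ⌊Real.exp v⌋₊, c k) * Real.exp (-v)

lemma hc_measurable (c : ℕ → ℂ) : Measurable (hc c) := by
  have h1 : Measurable (fun v : ℝ => ∑ k ∈ Icc 1 ⌊Real.exp v⌋₊, c k) := by
    have h2 : Measurable (fun n : ℕ => ∑ k ∈ Icc 1 n, c k) := measurable_from_nat
    exact h2.comp (Nat.measurable_floor.comp Real.measurable_exp)
  exact h1.mul (Complex.measurable_ofReal.comp (Real.measurable_exp.comp measurable_neg))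

lemma LSeries_eq_Lp (c : ℕ → ℂ) (K : ℝ) (hcK : ∀ n, ‖c n‖ ≤ K) (w : ℂ) (hw : 0 < w.re) :
    LSeries c (1 + w) = (1 + w) * Lp (hc c) 0 w := by
  have hO : (fun n ↦ ∑ k ∈ Icc 1 n, ‖c k‖) =O[Filter.atTop] fun n ↦ (n : ℝ) ^ (1:ℝ) := by
    apply Asymptotics.IsBigO.of_bound K
    refine Filter.Eventually.of_forall fun n => ?_
    rw [Real.rpow_one, Real.norm_of_nonneg (by positivity), Real.norm_of_nonneg (by positivity)]
    calc ∑ k ∈ Icc 1 n, ‖c k‖ ≤ ∑ k ∈ Icc 1 n, K := Finset.sum_le_sum fun k _ => hcK k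
      _ = K * n := by simp [mul_comm]
  rw [LSeries_eq_mul_integral' c zero_le_one (s := 1 + w) (by simpa using hw) hO]
  congr 1
  have := integral_comp_exp_Ioi (fun t : ℝ => (∑ k ∈ Icc 1 ⌊t⌋₊, c k) * (t:ℂ) ^ (-((1 + w) + 1))) 0
  rw [Real.exp_zero] at this
  rw [← this]
  unfold Lp hc
  apply setIntegral_congr_fun measurableSet_Ioi
  intro v _
  simp only [pow_zero, one_mul]
  have e : ((Real.exp v : ℝ) : ℂ) ^ (-((1 + w) + 1)) = Complex.exp (-v) * Complex.exp (-v) * Complex.exp (-w * v) := by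
    rw [Complex.ofReal_exp, Complex.cpow_def_of_ne_zero (Complex.exp_ne_zero _), ← Complex.ofReal_exp, ← Complex.ofReal_log (Real.exp_pos v).le, Real.log_exp, ← Complex.exp_add, ← Complex.exp_add]
    congr 1; ring
  rw [e, Complex.real_smul, Complex.ofReal_exp, Complex.ofReal_exp, Complex.ofReal_neg]
  have e2 : Complex.exp v * Complex.exp (-v) = 1 := by rw [← Complex.exp_add]; simp
  linear_combination (∑ k ∈ Icc 1 ⌊Real.exp v⌋₊, c k) * Complex.exp (-v) * Complex.exp (-w * v) * e2

end Gall

end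

section

open Finset MeasureTheory
namespace Gall

/-- Fejér weight. -/
noncomputable def tri (t : ℝ) : ℂ := ((1 - |t| : ℝ) : ℂ)

lemma tri_continuous : Continuous tri := by unfold tri; fun_prop

lemma tri_norm_le {t : ℝ} (ht : t ∈ Set.Icc (-1:ℝ) 1) : ‖tri t‖ ≤ 1 := by
  unfold tri
  rw [Complex.norm_real, Real.norm_of_nonneg (by have := abs_le.2 ht; linarith)]
  have := abs_nonneg t; linarith

lemma ibp_half {u u' : ℝ → ℂ} (a b : ℝ) (hu : ∀ t, t ∈ Set.uIcc a b → HasDerivAt u (u' t) t)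
    (hu' : ContinuousOn u' (Set.uIcc a b)) {c : ℂ} (hc : c ≠ 0) :
    ∫ t in a..b, u t * Complex.exp (c * t) =
      (u b * Complex.exp (c * b) - u a * Complex.exp (c * a)) / c - (1 / c) * ∫ t in a..b, u' t * Complex.exp (c * t) := by
  have hv : ∀ t ∈ Set.uIcc a b, HasDerivAt (fun t : ℝ => Complex.exp (c * t) / c) (Complex.exp (c * t)) t := by
    intro t _
    have h1 : HasDerivAt (fun t : ℝ => c * (t:ℂ)) (c * 1) t := (Complex.ofRealCLM.hasDerivAt).const_mul c
    have h2 := (h1.cexp).div_const c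
    exact h2.congr_deriv (by field_simp)
  have := intervalIntegral.integral_mul_deriv_eq_deriv_mul (a := a) (b := b) hu hv
    hu'.intervalIntegrable (by apply Continuous.intervalIntegrable; fun_prop)
  rw [this, ← intervalIntegral.integral_const_mul]
  have e : ∀ t : ℝ, u' t * (Complex.exp (c * t) / c) = 1 / c * (u' t * Complex.exp (c * t)) := by
    intro t; field_simp
  simp only [e]
  congr 1
  field_simp

lemma tri_split {R : ℝ → ℂ} (hR : ContinuousOn R (Set.Icc (-1) 1)) (c : ℂ) :
    ∫ t in (-1:ℝ)..1, tri t * R t * Complex.exp (c * t) =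
      (∫ t in (-1:ℝ)..0, ((1 + t) * R t) * Complex.exp (c * t)) +
      ∫ t in (0:ℝ)..1, ((1 - t) * R t) * Complex.exp (c * t) := by
  have hcont : ContinuousOn (fun t : ℝ => tri t * R t * Complex.exp (c * t)) (Set.Icc (-1) 1) := by
    apply (tri_continuous.continuousOn.mul hR).mul
    apply Continuous.continuousOn; fun_prop
  rw [← intervalIntegral.integral_add_adjacent_intervals (b := 0)]
  · congr 1
    · apply intervalIntegral.integral_congr
      intro t ht
      rw [Set.uIcc_of_le (by norm_num)] at ht
      simp only [tri]
      rw [abs_of_nonpos ht.2]; push_cast; ring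
    · apply intervalIntegral.integral_congr
      intro t ht
      rw [Set.uIcc_of_le (by norm_num)] at ht
      simp only [tri]
      rw [abs_of_nonneg ht.1]; push_cast; ring
  · apply (hcont.mono _).intervalIntegrable
    rw [Set.uIcc_of_le (by norm_num)]
    exact Set.Icc_subset_Icc le_rfl (by norm_num)
  · apply (hcont.mono _).intervalIntegrable
    rw [Set.uIcc_of_le (by norm_num)]
    exact Set.Icc_subset_Icc (by norm_num) le_rfl

lemma tri_ibp {R R' : ℝ → ℂ} (hR : ∀ t, t ∈ Set.Icc (-1:ℝ) 1 → HasDerivAt R (R' t) t)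
    (hR' : ContinuousOn R' (Set.Icc (-1) 1)) {c : ℂ} (hc : c ≠ 0) :
    ∫ t in (-1:ℝ)..1, tri t * R t * Complex.exp (c * t) =
      -(1 / c) * ((∫ t in (-1:ℝ)..0, (R t + (1 + t) * R' t) * Complex.exp (c * t)) +
      ∫ t in (0:ℝ)..1, (-R t + (1 - t) * R' t) * Complex.exp (c * t)) := by
  have hRc : ContinuousOn R (Set.Icc (-1) 1) := fun t ht => (hR t ht).continuousAt.continuousWithinAt
  have s1 : Set.uIcc (-1:ℝ) 0 ⊆ Set.Icc (-1) 1 := by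
    rw [Set.uIcc_of_le (by norm_num)]; exact Set.Icc_subset_Icc le_rfl (by norm_num)
  have s2 : Set.uIcc (0:ℝ) 1 ⊆ Set.Icc (-1) 1 := by
    rw [Set.uIcc_of_le (by norm_num)]; exact Set.Icc_subset_Icc (by norm_num) le_rfl
  rw [tri_split hRc c]
  have d1 : ∀ t : ℝ, HasDerivAt (fun t : ℝ => (1 + t : ℂ)) 1 t := fun t =>
    (Complex.ofRealCLM.hasDerivAt (x := t)).const_add 1
  have d2 : ∀ t : ℝ, HasDerivAt (fun t : ℝ => (1 - t : ℂ)) (-1) t := fun t =>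
    (Complex.ofRealCLM.hasDerivAt (x := t)).const_sub 1
  rw [ibp_half (u := fun t : ℝ => (1 + t) * R t) (u' := fun t : ℝ => R t + (1 + t) * R' t) (-1) 0
    (fun t ht => ((d1 t).mul (hR t (s1 ht))).congr_deriv (by ring))
    ((hRc.mono s1).add (ContinuousOn.mul (by fun_prop) (hR'.mono s1))) hc]
  rw [ibp_half (u := fun t : ℝ => (1 - t) * R t) (u' := fun t : ℝ => -R t + (1 - t) * R' t) 0 1
    (fun t ht => ((d2 t).mul (hR t (s2 ht))).congr_deriv (by ring))
    ((hRc.mono s2).neg.add (ContinuousOn.mul (by fun_prop) (hR'.mono s2))) hc]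
  push_cast
  simp only [mul_zero, Complex.exp_zero]
  field_simp
  ring

lemma exp_I_norm (y t : ℝ) : ‖Complex.exp (Complex.I * y * t)‖ = 1 := by
  rw [Complex.norm_exp]; simp

lemma tri_ibp_le {R R' : ℝ → ℂ} (hR : ∀ t, t ∈ Set.Icc (-1:ℝ) 1 → HasDerivAt R (R' t) t)
    (hR' : ContinuousOn R' (Set.Icc (-1) 1)) {y : ℝ} (hy : 0 < y) :
    ‖∫ t in (-1:ℝ)..1, tri t * R t * Complex.exp (Complex.I * y * t)‖ ≤
      (1 / y) * ∫ t in (-1:ℝ)..1, (‖R t‖ + ‖R' t‖) := by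
  have hRc : ContinuousOn R (Set.Icc (-1) 1) := fun t ht => (hR t ht).continuousAt.continuousWithinAt
  have hc : Complex.I * (y:ℂ) ≠ 0 := mul_ne_zero Complex.I_ne_zero (by exact_mod_cast hy.ne')
  have s1 : Set.uIcc (-1:ℝ) 0 ⊆ Set.Icc (-1) 1 := by
    rw [Set.uIcc_of_le (by norm_num)]; exact Set.Icc_subset_Icc le_rfl (by norm_num)
  have s2 : Set.uIcc (0:ℝ) 1 ⊆ Set.Icc (-1) 1 := by
    rw [Set.uIcc_of_le (by norm_num)]; exact Set.Icc_subset_Icc (by norm_num) le_rfl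
  rw [tri_ibp hR hR' hc, norm_mul]
  have hn : ‖-(1 / (Complex.I * (y:ℂ)))‖ = 1 / y := by
    rw [norm_neg, norm_div, norm_one, norm_mul, Complex.norm_I, one_mul, Complex.norm_real, Real.norm_of_nonneg hy.le]
  rw [hn]
  gcongr
  have hi : ContinuousOn (fun t => ‖R t‖ + ‖R' t‖) (Set.Icc (-1) 1) := hRc.norm.add hR'.norm
  rw [← intervalIntegral.integral_add_adjacent_intervals (a := -1) (b := 0) (c := 1)
    ((hi.mono s1).intervalIntegrable) ((hi.mono s2).intervalIntegrable)]
  refine (norm_add_le _ _).trans (add_le_add ?_ ?_)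
  · refine intervalIntegral.norm_integral_le_of_norm_le (by norm_num) (Filter.Eventually.of_forall fun t ht => ?_) ((hi.mono s1).intervalIntegrable)
    rw [norm_mul, exp_I_norm, mul_one]
    refine (norm_add_le _ _).trans ?_
    rw [norm_mul]
    have : ‖(1 + t : ℂ)‖ ≤ 1 := by
      rw [show (1 + t : ℂ) = ((1 + t : ℝ) : ℂ) by push_cast; rfl, Complex.norm_real, Real.norm_of_nonneg (by linarith [ht.1])]
      linarith [ht.2]
    nlinarith [norm_nonneg (R' t)]
  · refine intervalIntegral.norm_integral_le_of_norm_le (by norm_num) (Filter.Eventually.of_forall fun t ht => ?_) ((hi.mono s2).intervalIntegrable)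
    rw [norm_mul, exp_I_norm, mul_one]
    refine (norm_add_le _ _).trans ?_
    rw [norm_mul, norm_neg]
    have : ‖(1 - t : ℂ)‖ ≤ 1 := by
      rw [show (1 - t : ℂ) = ((1 - t : ℝ) : ℂ) by push_cast; rfl, Complex.norm_real, Real.norm_of_nonneg (by linarith [ht.2])]
      linarith [ht.1]
    nlinarith [norm_nonneg (R' t)]

lemma lin_int_le (p0 p1 : ℂ) (a b : ℝ) (ha : |a| ≤ 1) (hb : |b| ≤ 1) (hab : |b - a| ≤ 1) {y : ℝ} (hy : y ≠ 0) :
    ‖∫ t in a..b, (p0 + p1 * t) * Complex.exp (Complex.I * y * t)‖ ≤ (2 * ‖p0‖ + 3 * ‖p1‖) / |y| := by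
  have hc : Complex.I * (y:ℂ) ≠ 0 := mul_ne_zero Complex.I_ne_zero (by exact_mod_cast hy)
  have hn : ‖Complex.I * (y:ℂ)‖ = |y| := by simp
  have hy0 : 0 < |y| := abs_pos.2 hy
  rw [ibp_half (u := fun t : ℝ => p0 + p1 * t) (u' := fun _ => p1) a b
    (fun t _ => (((Complex.ofRealCLM.hasDerivAt (x := t)).const_mul p1).const_add p0).congr_deriv (by simp))
    continuousOn_const hc]
  have h1 : ‖∫ t in a..b, p1 * Complex.exp (Complex.I * y * t)‖ ≤ ‖p1‖ * |b - a| := by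
    apply intervalIntegral.norm_integral_le_of_norm_le_const
    intro t _
    rw [norm_mul, exp_I_norm, mul_one]
  have h2 : ∀ t : ℝ, |t| ≤ 1 → ‖(p0 + p1 * t) * Complex.exp (Complex.I * y * t)‖ ≤ ‖p0‖ + ‖p1‖ := by
    intro t ht
    rw [norm_mul, exp_I_norm, mul_one]
    refine (norm_add_le _ _).trans ?_
    rw [norm_mul, Complex.norm_real, Real.norm_eq_abs]
    nlinarith [norm_nonneg p1]
  refine (norm_sub_le _ _).trans ?_
  rw [norm_div, hn, norm_mul, norm_div, norm_one, hn]
  have h3 := norm_sub_le ((p0 + p1 * b) * Complex.exp (Complex.I * y * b)) ((p0 + p1 * a) * Complex.exp (Complex.I * y * a))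
  have h4 := h2 a ha
  have h5 := h2 b hb
  rw [one_div_mul_eq_div, ← add_div]
  apply div_le_div_of_nonneg_right _ hy0.le
  nlinarith [norm_nonneg p1]

lemma ker_lin_le (α β : ℂ) (y : ℝ) :
    ‖ker (fun t => tri t * (α + β * t)) y‖ ≤ 20 * (‖α‖ + ‖β‖) / (1 + y ^ 2) := by
  have e : ker (fun t => tri t * (α + β * t)) y = ∫ t in (-1:ℝ)..1, tri t * (α + β * t) * Complex.exp (Complex.I * y * t) := by
    unfold ker; congr 1; ext t; congr 2; ring
  have t1 : ‖ker (fun t => tri t * (α + β * t)) y‖ ≤ 2 * (‖α‖ + ‖β‖) := by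
    rw [e]
    have := intervalIntegral.norm_integral_le_of_norm_le_const (a := -1) (b := 1) (C := ‖α‖ + ‖β‖)
      (f := fun t : ℝ => tri t * (α + β * t) * Complex.exp (Complex.I * y * t)) (by
      intro t ht
      rw [Set.uIoc_of_le (by norm_num)] at ht
      rw [norm_mul, exp_I_norm, mul_one, norm_mul]
      have h1 := tri_norm_le (t := t) ⟨ht.1.le, ht.2⟩
      have h2 : ‖α + β * t‖ ≤ ‖α‖ + ‖β‖ := by
        refine (norm_add_le _ _).trans ?_
        rw [norm_mul, Complex.norm_real, Real.norm_eq_abs]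
        have : |t| ≤ 1 := abs_le.2 ⟨ht.1.le, ht.2⟩
        nlinarith [norm_nonneg β]
      have := norm_nonneg (α + β * t)
      nlinarith)
    refine this.trans_eq ?_
    rw [show |(1:ℝ) - -1| = 2 by norm_num]; ring
  rcases eq_or_ne y 0 with rfl | hy
  · have := norm_nonneg α
    have := norm_nonneg β
    refine t1.trans ?_
    rw [show (1 + (0:ℝ)^2) = 1 by norm_num, div_one]
    linarith
  · have hc : Complex.I * (y:ℂ) ≠ 0 := mul_ne_zero Complex.I_ne_zero (by exact_mod_cast hy)
    have hn : ‖-(1 / (Complex.I * (y:ℂ)))‖ = 1 / |y| := by simp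
    have hy0 : 0 < |y| := abs_pos.2 hy
    have t2 : ‖ker (fun t => tri t * (α + β * t)) y‖ ≤ 16 * (‖α‖ + ‖β‖) / y ^ 2 := by
      rw [e, tri_ibp (R := fun t : ℝ => α + β * t) (R' := fun _ => β)
        (fun t _ => (((Complex.ofRealCLM.hasDerivAt (x := t)).const_mul β).const_add α).congr_deriv (by simp))
        continuousOn_const hc, norm_mul, hn]
      have l1 := lin_int_le (α + β) (2 * β) (-1) 0 (by norm_num) (by norm_num) (by norm_num) hy
      have l2 := lin_int_le (-α + β) (-2 * β) 0 1 (by norm_num) (by norm_num) (by norm_num) hy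
      have e1 : ∀ t : ℝ, α + β * t + (1 + t) * β = α + β + 2 * β * t := by intro t; ring
      have e2 : ∀ t : ℝ, -(α + β * t) + (1 - t) * β = -α + β + -2 * β * t := by intro t; ring
      simp only [e1, e2]
      have n1 : ‖α + β‖ ≤ ‖α‖ + ‖β‖ := norm_add_le _ _
      have n2 : ‖-α + β‖ ≤ ‖α‖ + ‖β‖ := (norm_add_le _ _).trans (by rw [norm_neg])
      have n3 : ‖2 * β‖ = 2 * ‖β‖ := by simp
      have n4 : ‖-2 * β‖ = 2 * ‖β‖ := by simp
      rw [n3] at l1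
      rw [n4] at l2
      calc _ ≤ 1 / |y| * ((2 * ‖α + β‖ + 3 * (2 * ‖β‖)) / |y| + (2 * ‖-α + β‖ + 3 * (2 * ‖β‖)) / |y|) := by
            gcongr
            exact (norm_add_le _ _).trans (add_le_add l1 l2)
        _ = ((2 * ‖α + β‖ + 3 * (2 * ‖β‖)) + (2 * ‖-α + β‖ + 3 * (2 * ‖β‖))) / y ^ 2 := by
            rw [← sq_abs y]; field_simp
        _ ≤ _ := by
            gcongr
            linarith [norm_nonneg α]
    rw [le_div_iff₀ (by positivity)] at t2 ⊢
    have := norm_nonneg α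
    have := norm_nonneg β
    nlinarith

/-- Fejér kernel. -/
noncomputable def kk (y : ℝ) : ℝ := if y = 0 then 1 else (2 - 2 * Real.cos y) / y ^ 2

lemma ker_tri (y : ℝ) : ker tri y = kk y := by
  have e : ker tri y = ∫ t in (-1:ℝ)..1, tri t * 1 * Complex.exp (Complex.I * y * t) := by
    unfold ker; congr 1; ext t; rw [mul_one]; congr 2; ring
  rw [e]
  unfold kk
  rcases eq_or_ne y 0 with rfl | hy
  · rw [tri_split continuousOn_const]
    have i1 : ∫ t in (-1:ℝ)..0, (1 + (t:ℂ)) = 1/2 := by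
      rw [intervalIntegral.integral_add (by simp) (by apply Continuous.intervalIntegrable; fun_prop), intervalIntegral.integral_ofReal]
      simp; norm_num
    have i2 : ∫ t in (0:ℝ)..1, (1 - (t:ℂ)) = 1/2 := by
      rw [intervalIntegral.integral_sub (by simp) (by apply Continuous.intervalIntegrable; fun_prop), intervalIntegral.integral_ofReal]
      simp; norm_num
    simp [i1, i2]; norm_num
  · rw [if_neg hy]
    have hc : Complex.I * (y:ℂ) ≠ 0 := mul_ne_zero Complex.I_ne_zero (by exact_mod_cast hy)
    rw [tri_ibp (R := fun _ => 1) (R' := fun _ => 0) (fun t _ => hasDerivAt_const _ _) continuousOn_const hc]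
    have j1 := ibp_half (u := fun _ => 1) (u' := fun _ => 0) (-1) 0 (fun t _ => hasDerivAt_const _ _) continuousOn_const hc
    have j2 := ibp_half (u := fun _ => -1) (u' := fun _ => 0) 0 1 (fun t _ => hasDerivAt_const _ _) continuousOn_const hc
    simp only [mul_zero, add_zero]
    rw [j1, j2]
    push_cast
    rw [Complex.cos]
    simp only [zero_mul, intervalIntegral.integral_zero, mul_zero, Complex.exp_zero, mul_one]
    have hyc : (y:ℂ) ≠ 0 := by exact_mod_cast hy
    have hI := Complex.I_sq
    rw [show Complex.I * (y:ℂ) * -1 = -(y * Complex.I) by ring, show Complex.I * (y:ℂ) = y * Complex.I by ring,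
      show -(y:ℂ) * Complex.I = -(y * Complex.I) by ring]
    field_simp
    rw [hI]
    ring

lemma kk_nonneg (y : ℝ) : 0 ≤ kk y := by
  unfold kk
  split_ifs
  · norm_num
  · have := Real.cos_le_one y
    apply div_nonneg <;> nlinarith [sq_nonneg y]

lemma kk_le_one (y : ℝ) : kk y ≤ 1 := by
  unfold kk
  split_ifs with h
  · norm_num
  · have := Real.one_sub_sq_div_two_le_cos (x := y)
    rw [div_le_one (by positivity)]
    linarith

lemma kk_le (y : ℝ) : kk y ≤ 5 / (1 + y ^ 2) := by
  have h1 := kk_le_one y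
  have h0 := kk_nonneg y
  rw [le_div_iff₀ (by positivity)]
  have : kk y * y ^ 2 ≤ 4 := by
    unfold kk
    split_ifs with h
    · simp [h]
    · rw [div_mul_cancel₀ _ (by positivity)]
      have := Real.neg_one_le_cos y
      linarith
  linarith

lemma kk_lower (y : ℝ) (hy : |y| ≤ 2) : 1/3 ≤ kk y := by
  unfold kk
  split_ifs with h
  · norm_num
  · have hπ := Real.pi_gt_three
    have hπ4 := Real.pi_lt_d2
    have := Real.cos_le_one_sub_mul_cos_sq (x := y) (by linarith)
    rw [le_div_iff₀ (by positivity)]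
    have h3 : (1:ℝ) / 6 ≤ 2 / Real.pi ^ 2 := by
      rw [div_le_div_iff₀ (by norm_num) (by positivity)]
      nlinarith
    have h2 : 1/6 * y ^ 2 ≤ 2 / Real.pi ^ 2 * y ^ 2 := mul_le_mul_of_nonneg_right h3 (sq_nonneg y)
    linarith

end Gall

end

section

open Finset MeasureTheory
namespace Gall

/-- Lower bound for a nonvanishing bounded function via Borel-Caratheodory. -/
lemma bc_inv0 {f : ℂ → ℂ} {r B B1 : ℝ} (hr : 0 < r)
    (hf : DifferentiableOn ℂ f (Metric.ball 0 r)) (hne : ∀ w ∈ Metric.ball (0:ℂ) r, f w ≠ 0)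
    (hB : ∀ w ∈ Metric.ball (0:ℂ) r, ‖f w‖ ≤ B) (hB1 : 0 < B1) (h0 : 1 ≤ B1 * ‖f 0‖) (hBB : 1 < B * B1)
    {w : ℂ} (hw : ‖w‖ ≤ r / 2) : 1 ≤ B1 * Real.exp (2 * Real.log (B * B1)) * ‖f w‖ := by
  have hd : DifferentiableOn ℂ (fun w => deriv f w / f w) (Metric.ball 0 r) :=
    (hf.deriv Metric.isOpen_ball).div hf hne
  obtain ⟨g, hg0, hg⟩ := hd.isExactOn_ball.with_val_at 0 0
  have hfd : ∀ x ∈ Metric.ball (0:ℂ) r, HasDerivAt f (deriv f x) x := fun x hx =>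
    (hf.differentiableAt (Metric.isOpen_ball.mem_nhds hx)).hasDerivAt
  have hk : ∀ x ∈ Metric.ball (0:ℂ) r, HasDerivAt (fun x => f x * Complex.exp (- g x)) 0 x := by
    intro x hx
    have h1 := (hfd x hx).mul (hg x hx).neg.cexp
    refine h1.congr_deriv ?_
    have := hne x hx
    field_simp
    ring
  have h0m : (0:ℂ) ∈ Metric.ball (0:ℂ) r := Metric.mem_ball_self hr
  have hconst : ∀ x ∈ Metric.ball (0:ℂ) r, f x * Complex.exp (- g x) = f 0 := by
    intro x hx
    have := (convex_ball (0:ℂ) r).is_const_of_fderivWithin_eq_zero (𝕜 := ℂ) (f := fun x => f x * Complex.exp (- g x))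
      (fun y hy => (hk y hy).differentiableAt.differentiableWithinAt) (fun y hy => by
        have h3 := (hk y hy).hasFDerivAt.hasFDerivWithinAt (s := Metric.ball (0:ℂ) r)
        rw [h3.fderivWithin (Metric.isOpen_ball.uniqueDiffWithinAt hy)]
        ext; simp) hx h0m
    simpa [hg0] using this
  have hnorm : ∀ x ∈ Metric.ball (0:ℂ) r, ‖f x‖ = ‖f 0‖ * Real.exp (g x).re := by
    intro x hx
    rw [← hconst x hx, norm_mul, Complex.norm_exp, mul_assoc, ← Real.exp_add]
    simp
  have hf0 : 0 < ‖f 0‖ := norm_pos_iff.2 (hne 0 h0m)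
  have hM : 0 < Real.log (B * B1) := Real.log_pos hBB
  have hre : Set.MapsTo g (Metric.ball 0 r) {z | z.re ≤ Real.log (B * B1)} := by
    intro x hx
    show (g x).re ≤ _
    rw [Real.le_log_iff_exp_le (by linarith)]
    have h1 := hB x hx
    rw [hnorm x hx] at h1
    have h2 := Real.exp_pos (g x).re
    calc Real.exp (g x).re = 1 * Real.exp (g x).re := by ring
      _ ≤ (B1 * ‖f 0‖) * Real.exp (g x).re := by gcongr
      _ = B1 * (‖f 0‖ * Real.exp (g x).re) := by ring
      _ ≤ B1 * B := by gcongr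
      _ = _ := by ring
  have hwb : w ∈ Metric.ball (0:ℂ) r := by rw [mem_ball_zero_iff]; linarith
  have hbc := Complex.borelCaratheodory_zero hM
    (fun y hy => (hg y hy).differentiableAt.differentiableWithinAt) hre hr hwb hg0
  have h4 : ‖g w‖ ≤ 2 * Real.log (B * B1) := by
    refine hbc.trans ?_
    rw [div_le_iff₀ (by linarith)]
    nlinarith
  have h5 : -(2 * Real.log (B * B1)) ≤ (g w).re := by
    have := Complex.abs_re_le_norm (g w)
    rw [abs_le] at this
    linarith
  rw [hnorm w hwb]
  calc 1 ≤ B1 * ‖f 0‖ := h0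
    _ = B1 * ‖f 0‖ * 1 := by ring
    _ ≤ B1 * ‖f 0‖ * (Real.exp (2 * Real.log (B * B1)) * Real.exp (g w).re) := by
      gcongr
      rw [← Real.exp_add]
      apply Real.one_le_exp; linarith
    _ = _ := by ring

lemma bc_inv {f : ℂ → ℂ} {w0 : ℂ} {r B B1 : ℝ} (hr : 0 < r)
    (hf : DifferentiableOn ℂ f (Metric.ball w0 r)) (hne : ∀ w ∈ Metric.ball w0 r, f w ≠ 0)
    (hB : ∀ w ∈ Metric.ball w0 r, ‖f w‖ ≤ B) (hB1 : 0 < B1) (h0 : 1 ≤ B1 * ‖f w0‖) (hBB : 1 < B * B1)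
    {w : ℂ} (hw : ‖w - w0‖ ≤ r / 2) : 1 ≤ B1 * Real.exp (2 * Real.log (B * B1)) * ‖f w‖ := by
  have hmem : ∀ x ∈ Metric.ball (0:ℂ) r, w0 + x ∈ Metric.ball w0 r := by
    intro x hx
    rw [mem_ball_zero_iff] at hx
    rw [Metric.mem_ball, dist_eq_norm]; simpa using hx
  have := bc_inv0 (f := fun x => f (w0 + x)) hr
    (hf.comp ((differentiable_id.const_add w0).differentiableOn) hmem)
    (fun x hx => hne _ (hmem x hx)) (fun x hx => hB _ (hmem x hx)) hB1 (by simpa using h0) hBB hw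
  simpa using this

end Gall

end

section

open Finset MeasureTheory
namespace Gall

open Classical in
/-- Character values restricted to rough numbers. -/
noncomputable def gX (q z : ℕ) (χ : DirichletCharacter ℂ q) (n : ℕ) : ℂ := if Rough z n then χ n else 0

noncomputable def hEc (q z : ℕ) (β : (ZMod q)ˣ) (v : ℝ) : ℂ := ((hE q z β v : ℝ) : ℂ)

noncomputable def hX (q z : ℕ) [NeZero q] (χ : DirichletCharacter ℂ q) (v : ℝ) : ℂ :=
  ∑ β : (ZMod q)ˣ, χ β * hEc q z β v

lemma sum_char_units {q : ℕ} [NeZero q] (χ : DirichletCharacter ℂ q) (hχ : χ ≠ 1) :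
    ∑ β : (ZMod q)ˣ, χ β = 0 := by
  rw [← MulChar.sum_eq_zero_of_ne_one hχ]
  classical
  symm
  rw [← Finset.sum_subset (Finset.subset_univ (Finset.univ.map ⟨fun u : (ZMod q)ˣ => (u : ZMod q), Units.val_injective⟩))]
  · rw [Finset.sum_map]; rfl
  · intro x _ hx
    apply MulChar.map_nonunit
    rintro ⟨u, rfl⟩
    exact hx (by simp)

lemma totient_pos' (q : ℕ) [NeZero q] : (0:ℝ) < Nat.totient q := by
  exact_mod_cast Nat.totient_pos.2 (Nat.pos_of_ne_zero (NeZero.ne q))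

lemma card_units' (q : ℕ) [NeZero q] : (Finset.univ : Finset (ZMod q)ˣ).card = Nat.totient q := by
  rw [Finset.card_univ, ZMod.card_units_eq_totient]

lemma sum_char_cE (q z : ℕ) [NeZero q] (hqz : q < z) (χ : DirichletCharacter ℂ q) (n : ℕ) :
    ∑ β : (ZMod q)ˣ, χ β * ((cE q z β n : ℝ) : ℂ) =
      if χ = 1 then 0 else gX q z χ n := by
  classical
  have hq : 0 < q := Nat.pos_of_ne_zero (NeZero.ne q)
  have hφ : (Nat.totient q : ℂ) ≠ 0 := by exact_mod_cast (totient_pos' q).ne'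
  unfold cE gX
  by_cases h : Rough z n
  · simp only [h, if_true]
    obtain ⟨γ0, hγ0⟩ := (ZMod.isUnit_iff_coprime n q).2 (h.coprime hq hqz)
    have e : ∀ β : (ZMod q)ˣ, χ β * ((((if (n : ZMod q) = β then (1:ℝ) else 0) - 1 / (Nat.totient q : ℝ) : ℝ)) : ℂ) =
        (if γ0 = β then χ β else 0) - χ β * (1 / (Nat.totient q : ℂ)) := by
      intro β
      rw [← hγ0]
      by_cases hb : γ0 = β
      · simp [hb]; ring
      · have : ¬ ((γ0 : ZMod q) = β) := fun h => hb (Units.ext h)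
        simp [hb, this]
    rw [Finset.sum_congr rfl (fun β _ => e β), Finset.sum_sub_distrib, Finset.sum_ite_eq, ← Finset.sum_mul]
    simp only [Finset.mem_univ, if_true]
    by_cases hχ : χ = 1
    · rw [if_pos hχ, hχ]
      simp [card_units', hφ]
    · rw [if_neg hχ, sum_char_units χ hχ, ← hγ0]; simp
  · simp [h]

lemma hX_eq_sum (q z : ℕ) [NeZero q] (χ : DirichletCharacter ℂ q) (v : ℝ) :
    hX q z χ v = (∑ k ∈ Icc 1 ⌊Real.exp v⌋₊, ∑ β : (ZMod q)ˣ, χ β * ((cE q z β k : ℝ) : ℂ)) * Real.exp (-v) := by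
  unfold hX hEc hE EE
  rw [Finset.sum_comm, Finset.sum_mul]
  apply Finset.sum_congr rfl
  intro β _
  rw [← Finset.mul_sum]
  push_cast
  ring

lemma hX_eq (q z : ℕ) [NeZero q] (hqz : q < z) (χ : DirichletCharacter ℂ q) (hχ : χ ≠ 1) :
    hX q z χ = hc (gX q z χ) := by
  ext v
  rw [hX_eq_sum, hc]
  simp only [sum_char_cE q z hqz χ, if_neg hχ]

lemma hX_one (q z : ℕ) [NeZero q] (hqz : q < z) : hX q z 1 = 0 := by
  ext v
  rw [hX_eq_sum]
  simp only [sum_char_cE q z hqz, if_true]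
  simp

lemma char_inv_conj {q : ℕ} [NeZero q] (χ : DirichletCharacter ℂ q) (β : (ZMod q)ˣ) :
    χ ((β : ZMod q)⁻¹) = (starRingEnd ℂ) (χ β) := by
  have h1 : χ ((β : ZMod q)⁻¹) * χ β = 1 := by
    rw [← map_mul, ZMod.inv_mul_of_unit _ β.isUnit, map_one]
  have h2 : ‖χ β‖ = 1 := χ.unit_norm_eq_one β
  have h3 : (starRingEnd ℂ) (χ β) * χ β = 1 := by
    rw [Complex.conj_mul', h2]; simp
  exact mul_right_cancel₀ (right_ne_zero_of_mul_eq_one h1) (h1.trans h3.symm)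

lemma char_inversion {q : ℕ} [NeZero q] (α : (ZMod q)ˣ) (x : (ZMod q)ˣ → ℂ) :
    ∑ χ : DirichletCharacter ℂ q, χ ((α : ZMod q)⁻¹) * ∑ β : (ZMod q)ˣ, χ β * x β = Nat.totient q * x α := by
  classical
  simp_rw [Finset.mul_sum]
  rw [Finset.sum_comm]
  have : ∀ β : (ZMod q)ˣ, ∑ χ : DirichletCharacter ℂ q, χ ((α : ZMod q)⁻¹) * (χ β * x β) =
      if α = β then Nat.totient q * x β else 0 := by
    intro β
    simp_rw [← mul_assoc]
    rw [← Finset.sum_mul, DirichletCharacter.sum_char_inv_mul_char_eq ℂ α.isUnit]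
    by_cases h : α = β
    · simp [h]
    · have : ¬ ((α : ZMod q) = β) := fun h' => h (Units.ext h')
      simp [h, this]
  rw [Finset.sum_congr rfl (fun β _ => this β)]
  simp

lemma char_parseval {q : ℕ} [NeZero q] (x : (ZMod q)ˣ → ℂ) :
    ∑ χ : DirichletCharacter ℂ q, ‖∑ β : (ZMod q)ˣ, χ β * x β‖ ^ 2 = Nat.totient q * ∑ β : (ZMod q)ˣ, ‖x β‖ ^ 2 := by
  have h : ((∑ χ : DirichletCharacter ℂ q, ‖∑ β : (ZMod q)ˣ, χ β * x β‖ ^ 2 : ℝ) : ℂ) =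
      ((Nat.totient q * ∑ β : (ZMod q)ˣ, ‖x β‖ ^ 2 : ℝ) : ℂ) := by
    push_cast
    simp_rw [← Complex.conj_mul']
    rw [Finset.mul_sum]
    calc _ = ∑ χ : DirichletCharacter ℂ q, ∑ α : (ZMod q)ˣ, (starRingEnd ℂ (x α)) *
          (χ ((α : ZMod q)⁻¹) * ∑ β : (ZMod q)ˣ, χ β * x β) := by
          apply Finset.sum_congr rfl
          intro χ _
          rw [map_sum, Finset.sum_mul]
          apply Finset.sum_congr rfl
          intro α _
          rw [map_mul, char_inv_conj]
          ring
      _ = ∑ α : (ZMod q)ˣ, (starRingEnd ℂ (x α)) * ∑ χ : DirichletCharacter ℂ q,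
          (χ ((α : ZMod q)⁻¹) * ∑ β : (ZMod q)ˣ, χ β * x β) := by
          rw [Finset.sum_comm]
          simp_rw [Finset.mul_sum]
      _ = _ := by
          apply Finset.sum_congr rfl
          intro α _
          rw [char_inversion]
          ring
  exact_mod_cast h

section bounds
variable {q z : ℕ} [NeZero q] {B a : ℝ}

lemma hEc_bound (hb : ∀ (β : (ZMod q)ˣ) (v : ℝ), |hE q z β v| ≤ B / Nat.totient q * Real.exp (-(a * v)))
    (β : (ZMod q)ˣ) (v : ℝ) : ‖hEc q z β v‖ ≤ B / Nat.totient q * Real.exp (-(a * v)) := by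
  unfold hEc
  rw [Complex.norm_real]
  exact hb β v

lemma hEc_measurable (β : (ZMod q)ˣ) : Measurable (hEc q z β) :=
  Complex.measurable_ofReal.comp (hE_measurable q z β)

lemma hX_measurable (χ : DirichletCharacter ℂ q) : Measurable (hX q z χ) := by
  unfold hX
  exact Finset.measurable_sum _ (fun β _ => (hEc_measurable β).const_mul _)

lemma hX_bound (hb : ∀ (β : (ZMod q)ˣ) (v : ℝ), |hE q z β v| ≤ B / Nat.totient q * Real.exp (-(a * v)))
    (χ : DirichletCharacter ℂ q) (v : ℝ) : ‖hX q z χ v‖ ≤ B * Real.exp (-(a * v)) := by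
  unfold hX
  have hφ := totient_pos' q
  calc _ ≤ ∑ β : (ZMod q)ˣ, B / Nat.totient q * Real.exp (-(a * v)) := by
        refine (norm_sum_le _ _).trans (Finset.sum_le_sum fun β _ => ?_)
        rw [norm_mul, χ.unit_norm_eq_one, one_mul]
        exact hEc_bound hb β v
    _ = _ := by
        rw [Finset.sum_const, card_units', nsmul_eq_mul]
        field_simp

lemma Lp_hX (hb : ∀ (β : (ZMod q)ˣ) (v : ℝ), |hE q z β v| ≤ B / Nat.totient q * Real.exp (-(a * v)))
    (χ : DirichletCharacter ℂ q) (j : ℕ) (w : ℂ) (hw : -a < w.re) :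
    Lp (hX q z χ) j w = ∑ β : (ZMod q)ˣ, χ β * Lp (hEc q z β) j w := by
  unfold Lp
  simp_rw [← integral_const_mul]
  rw [← integral_finsetSum]
  · congr 1
    ext v
    unfold hX
    rw [Finset.mul_sum, Finset.sum_mul]
    apply Finset.sum_congr rfl
    intro β _
    ring
  · intro β _
    exact (Lp_integrable (hEc_measurable β) (hEc_bound hb β) j w hw).const_mul _

/-- Mean square over characters. -/
lemma hX_mean_square (hb : ∀ (β : (ZMod q)ˣ) (v : ℝ), |hE q z β v| ≤ B / Nat.totient q * Real.exp (-(a * v)))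
    (ha : 0 < a) (j : ℕ) {δ : ℝ} (hδ : 0 ≤ δ) :
    ∑ χ : DirichletCharacter ℂ q, ∫ t in (-1:ℝ)..1, ‖Lp (hX q z χ) j (δ + Complex.I * t)‖ ^ 2 ≤
      18 * (B ^ 2 * ((Nat.factorial (2*j)) / (2*a)^(2*j+1))) := by
  have hφ := totient_pos' q
  have hre : ∀ t : ℝ, -a < ((δ:ℂ) + Complex.I * t).re := by intro t; simp; linarith
  have hline : Continuous (fun t : ℝ => (δ:ℂ) + Complex.I * t) := by fun_prop
  have hcont : ∀ h : ℝ → ℂ, ∀ B' : ℝ, Measurable h → (∀ v, ‖h v‖ ≤ B' * Real.exp (-(a * v))) →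
      Continuous (fun t : ℝ => ‖Lp h j (δ + Complex.I * t)‖ ^ 2) := by
    intro h B' hm hb'
    have : Continuous (fun t : ℝ => Lp h j (δ + Complex.I * t)) := by
      rw [continuous_iff_continuousAt]
      intro t
      exact ContinuousAt.comp (f := fun t : ℝ => (δ:ℂ) + Complex.I * t) (Lp_hasDerivAt hm hb' j _ (hre t)).continuousAt hline.continuousAt
    fun_prop
  rw [← intervalIntegral.integral_finsetSum (fun χ _ => (hcont _ _ (hX_measurable χ) (hX_bound hb χ)).intervalIntegrable _ _)]
  have e : ∀ t : ℝ, ∑ χ : DirichletCharacter ℂ q, ‖Lp (hX q z χ) j (δ + Complex.I * t)‖ ^ 2 =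
      Nat.totient q * ∑ β : (ZMod q)ˣ, ‖Lp (hEc q z β) j (δ + Complex.I * t)‖ ^ 2 := by
    intro t
    rw [← char_parseval]
    apply Finset.sum_congr rfl
    intro χ _
    rw [Lp_hX hb χ j _ (hre t)]
  simp_rw [e]
  rw [intervalIntegral.integral_const_mul,
    intervalIntegral.integral_finsetSum (fun β _ => (hcont _ _ (hEc_measurable β) (hEc_bound hb β)).intervalIntegrable _ _)]
  calc _ ≤ (Nat.totient q : ℝ) * ∑ _β : (ZMod q)ˣ, (18:ℝ) * ((B / Nat.totient q) ^ 2 * ((Nat.factorial (2*j)) / (2*a)^(2*j+1))) := by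
        gcongr with β _
        exact Lp_mean_square (hEc_measurable β) (hEc_bound hb β) ha j hδ
    _ = _ := by
        rw [Finset.sum_const, card_units', nsmul_eq_mul]
        field_simp

end bounds
end Gall

end

section

open Finset MeasureTheory
namespace Gall

def lev (q z : ℕ) : ℕ := q * PP q z

instance lev_neZero (q z : ℕ) [NeZero q] : NeZero (lev q z) :=
  ⟨mul_ne_zero (NeZero.ne q) (PP_pos q z).ne'⟩

lemma lev_dvd (q z : ℕ) : q ∣ lev q z := Dvd.intro _ rfl

noncomputable def chz (q z : ℕ) (χ : DirichletCharacter ℂ q) : DirichletCharacter ℂ (lev q z) :=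
  DirichletCharacter.changeLevel (lev_dvd q z) χ

lemma chz_apply (q z : ℕ) [NeZero q] (hqz : q < z) (χ : DirichletCharacter ℂ q) {n : ℕ} (hn : n ≠ 0) :
    chz q z χ n = LSeries.delta n + gX q z χ n := by
  classical
  have hq : 0 < q := Nat.pos_of_ne_zero (NeZero.ne q)
  unfold gX
  by_cases hcop : Nat.Coprime n (lev q z)
  · have h1 : chz q z χ n = χ n := by
      have := DirichletCharacter.changeLevel_eq_cast_of_dvd' χ (lev_dvd q z) (a := (n:ℤ))
        (by rw [Nat.isCoprime_iff_coprime]; exact hcop)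
      simpa [chz] using this
    have h2 := Nat.Coprime.coprime_mul_right_right hcop
    have h3 := Nat.Coprime.coprime_mul_left_right hcop
    rw [h1]
    by_cases hn1 : n = 1
    · have : ¬ Rough z n := by rintro ⟨h, _⟩; omega
      rw [if_neg this, hn1]
      simp [LSeries.delta]
    · have : Rough z n := (rough_iff h2).2 ⟨by omega, h3⟩
      simp [this, hn1, LSeries.delta]
  · have h1 : chz q z χ n = 0 := by
      apply MulChar.map_nonunit
      rwa [ZMod.isUnit_iff_coprime]
    have hn1 : n ≠ 1 := by rintro rfl; exact hcop (Nat.coprime_one_left _)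
    have : ¬ Rough z n := by
      intro h
      have h2 := h.coprime hq hqz
      exact hcop (Nat.Coprime.mul_right h2 ((rough_iff h2).1 h).2)
    simp [h1, this, hn1, LSeries.delta]

lemma gX_norm_le (q z : ℕ) (χ : DirichletCharacter ℂ q) (n : ℕ) : ‖gX q z χ n‖ ≤ 1 := by
  unfold gX
  split_ifs
  · exact χ.norm_le_one _
  · simp

noncomputable def FF (q z : ℕ) [NeZero q] (χ : DirichletCharacter ℂ q) (w : ℂ) : ℂ := 1 + (1 + w) * Lp (hX q z χ) 0 w
noncomputable def FF1 (q z : ℕ) [NeZero q] (χ : DirichletCharacter ℂ q) (w : ℂ) : ℂ :=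
  Lp (hX q z χ) 0 w + (1 + w) * Lp (hX q z χ) 1 w
noncomputable def FF2 (q z : ℕ) [NeZero q] (χ : DirichletCharacter ℂ q) (w : ℂ) : ℂ :=
  2 * Lp (hX q z χ) 1 w + (1 + w) * Lp (hX q z χ) 2 w

lemma LSeries_chz (q z : ℕ) [NeZero q] (hqz : q < z) (χ : DirichletCharacter ℂ q) (hχ : χ ≠ 1) (w : ℂ)
    (hw : 0 < w.re) : LSeries (chz q z χ ·) (1 + w) = FF q z χ w := by
  have hs : 1 < (1 + w).re := by simpa using hw
  rw [LSeries_congr (g := LSeries.delta + gX q z χ) (fun {n} hn => chz_apply q z hqz χ hn), LSeries_add,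
    LSeries_delta, FF, hX_eq q z hqz χ hχ, LSeries_eq_Lp (gX q z χ) 1 (gX_norm_le q z χ) w hw]
  · rfl
  · apply LSeriesSummable_of_bounded_of_one_lt_re (m := 1) _ hs
    intro n _
    unfold LSeries.delta
    split_ifs <;> simp
  · exact LSeriesSummable_of_bounded_of_one_lt_re (m := 1) (fun n _ => gX_norm_le q z χ n) hs

section bounds
variable {q z : ℕ} [NeZero q] {B a : ℝ}

lemma FF_hasDerivAt (hb : ∀ (β : (ZMod q)ˣ) (v : ℝ), |hE q z β v| ≤ B / Nat.totient q * Real.exp (-(a * v)))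
    (χ : DirichletCharacter ℂ q) (w : ℂ) (hw : -a < w.re) : HasDerivAt (FF q z χ) (FF1 q z χ w) w := by
  have h1 := Lp_hasDerivAt (hX_measurable χ) (hX_bound hb χ) 0 w hw
  have h2 := (((hasDerivAt_id w).const_add 1).mul h1).const_add 1
  refine h2.congr_deriv ?_
  simp [FF1]

lemma FF1_hasDerivAt (hb : ∀ (β : (ZMod q)ˣ) (v : ℝ), |hE q z β v| ≤ B / Nat.totient q * Real.exp (-(a * v)))
    (χ : DirichletCharacter ℂ q) (w : ℂ) (hw : -a < w.re) : HasDerivAt (FF1 q z χ) (FF2 q z χ w) w := by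
  have h1 := Lp_hasDerivAt (hX_measurable χ) (hX_bound hb χ) 0 w hw
  have h3 := Lp_hasDerivAt (hX_measurable χ) (hX_bound hb χ) 1 w hw
  have h2 := h1.add (((hasDerivAt_id w).const_add 1).mul h3)
  refine h2.congr_deriv ?_
  simp [FF2]; ring

lemma FF_norm_le (hb : ∀ (β : (ZMod q)ˣ) (v : ℝ), |hE q z β v| ≤ B / Nat.totient q * Real.exp (-(a * v)))
    (χ : DirichletCharacter ℂ q) (w : ℂ) (hw : -a < w.re) : ‖FF q z χ w‖ ≤ 1 + (1 + ‖w‖) * (B / (a + w.re)) := by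
  have h1 := Lp_norm_le (hX_bound hb χ) 0 w hw
  unfold FF
  refine (norm_add_le _ _).trans ?_
  rw [norm_one, norm_mul]
  simp only [Nat.factorial_zero, Nat.cast_one, zero_add, pow_one, mul_one_div] at h1
  gcongr
  exact (norm_add_le _ _).trans (by simp)

lemma LFunction_chz (hqz : q < z)
    (hb : ∀ (β : (ZMod q)ˣ) (v : ℝ), |hE q z β v| ≤ B / Nat.totient q * Real.exp (-(a * v)))
    (χ : DirichletCharacter ℂ q) (hχ : χ ≠ 1) (w : ℂ) (hw : -a < w.re) (ha : 0 < a) :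
    DirichletCharacter.LFunction (chz q z χ) (1 + w) = FF q z χ w := by
  have hχ' : chz q z χ ≠ 1 := by
    unfold chz
    exact fun h => hχ ((DirichletCharacter.changeLevel_eq_one_iff (lev_dvd q z)).1 h)
  have hopen : IsOpen {w : ℂ | -a < w.re} := isOpen_lt continuous_const Complex.continuous_re
  have hA1 : AnalyticOnNhd ℂ (fun w => DirichletCharacter.LFunction (chz q z χ) (1 + w)) {w : ℂ | -a < w.re} := by
    apply DifferentiableOn.analyticOnNhd _ hopen
    exact ((DirichletCharacter.differentiable_LFunction hχ').comp (differentiable_id.const_add 1)).differentiableOn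
  have hA2 : AnalyticOnNhd ℂ (FF q z χ) {w : ℂ | -a < w.re} := by
    apply DifferentiableOn.analyticOnNhd _ hopen
    intro w hw
    exact (FF_hasDerivAt hb χ w hw).differentiableAt.differentiableWithinAt
  have hpre : IsPreconnected {w : ℂ | -a < w.re} := (convex_halfSpace_re_gt (-a)).isPreconnected
  refine hA1.eqOn_of_preconnected_of_eventuallyEq hA2 hpre (z₀ := 1) (by simp; linarith) ?_ hw
  have : {w : ℂ | 0 < w.re} ∈ nhds (1:ℂ) :=
    (isOpen_lt continuous_const Complex.continuous_re).mem_nhds (by simp)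
  filter_upwards [this] with w hw
  rw [DirichletCharacter.LFunction_eq_LSeries _ (by simpa using hw)]
  exact LSeries_chz q z hqz χ hχ w hw

lemma FF_ne_zero (hqz : q < z)
    (hb : ∀ (β : (ZMod q)ˣ) (v : ℝ), |hE q z β v| ≤ B / Nat.totient q * Real.exp (-(a * v)))
    (χ : DirichletCharacter ℂ q) (hχ : χ ≠ 1) (w : ℂ) (hw : -a < w.re) (ha : 0 < a) (hw1 : -1 < w.re)
    (hL : DirichletCharacter.LFunction χ (1 + w) ≠ 0) : FF q z χ w ≠ 0 := by
  rw [← LFunction_chz hqz hb χ hχ w hw ha, chz, DirichletCharacter.LFunction_changeLevel _ _ (Or.inl hχ)]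
  apply mul_ne_zero hL
  rw [Finset.prod_ne_zero_iff]
  intro p hp h0
  have hp' := Nat.prime_of_mem_primeFactors hp
  have h1 : χ p * (p:ℂ) ^ (-(1 + w)) = 1 := (sub_eq_zero.1 h0).symm
  have h2 : ‖χ p * (p:ℂ) ^ (-(1 + w))‖ < 1 := by
    rw [norm_mul, Complex.norm_natCast_cpow_of_pos hp'.pos]
    have h3 : ((p:ℝ)) ^ (-(1 + w)).re < 1 := by
      apply Real.rpow_lt_one_of_one_lt_of_neg (by exact_mod_cast hp'.one_lt)
      simp; linarith
    have h4 := χ.norm_le_one p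
    have h5 : 0 ≤ ((p:ℝ)) ^ (-(1 + w)).re := by positivity
    nlinarith [norm_nonneg (χ p)]
  rw [h1] at h2
  simp at h2

lemma LSeries_Lambda (hqz : q < z)
    (hb : ∀ (β : (ZMod q)ˣ) (v : ℝ), |hE q z β v| ≤ B / Nat.totient q * Real.exp (-(a * v)))
    (χ : DirichletCharacter ℂ q) (hχ : χ ≠ 1) (w : ℂ) (hw : 0 < w.re) (ha : 0 < a) :
    FF q z χ w ≠ 0 ∧
    LSeries (fun n => gX q z χ n * (ArithmeticFunction.vonMangoldt n : ℂ)) (1 + w) = -(FF1 q z χ w / FF q z χ w) := by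
  have hs : 1 < (1 + w).re := by simpa using hw
  have h1 := DirichletCharacter.LSeries_twist_vonMangoldt_eq (chz q z χ) hs
  have h2 : deriv (LSeries (chz q z χ ·)) (1 + w) = FF1 q z χ w := by
    have hd : HasDerivAt (LSeries (chz q z χ ·)) (deriv (LSeries (chz q z χ ·)) (1 + w)) (1 + w) := by
      have : DifferentiableAt ℂ (LSeries (chz q z χ ·)) (1 + w) := by
        refine (LSeries_hasDerivAt ?_).differentiableAt
        rw [DirichletCharacter.absicssaOfAbsConv_eq_one (NeZero.ne _)]
        exact_mod_cast hs
      exact this.hasDerivAt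
    have h3 := HasDerivAt.comp_const_add (1:ℂ) w hd
    have h4 := FF_hasDerivAt hb χ w (by linarith)
    refine h3.unique (h4.congr_of_eventuallyEq ?_)
    have : {w : ℂ | 0 < w.re} ∈ nhds w :=
      (isOpen_lt continuous_const Complex.continuous_re).mem_nhds hw
    filter_upwards [this] with w hw
    exact LSeries_chz q z hqz χ hχ w hw
  have h0 : FF q z χ w ≠ 0 := by
    rw [← LSeries_chz q z hqz χ hχ w hw]
    exact DirichletCharacter.LSeries_ne_zero_of_one_lt_re _ hs
  refine ⟨h0, ?_⟩
  rw [h2, LSeries_chz q z hqz χ hχ w hw] at h1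
  rw [← neg_div, ← h1]
  apply LSeries_congr
  intro n hn
  simp only [Pi.mul_apply]
  rw [chz_apply q z hqz χ hn]
  unfold LSeries.delta
  by_cases hn1 : n = 1
  · simp [hn1]
  · simp [hn1]

open Classical in
noncomputable def rgh (z n : ℕ) : ℂ := if Rough z n then 1 else 0

lemma rgh_norm (z n : ℕ) : ‖rgh z n‖ ≤ 1 := by unfold rgh; split_ifs <;> simp

lemma FF_inv_le (hqz : q < z) (χ : DirichletCharacter ℂ q) (hχ : χ ≠ 1) (w : ℂ) (hw : 0 < w.re) :
    1 ≤ (1 + ‖LSeries (rgh z) (1 + w.re)‖) * ‖FF q z χ w‖ := by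
  have hs : 1 < (1 + w).re := by simpa using hw
  have h1 := DirichletCharacter.LSeries.mul_mu_eq_one (chz q z χ) hs
  rw [LSeries_chz q z hqz χ hχ w hw] at h1
  have h2 : LSeries ((fun n : ℕ => chz q z χ n) * (fun n : ℕ => (ArithmeticFunction.moebius n : ℂ))) (1 + w) =
      LSeries (LSeries.delta + fun n : ℕ => gX q z χ n * (ArithmeticFunction.moebius n : ℂ)) (1 + w) := by
    apply LSeries_congr
    intro n hn
    simp only [Pi.mul_apply, Pi.add_apply]
    rw [chz_apply q z hqz χ hn]
    by_cases hn1 : n = 1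
    · simp [hn1, LSeries.delta, add_mul]
    · simp [hn1, LSeries.delta]
  have hmu : ∀ n, ‖gX q z χ n * (ArithmeticFunction.moebius n : ℂ)‖ ≤ ‖rgh z n‖ := by
    intro n
    rw [norm_mul]
    unfold gX rgh
    split_ifs
    · have h5 : ‖((ArithmeticFunction.moebius n : ℤ) : ℂ)‖ ≤ 1 := by
        rw [Complex.norm_intCast]
        exact_mod_cast ArithmeticFunction.abs_moebius_le_one
      have := χ.norm_le_one n
      simp only [norm_one]
      nlinarith [norm_nonneg (χ n)]
    · simp
  have hsum1 : LSeriesSummable (fun n : ℕ => gX q z χ n * (ArithmeticFunction.moebius n : ℂ)) (1 + w) :=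
    LSeriesSummable_of_bounded_of_one_lt_re (m := 1) (fun n _ => (hmu n).trans (rgh_norm z n)) hs
  have hs' : 1 < ((1 + w.re : ℂ)).re := by simpa using hw
  have hsum2 : LSeriesSummable (rgh z) (1 + w.re) :=
    LSeriesSummable_of_bounded_of_one_lt_re (m := 1) (fun n _ => (rgh_norm z n)) hs'
  have h3 : LSeries (LSeries.delta + fun n : ℕ => gX q z χ n * (ArithmeticFunction.moebius n : ℂ)) (1 + w) =
      1 + LSeries (fun n : ℕ => gX q z χ n * (ArithmeticFunction.moebius n : ℂ)) (1 + w) := by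
    rw [LSeries_add _ hsum1, LSeries_delta]
    · rfl
    · apply LSeriesSummable_of_bounded_of_one_lt_re (m := 1) _ hs
      intro n _
      unfold LSeries.delta
      split_ifs <;> simp
  have h4 : ‖LSeries (fun n : ℕ => gX q z χ n * (ArithmeticFunction.moebius n : ℂ)) (1 + w)‖ ≤
      ‖LSeries (rgh z) (1 + w.re)‖ := by
    have e : ∀ n, LSeries.term (rgh z) (1 + w.re) n = ((‖LSeries.term (rgh z) (1 + w.re) n‖ : ℝ) : ℂ) := by
      intro n
      rw [LSeries.norm_term_eq, LSeries.term_def]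
      split_ifs with h0
      · simp
      · unfold rgh
        have : (n:ℂ) ^ ((1:ℂ) + w.re) = (((n:ℝ) ^ (1 + w.re) : ℝ) : ℂ) := by
          rw [Complex.ofReal_cpow (by positivity)]; push_cast; rfl
        rw [this]
        split_ifs <;> simp
    have e2 : LSeries (rgh z) (1 + w.re) = ((∑' n, ‖LSeries.term (rgh z) (1 + w.re) n‖ : ℝ) : ℂ) := by
      rw [Complex.ofReal_tsum]
      exact tsum_congr e
    rw [e2, Complex.norm_real, Real.norm_of_nonneg (tsum_nonneg fun _ => norm_nonneg _)]
    refine (norm_tsum_le_tsum_norm hsum1.norm).trans ?_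
    apply Summable.tsum_le_tsum _ hsum1.norm hsum2.norm
    intro n
    rw [LSeries.norm_term_eq, LSeries.norm_term_eq]
    split_ifs
    · exact le_rfl
    · simp only [Complex.add_re, Complex.one_re, Complex.ofReal_re]
      gcongr
      exact hmu n
  have h6 : ‖LSeries ((fun n : ℕ => chz q z χ n) * (fun n : ℕ => (ArithmeticFunction.moebius n : ℂ))) (1 + w)‖ ≤
      1 + ‖LSeries (rgh z) (1 + w.re)‖ := by
    rw [h2, h3]
    refine (norm_add_le _ _).trans ?_
    rw [norm_one]; gcongr
  calc 1 = ‖FF q z χ w * LSeries ((fun n : ℕ => chz q z χ n) * (fun n : ℕ => (ArithmeticFunction.moebius n : ℂ))) (1 + w)‖ := by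
        rw [h1, norm_one]
    _ ≤ ‖FF q z χ w‖ * (1 + ‖LSeries (rgh z) (1 + w.re)‖) := by
        rw [norm_mul]; gcongr
    _ = _ := by ring

end bounds
end Gall

end

section

open Finset MeasureTheory
namespace Gall

lemma hc_rgh_eq (z : ℕ) (v : ℝ) : hc (rgh z) v = ((NN 1 z ((1 : (ZMod 1)ˣ) : ZMod 1) (Real.exp v) * Real.exp (-v) : ℝ) : ℂ) := by
  classical
  unfold hc NN rgh
  rw [Finset.sum_boole]
  push_cast
  congr 3
  congr 1
  ext n
  simp only [Units.val_one, iff_self_and]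
  exact fun _ => Subsingleton.elim _ _

lemma hc_rgh_bound : ∃ C > (0:ℝ), ∀ z : ℕ, 2 ≤ z → ∀ v : ℝ, ‖hc (rgh z) v‖ ≤ C / Real.log z * Real.exp (-(0 * v)) := by
  obtain ⟨C, hC, h⟩ := SS_BT
  refine ⟨C, hC, ?_⟩
  intro z hz v
  have hz' : (2:ℝ) ≤ z := by exact_mod_cast hz
  have hl : 0 < Real.log z := Real.log_pos (by linarith)
  rw [hc_rgh_eq, Complex.norm_real, Real.norm_of_nonneg (mul_nonneg (NN_nonneg _ _ _ _) (Real.exp_pos _).le)]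
  simp only [zero_mul, neg_zero, Real.exp_zero, mul_one]
  by_cases hv : Real.exp v < z
  · rw [NN_zero _ _ _ _ hv, zero_mul]; positivity
  · push Not at hv
    have h1 := (NN_SS 1 z 1 (Real.exp v)).1
    have h2 := h 1 ((1 : (ZMod 1)ˣ) : ZMod 1) z (Real.exp v) hz (by push_cast; linarith) hv
    have h3 := h1.trans h2
    simp only [Nat.totient_one, Nat.cast_one, one_mul] at h3
    calc _ ≤ C * (Real.exp v / Real.log z) * Real.exp (-v) := by gcongr
      _ = C / Real.log z * (Real.exp v * Real.exp (-v)) := by ring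
      _ = _ := by rw [← Real.exp_add]; simp

lemma rgh_LSeries : ∃ C > (0:ℝ), ∀ z : ℕ, 2 ≤ z → ∀ σ : ℝ, 0 < σ →
    ‖LSeries (rgh z) (1 + σ)‖ ≤ C * ((1 + σ) / (σ * Real.log z)) := by
  obtain ⟨C, hC, h⟩ := hc_rgh_bound
  refine ⟨C, hC, ?_⟩
  intro z hz σ hσ
  have hz' : (2:ℝ) ≤ z := by exact_mod_cast hz
  have hl : 0 < Real.log z := Real.log_pos (by linarith)
  rw [LSeries_eq_Lp (rgh z) 1 (rgh_norm z) σ (by simpa using hσ), norm_mul]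
  have h1 := Lp_norm_le (h z hz) 0 (σ:ℂ) (by simpa using hσ)
  have h2 : ‖(1 + σ : ℂ)‖ = 1 + σ := by
    rw [show (1 + σ : ℂ) = ((1 + σ : ℝ) : ℂ) by push_cast; rfl, Complex.norm_real, Real.norm_of_nonneg (by linarith)]
  rw [h2]
  simp only [Nat.factorial_zero, Nat.cast_one, zero_add, pow_one, Complex.ofReal_re] at h1
  calc _ ≤ (1 + σ) * (C / Real.log z * (1 / σ)) := by gcongr
    _ = _ := by field_simp

/-- Bounded inverse near the 1-line. -/
lemma FF_inv (C : ℝ) (hC : 0 < C) : ∃ K ≥ (1:ℝ), ∀ (q z : ℕ) [NeZero q], q < z → 1 ≤ Real.log z →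
    (∀ (β : (ZMod q)ˣ) (v : ℝ), |hE q z β v| ≤ (C / Real.log z) / Nat.totient q * Real.exp (-(1 / (64 * Real.log z) * v))) →
    ∀ χ : DirichletCharacter ℂ q, χ ≠ 1 →
    (∀ w : ℂ, -(1 / (128 * Real.log z)) < w.re → |w.im| ≤ 2 → DirichletCharacter.LFunction χ (1 + w) ≠ 0) →
    ∀ δ t : ℝ, 0 < δ → δ ≤ 1 / (256 * Real.log z) → |t| ≤ 1 → 1 ≤ K * ‖FF q z χ (δ + Complex.I * t)‖ := by
  obtain ⟨C1, hC1, hr⟩ := rgh_LSeries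
  set B : ℝ := 1 + 640 * C with hBdef
  set B1 : ℝ := 1 + 512 * C1 with hB1def
  have hBB : 1 < B * B1 := by
    have : 0 < C * C1 := by positivity
    rw [hBdef, hB1def]; nlinarith
  have hKpos : 1 ≤ B1 * Real.exp (2 * Real.log (B * B1)) := by
    have h1 : 1 ≤ Real.exp (2 * Real.log (B * B1)) := Real.one_le_exp (by have := Real.log_pos hBB; linarith)
    have h2 : 1 ≤ B1 := by rw [hB1def]; linarith
    nlinarith
  refine ⟨B1 * Real.exp (2 * Real.log (B * B1)), hKpos, ?_⟩
  intro q z _ hqz hl hb χ hχ hzf δ t hδ0 hδ ht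
  set ℓ := Real.log z with hℓ
  have hl0 : 0 < ℓ := by linarith
  set a : ℝ := 1 / (64 * ℓ) with hadef
  have ha : 0 < a := by positivity
  have haℓ : a * ℓ = 1 / 64 := by rw [hadef]; field_simp
  have ha1 : a ≤ 1 / 64 := by
    rw [hadef]; apply one_div_le_one_div_of_le <;> linarith
  have hz2 : 2 ≤ z := by
    have : z ≠ 0 := by rintro rfl; omega
    have : z ≠ 1 := by rintro rfl; simp [hℓ] at hl; linarith
    omega
  have e1 : 1 / (128 * ℓ) = a / 2 := by rw [hadef]; field_simp; norm_num
  have e2 : 1 / (256 * ℓ) = a / 4 := by rw [hadef]; field_simp; norm_num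
  rw [e1] at hzf
  rw [e2] at hδ
  have hball : ∀ w ∈ Metric.ball (((a / 4 : ℝ) : ℂ) + Complex.I * t) (3 * a / 4), -(a/2) < w.re ∧ w.re < a ∧ |w.im| ≤ 2 := by
    intro w hw
    rw [Metric.mem_ball, dist_eq_norm] at hw
    have h1 := (Complex.abs_re_le_norm _).trans_lt hw
    have h2 := (Complex.abs_im_le_norm _).trans_lt hw
    simp only [Complex.sub_re, Complex.add_re, Complex.ofReal_re, Complex.mul_re, Complex.I_re, Complex.I_im,
      Complex.ofReal_im, Complex.sub_im, Complex.add_im, Complex.mul_im] at h1 h2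
    rw [abs_lt] at h1 h2
    rw [abs_le] at ht ⊢
    refine ⟨?_, ?_, ?_, ?_⟩ <;> linarith [h1.1, h1.2, h2.1, h2.2, ht.1, ht.2]
  apply bc_inv (r := 3 * a / 4) (w0 := ((a / 4 : ℝ) : ℂ) + Complex.I * t) (by positivity)
  · intro w hw
    have := (hball w hw).1
    exact (FF_hasDerivAt hb χ w (by linarith)).differentiableAt.differentiableWithinAt
  · intro w hw
    obtain ⟨h1, h2, h3⟩ := hball w hw
    exact FF_ne_zero hqz hb χ hχ w (by linarith) ha (by linarith) (hzf w h1 h3)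
  · intro w hw
    obtain ⟨h1, h2, h3⟩ := hball w hw
    refine (FF_norm_le hb χ w (by linarith)).trans ?_
    have h4 : ‖w‖ ≤ 4 := by
      refine (Complex.norm_le_abs_re_add_abs_im w).trans ?_
      have : |w.re| ≤ 1 := by rw [abs_le]; constructor <;> linarith
      linarith
    have h5 : C / ℓ / (a + w.re) ≤ 128 * C := by
      rw [div_div, div_le_iff₀ (by apply mul_pos hl0; linarith)]
      have : 1 / 128 ≤ ℓ * (a + w.re) := by nlinarith
      nlinarith
    have h6 : 0 ≤ C / ℓ / (a + w.re) := div_nonneg (by positivity) (by linarith)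
    rw [hBdef]
    nlinarith [norm_nonneg w]
  · positivity
  · refine (FF_inv_le hqz χ hχ (((a / 4 : ℝ) : ℂ) + Complex.I * t) (by simpa using ha)).trans ?_
    gcongr
    rw [hB1def]
    have h1 := hr z hz2 (a/4) (by positivity)
    have h2 : C1 * ((1 + a/4) / (a/4 * Real.log z)) ≤ 512 * C1 := by
      rw [← hℓ, show a / 4 * ℓ = 1 / 256 by linarith]
      nlinarith
    have h3 : ((((a/4:ℝ):ℂ) + Complex.I * t).re) = a/4 := by simp
    rw [h3]
    linarith
  · exact hBB
  · have : ((δ:ℂ) + Complex.I * t - (((a/4 : ℝ):ℂ) + Complex.I * t)) = ((δ - a/4 : ℝ) : ℂ) := by push_cast; ring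
    rw [this, Complex.norm_real, Real.norm_eq_abs, abs_le]
    constructor <;> linarith

end Gall

end

section

open Finset MeasureTheory
namespace Gall

/-- The quadratic remainder of the logarithmic derivative. -/
noncomputable def RR (q z : ℕ) [NeZero q] (χ : DirichletCharacter ℂ q) (w : ℂ) : ℂ :=
  FF1 q z χ w * (FF q z χ w - 1) / FF q z χ w

noncomputable def RR1 (q z : ℕ) [NeZero q] (χ : DirichletCharacter ℂ q) (w : ℂ) : ℂ :=
  FF2 q z χ w * (FF q z χ w - 1) / FF q z χ w + FF1 q z χ w ^ 2 / FF q z χ w ^ 2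

section bounds
variable {q z : ℕ} [NeZero q] {B a : ℝ}

lemma FF2_continuousAt (hb : ∀ (β : (ZMod q)ˣ) (v : ℝ), |hE q z β v| ≤ B / Nat.totient q * Real.exp (-(a * v)))
    (χ : DirichletCharacter ℂ q) (w : ℂ) (hw : -a < w.re) : ContinuousAt (FF2 q z χ) w := by
  have h1 := (Lp_hasDerivAt (hX_measurable χ) (hX_bound hb χ) 1 w hw).continuousAt
  have h2 := (Lp_hasDerivAt (hX_measurable χ) (hX_bound hb χ) 2 w hw).continuousAt
  unfold FF2
  fun_prop

lemma RR_hasDerivAt (hb : ∀ (β : (ZMod q)ˣ) (v : ℝ), |hE q z β v| ≤ B / Nat.totient q * Real.exp (-(a * v)))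
    (χ : DirichletCharacter ℂ q) (w : ℂ) (hw : -a < w.re) (h0 : FF q z χ w ≠ 0) :
    HasDerivAt (RR q z χ) (RR1 q z χ w) w := by
  have h1 := FF_hasDerivAt hb χ w hw
  have h2 := FF1_hasDerivAt hb χ w hw
  have h3 := (h2.mul (h1.sub_const 1)).div h1 h0
  refine h3.congr_deriv ?_
  unfold RR1
  simp only [Pi.mul_apply]
  field_simp
  ring

lemma RR1_continuousAt (hb : ∀ (β : (ZMod q)ˣ) (v : ℝ), |hE q z β v| ≤ B / Nat.totient q * Real.exp (-(a * v)))
    (χ : DirichletCharacter ℂ q) (w : ℂ) (hw : -a < w.re) (h0 : FF q z χ w ≠ 0) :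
    ContinuousAt (RR1 q z χ) w := by
  have h1 := (FF_hasDerivAt hb χ w hw).continuousAt
  have h2 := (FF1_hasDerivAt hb χ w hw).continuousAt
  have h3 := FF2_continuousAt hb χ w hw
  unfold RR1
  have h4 : FF q z χ w ^ 2 ≠ 0 := pow_ne_zero _ h0
  exact ((h3.mul (h1.sub continuousAt_const)).div h1 h0).add ((h2.pow 2).div (h1.pow 2) h4)

lemma RR_pointwise (χ : DirichletCharacter ℂ q) (w : ℂ) (hw : ‖1 + w‖ ≤ 3) {K ℓ : ℝ} (hK : 1 ≤ K) (hℓ : 1 ≤ ℓ)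
    (h0 : 1 ≤ K * ‖FF q z χ w‖) :
    ‖RR q z χ w‖ + ‖RR1 q z χ w‖ ≤ K ^ 2 * (20 * ℓ ^ 2 * ‖Lp (hX q z χ) 0 w‖ ^ 2 + 31 * ‖Lp (hX q z χ) 1 w‖ ^ 2
      + 9 / ℓ ^ 2 * ‖Lp (hX q z χ) 2 w‖ ^ 2) := by
  set m0 := ‖Lp (hX q z χ) 0 w‖ with hm0
  set m1 := ‖Lp (hX q z χ) 1 w‖ with hm1
  set m2 := ‖Lp (hX q z χ) 2 w‖ with hm2
  have p0 : 0 ≤ m0 := norm_nonneg _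
  have p1 : 0 ≤ m1 := norm_nonneg _
  have p2 : 0 ≤ m2 := norm_nonneg _
  have hF : 0 < ‖FF q z χ w‖ := by
    by_contra h
    have : ‖FF q z χ w‖ = 0 := le_antisymm (not_lt.1 h) (norm_nonneg _)
    rw [this] at h0; linarith
  have hinv : ‖FF q z χ w‖⁻¹ ≤ K := by
    rw [inv_le_iff_one_le_mul₀ hF]; exact h0
  have hinv0 : 0 < ‖FF q z χ w‖⁻¹ := by positivity
  have g0 : ‖FF q z χ w - 1‖ ≤ 3 * m0 := by
    unfold FF
    rw [add_sub_cancel_left, norm_mul]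
    gcongr
  have g1 : ‖FF1 q z χ w‖ ≤ m0 + 3 * m1 := by
    unfold FF1
    refine (norm_add_le _ _).trans ?_
    rw [norm_mul]
    gcongr
  have g2 : ‖FF2 q z χ w‖ ≤ 2 * m1 + 3 * m2 := by
    unfold FF2
    refine (norm_add_le _ _).trans ?_
    rw [norm_mul, norm_mul]
    have : ‖(2:ℂ)‖ = 2 := by simp
    rw [this]
    gcongr
  have r0 : ‖RR q z χ w‖ ≤ K * ((m0 + 3 * m1) * (3 * m0)) := by
    unfold RR
    rw [norm_div, norm_mul, div_eq_mul_inv, mul_comm]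
    gcongr
  have r1 : ‖RR1 q z χ w‖ ≤ K * ((2 * m1 + 3 * m2) * (3 * m0)) + K ^ 2 * (m0 + 3 * m1) ^ 2 := by
    unfold RR1
    refine (norm_add_le _ _).trans ?_
    rw [norm_div, norm_mul, norm_div, norm_pow, norm_pow, div_eq_mul_inv, mul_comm, div_eq_mul_inv, ← inv_pow,
      mul_comm (‖FF1 q z χ w‖ ^ 2)]
    gcongr
  have hKK : K ≤ K ^ 2 := by nlinarith
  have x1 : (2 * m1 + 3 * m2) * (3 * m0) ≤ 9 / 2 * ℓ ^ 2 * m0 ^ 2 + (4 * m1 ^ 2 + 9 * m2 ^ 2) / ℓ ^ 2 := by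
    have hl2 : 0 < ℓ ^ 2 := by positivity
    rw [← sub_nonneg]
    have : 9 / 2 * ℓ ^ 2 * m0 ^ 2 + (4 * m1 ^ 2 + 9 * m2 ^ 2) / ℓ ^ 2 - (2 * m1 + 3 * m2) * (3 * m0) =
        (1/2 * (3 * ℓ * m0 - (2 * m1 + 3 * m2) / ℓ) ^ 2) + (1/2 * (2 * m1 - 3 * m2) ^ 2 / ℓ ^ 2) := by
      field_simp; ring
    rw [this]; positivity
  have x2 : (4 * m1 ^ 2 + 9 * m2 ^ 2) / ℓ ^ 2 ≤ 4 * m1 ^ 2 + 9 / ℓ ^ 2 * m2 ^ 2 := by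
    rw [add_div]
    have : 4 * m1 ^ 2 / ℓ ^ 2 ≤ 4 * m1 ^ 2 := div_le_self (by positivity) (by nlinarith)
    have e : 9 * m2 ^ 2 / ℓ ^ 2 = 9 / ℓ ^ 2 * m2 ^ 2 := by ring
    linarith
  have x3 : m0 ^ 2 ≤ ℓ ^ 2 * m0 ^ 2 := le_mul_of_one_le_left (sq_nonneg m0) (by nlinarith)
  calc _ ≤ K * ((m0 + 3 * m1) * (3 * m0)) + (K * ((2 * m1 + 3 * m2) * (3 * m0)) + K ^ 2 * (m0 + 3 * m1) ^ 2) := by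
        linarith
    _ ≤ K ^ 2 * ((m0 + 3 * m1) * (3 * m0)) + (K ^ 2 * ((2 * m1 + 3 * m2) * (3 * m0)) + K ^ 2 * (m0 + 3 * m1) ^ 2) := by
        gcongr
    _ = K ^ 2 * ((m0 + 3 * m1) * (3 * m0) + (2 * m1 + 3 * m2) * (3 * m0) + (m0 + 3 * m1) ^ 2) := by ring
    _ ≤ _ := by
        refine mul_le_mul_of_nonneg_left ?_ (by positivity)
        have x4 : 15 * (m0 * m1) ≤ 15 / 2 * m0 ^ 2 + 15 / 2 * m1 ^ 2 := by nlinarith [sq_nonneg (m0 - m1)]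
        have x5 : 0 ≤ m1 ^ 2 := sq_nonneg _
        have x6 : 0 ≤ ℓ ^ 2 * m0 ^ 2 := by positivity
        have x7 := x1.trans (add_le_add_right x2 _)
        have x8 : (m0 + 3 * m1) * (3 * m0) + (m0 + 3 * m1) ^ 2 = 4 * m0 ^ 2 + 15 * (m0 * m1) + 9 * m1 ^ 2 := by ring
        linarith

end bounds

open Classical in
lemma part2 {q z : ℕ} [NeZero q] {C K ℓ δ L : ℝ} (hK : 1 ≤ K) (hℓ : 1 ≤ ℓ) (hδ0 : 0 < δ) (hδ1 : δ ≤ 1)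
    (hL : 0 < L)
    (hb : ∀ (β : (ZMod q)ˣ) (v : ℝ), |hE q z β v| ≤ (C / ℓ) / Nat.totient q * Real.exp (-(1 / (64 * ℓ) * v)))
    (hF : ∀ χ : DirichletCharacter ℂ q, χ ≠ 1 → ∀ t : ℝ, |t| ≤ 1 → 1 ≤ K * ‖FF q z χ (δ + Complex.I * t)‖) :
    ∑ χ ∈ (Finset.univ : Finset (DirichletCharacter ℂ q)).erase 1,
      ‖∫ t in (-1:ℝ)..1, tri t * RR q z χ (δ + Complex.I * t) * Complex.exp (Complex.I * L * t)‖ ≤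
    10 ^ 12 * K ^ 2 * C ^ 2 * (ℓ / L) := by
  have hl0 : 0 < ℓ := by linarith
  set a : ℝ := 1 / (64 * ℓ) with hadef
  have ha : 0 < a := by positivity
  have hre : ∀ t : ℝ, -a < ((δ:ℂ) + Complex.I * t).re := by intro t; simp; linarith
  have hline : Continuous (fun t : ℝ => (δ:ℂ) + Complex.I * t) := by fun_prop
  have hcont : ∀ (χ : DirichletCharacter ℂ q) (j : ℕ),
      Continuous (fun t : ℝ => ‖Lp (hX q z χ) j (δ + Complex.I * t)‖ ^ 2) := by
    intro χ j
    have : Continuous (fun t : ℝ => Lp (hX q z χ) j (δ + Complex.I * t)) := by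
      rw [continuous_iff_continuousAt]
      intro t
      exact ContinuousAt.comp (f := fun t : ℝ => (δ:ℂ) + Complex.I * t)
        (Lp_hasDerivAt (hX_measurable χ) (hX_bound hb χ) j _ (hre t)).continuousAt hline.continuousAt
    fun_prop
  have h3 : ∀ t ∈ Set.Icc (-1:ℝ) 1, ‖1 + ((δ:ℂ) + Complex.I * t)‖ ≤ 3 := by
    intro t ht
    refine (norm_add_le _ _).trans ?_
    have h1 := norm_add_le (δ:ℂ) (Complex.I * t)
    rw [norm_mul, Complex.norm_I, Complex.norm_real, Complex.norm_real, Real.norm_of_nonneg hδ0.le, Real.norm_eq_abs] at h1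
    have := abs_le.2 ht
    rw [norm_one]; linarith
  have hI : ∀ (χ : DirichletCharacter ℂ q) (j : ℕ) (c : ℝ), IntervalIntegrable
      (fun t : ℝ => c * ‖Lp (hX q z χ) j (δ + Complex.I * t)‖ ^ 2) volume (-1) 1 :=
    fun χ j c => ((hcont χ j).const_mul c |>.intervalIntegrable _ _)
  have hone : ∀ χ ∈ (Finset.univ : Finset (DirichletCharacter ℂ q)).erase 1,
      ‖∫ t in (-1:ℝ)..1, tri t * RR q z χ (δ + Complex.I * t) * Complex.exp (Complex.I * L * t)‖ ≤
      K ^ 2 / L * (20 * ℓ ^ 2 * (∫ t in (-1:ℝ)..1, ‖Lp (hX q z χ) 0 (δ + Complex.I * t)‖ ^ 2) +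
        31 * (∫ t in (-1:ℝ)..1, ‖Lp (hX q z χ) 1 (δ + Complex.I * t)‖ ^ 2) +
        9 / ℓ ^ 2 * (∫ t in (-1:ℝ)..1, ‖Lp (hX q z χ) 2 (δ + Complex.I * t)‖ ^ 2)) := by
    intro χ hχ
    have hχ1 : χ ≠ 1 := (Finset.mem_erase.1 hχ).1
    have hne : ∀ t ∈ Set.Icc (-1:ℝ) 1, FF q z χ (δ + Complex.I * t) ≠ 0 := by
      intro t ht h0
      have := hF χ hχ1 t (abs_le.2 ht)
      rw [h0, norm_zero] at this; linarith
    have hd : ∀ t ∈ Set.Icc (-1:ℝ) 1, HasDerivAt (fun t : ℝ => RR q z χ (δ + Complex.I * t))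
        (RR1 q z χ (δ + Complex.I * t) * Complex.I) t := by
      intro t ht
      have h1 := RR_hasDerivAt hb χ _ (hre t) (hne t ht)
      have h2 : HasDerivAt (fun t : ℝ => (δ:ℂ) + Complex.I * t) Complex.I t :=
        (((Complex.ofRealCLM.hasDerivAt (x := t)).const_mul Complex.I).const_add (δ:ℂ)).congr_deriv (by simp)
      exact HasDerivAt.comp (h := fun t : ℝ => (δ:ℂ) + Complex.I * t) t h1 h2
    have hcR1 : ContinuousOn (fun t : ℝ => RR1 q z χ (δ + Complex.I * t)) (Set.Icc (-1) 1) := by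
      intro t ht
      exact (ContinuousAt.comp (f := fun t : ℝ => (δ:ℂ) + Complex.I * t)
        (RR1_continuousAt hb χ _ (hre t) (hne t ht)) hline.continuousAt).continuousWithinAt
    have hcR : ContinuousOn (fun t : ℝ => RR q z χ (δ + Complex.I * t)) (Set.Icc (-1) 1) :=
      fun t ht => (hd t ht).continuousAt.continuousWithinAt
    refine (tri_ibp_le hd (hcR1.mul continuousOn_const) hL).trans ?_
    have e : (20 * ℓ ^ 2 * (∫ t in (-1:ℝ)..1, ‖Lp (hX q z χ) 0 (δ + Complex.I * t)‖ ^ 2) +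
        31 * (∫ t in (-1:ℝ)..1, ‖Lp (hX q z χ) 1 (δ + Complex.I * t)‖ ^ 2) +
        9 / ℓ ^ 2 * (∫ t in (-1:ℝ)..1, ‖Lp (hX q z χ) 2 (δ + Complex.I * t)‖ ^ 2)) =
        ∫ t in (-1:ℝ)..1, (20 * ℓ ^ 2 * ‖Lp (hX q z χ) 0 (δ + Complex.I * t)‖ ^ 2 +
        31 * ‖Lp (hX q z χ) 1 (δ + Complex.I * t)‖ ^ 2 +
        9 / ℓ ^ 2 * ‖Lp (hX q z χ) 2 (δ + Complex.I * t)‖ ^ 2) := by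
      rw [intervalIntegral.integral_add ((hI χ 0 _).add (hI χ 1 _)) (hI χ 2 _),
        intervalIntegral.integral_add (hI χ 0 _) (hI χ 1 _), intervalIntegral.integral_const_mul,
        intervalIntegral.integral_const_mul, intervalIntegral.integral_const_mul]
    rw [e]
    rw [show K ^ 2 / L = 1 / L * K ^ 2 by ring, mul_assoc]
    apply mul_le_mul_of_nonneg_left _ (by positivity)
    rw [← intervalIntegral.integral_const_mul]
    apply intervalIntegral.integral_mono_on (by norm_num)
    · apply ContinuousOn.intervalIntegrable
      rw [Set.uIcc_of_le (by norm_num)]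
      exact hcR.norm.add (hcR1.mul continuousOn_const).norm
    · exact (((hI χ 0 _).add (hI χ 1 _)).add (hI χ 2 _)).const_mul _
    · intro t ht
      rw [norm_mul, Complex.norm_I, mul_one]
      exact RR_pointwise χ _ (h3 t ht) hK hℓ (hF χ hχ1 t (abs_le.2 ht))
  have hms : ∀ j : ℕ, ∑ χ ∈ (Finset.univ : Finset (DirichletCharacter ℂ q)).erase 1,
      ∫ t in (-1:ℝ)..1, ‖Lp (hX q z χ) j (δ + Complex.I * t)‖ ^ 2 ≤
      18 * ((C / ℓ) ^ 2 * ((Nat.factorial (2*j)) / (2*a)^(2*j+1))) := by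
    intro j
    refine le_trans ?_ (hX_mean_square hb ha j hδ0.le)
    apply Finset.sum_le_sum_of_subset_of_nonneg (Finset.erase_subset _ _)
    intro χ _ _
    exact intervalIntegral.integral_nonneg (by norm_num) (fun t _ => by positivity)
  refine (Finset.sum_le_sum hone).trans ?_
  rw [← Finset.mul_sum, Finset.sum_add_distrib, Finset.sum_add_distrib, ← Finset.mul_sum, ← Finset.mul_sum, ← Finset.mul_sum]
  have e2a : 2 * a = 1 / (32 * ℓ) := by rw [hadef]; field_simp; norm_num
  have m0 := (hms 0).trans_eq (show _ = 18 * ((C / ℓ) ^ 2 * (32 * ℓ)) by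
    rw [e2a]; norm_num [Nat.factorial])
  have m1 := (hms 1).trans_eq (show _ = 18 * ((C / ℓ) ^ 2 * (2 * (32768 * ℓ ^ 3))) by
    rw [e2a]; norm_num [Nat.factorial]; field_simp; norm_num)
  have m2 := (hms 2).trans_eq (show _ = 18 * ((C / ℓ) ^ 2 * (24 * (33554432 * ℓ ^ 5))) by
    rw [e2a]; norm_num [Nat.factorial]; field_simp; norm_num)
  calc _ ≤ K ^ 2 / L * (20 * ℓ ^ 2 * (18 * ((C / ℓ) ^ 2 * (32 * ℓ))) + 31 * (18 * ((C / ℓ) ^ 2 * (2 * (32768 * ℓ ^ 3))))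
        + 9 / ℓ ^ 2 * (18 * ((C / ℓ) ^ 2 * (24 * (33554432 * ℓ ^ 5))))) := by
        gcongr
    _ = K ^ 2 / L * (C ^ 2 * ℓ) * (20 * 18 * 32 + 31 * 18 * 2 * 32768 + 9 * 18 * 24 * 33554432) := by
        field_simp
    _ ≤ K ^ 2 / L * (C ^ 2 * ℓ) * 10 ^ 12 := by
        gcongr; norm_num
    _ = _ := by ring

end Gall

end

section

open Finset MeasureTheory
namespace Gall

lemma weight_pt {a L v : ℝ} (ha : 0 < a) (hL : 2 ≤ L) (hv : 0 < v) :
    (1 + v) * Real.exp (-(a * v)) * (1 + (L - v) ^ 2)⁻¹ ≤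
      8 / (a ^ 2 * L) * (1 + (L - v) ^ 2)⁻¹ + 4 / L ^ 2 * (v ^ 0 * Real.exp (-(a * v)) + v ^ 1 * Real.exp (-(a * v))) := by
  have hL0 : 0 < L := by linarith
  have hi : 0 < (1 + (L - v) ^ 2)⁻¹ := by positivity
  have he := Real.exp_pos (-(a * v))
  rcases le_total (L / 2) v with h | h
  · have h1 : (1 + v) * Real.exp (-(a * v)) ≤ 8 / (a ^ 2 * L) := by
      have h2 : (a * v) ^ 2 / 2 ≤ Real.exp (a * v) := by
        have := Real.quadratic_le_exp_of_nonneg (x := a * v) (by positivity)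
        nlinarith [mul_pos ha hv]
      rw [Real.exp_neg, ← div_eq_mul_inv, div_le_div_iff₀ (Real.exp_pos _) (by positivity)]
      calc (1 + v) * (a ^ 2 * L) ≤ (2 * v) * (a ^ 2 * (2 * v)) := by
            gcongr
            · linarith
            · linarith
        _ = 8 * ((a * v) ^ 2 / 2) := by ring
        _ ≤ _ := by gcongr
    have h3 : 0 ≤ 4 / L ^ 2 * (v ^ 0 * Real.exp (-(a * v)) + v ^ 1 * Real.exp (-(a * v))) := by positivity
    have := mul_le_mul_of_nonneg_right h1 hi.le
    linarith
  · have h1 : (1 + (L - v) ^ 2)⁻¹ ≤ 4 / L ^ 2 := by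
      rw [inv_le_comm₀ (by positivity) (by positivity), inv_div]
      nlinarith
    have h3 : 0 ≤ 8 / (a ^ 2 * L) * (1 + (L - v) ^ 2)⁻¹ := by positivity
    have := mul_le_mul_of_nonneg_left h1 (show 0 ≤ (1 + v) * Real.exp (-(a * v)) by positivity)
    have e : 4 / L ^ 2 * (v ^ 0 * Real.exp (-(a * v)) + v ^ 1 * Real.exp (-(a * v))) =
      (1 + v) * Real.exp (-(a * v)) * (4 / L ^ 2) := by ring
    linarith

lemma Lp_ker_le {h : ℝ → ℂ} {B a : ℝ} (hB : 0 ≤ B) (hm : Measurable h) (hb : ∀ v, ‖h v‖ ≤ B * Real.exp (-(a * v))) (j : ℕ)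
    (hj : j ≤ 1) (ha : 0 < a) (ha1 : a ≤ 1) {δ : ℝ} (hδ : 0 < δ) (ψ : ℝ → ℂ) (hψ : Continuous ψ)
    (hk : ∀ y, ‖ker ψ y‖ ≤ 60 / (1 + y ^ 2)) {L : ℝ} (hL : 2 ≤ L) :
    ‖∫ t in (-1:ℝ)..1, ψ t * Complex.exp (Complex.I * t * L) * Lp h j (δ + Complex.I * t)‖ ≤
      B * 2100 / (a ^ 2 * L) := by
  have hL0 : 0 < L := by linarith
  rw [Lp_kernel hm hb j (by linarith) ψ hψ L]
  have i1 : Integrable (fun v : ℝ => (1 + (L - v) ^ 2)⁻¹) := integrable_inv_one_add_sq.comp_sub_left L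
  have i2 : IntegrableOn (fun v : ℝ => v ^ 0 * Real.exp (-(a * v)) + v ^ 1 * Real.exp (-(a * v))) (Set.Ioi 0) :=
    (integrableOn_pow_exp 0 ha).add (integrableOn_pow_exp 1 ha)
  have v2 : ∫ v in Set.Ioi (0:ℝ), (v ^ 0 * Real.exp (-(a * v)) + v ^ 1 * Real.exp (-(a * v))) = 1 / a + 1 / a ^ 2 := by
    rw [integral_add (integrableOn_pow_exp 0 ha) (integrableOn_pow_exp 1 ha), integral_pow_exp 0 ha, integral_pow_exp 1 ha]
    simp
  have v1 : ∫ v in Set.Ioi (0:ℝ), (1 + (L - v) ^ 2)⁻¹ ≤ Real.pi := by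
    refine (setIntegral_le_integral i1 (Filter.Eventually.of_forall fun v => by positivity)).trans ?_
    rw [integral_sub_left_eq_self (fun v : ℝ => (1 + v ^ 2)⁻¹) volume L, integral_univ_inv_one_add_sq]
  refine (norm_integral_le_of_norm_le (g := fun v : ℝ => B * 60 * (8 / (a ^ 2 * L) * (1 + (L - v) ^ 2)⁻¹ +
    4 / L ^ 2 * (v ^ 0 * Real.exp (-(a * v)) + v ^ 1 * Real.exp (-(a * v))))) ?_ ?_).trans ?_
  · exact ((i1.integrableOn.const_mul _).add (i2.const_mul _)).const_mul _
  · filter_upwards [ae_restrict_mem measurableSet_Ioi] with v hv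
    have hv0 : 0 < v := hv
    refine le_trans ?_ (mul_le_mul_of_nonneg_left (weight_pt ha hL hv0) (by positivity))
    have n1 : ‖(-(v:ℂ)) ^ j‖ ≤ 1 + v := by
      rw [norm_pow, norm_neg, Complex.norm_real, Real.norm_of_nonneg hv0.le]
      interval_cases j
      · simp; exact hv0.le
      · simp
    have n2 : ‖Complex.exp (-δ * v)‖ ≤ 1 := by
      rw [Complex.norm_exp]
      have : (-(δ:ℂ) * v).re = -(δ * v) := by simp
      rw [this, Real.exp_le_one_iff]
      have := mul_pos hδ hv0
      linarith
    rw [norm_mul, norm_mul, norm_mul]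
    calc _ ≤ (1 + v) * (B * Real.exp (-(a * v))) * 1 * (60 / (1 + (L - v) ^ 2)) := by
          gcongr
          · exact hb v
          · exact hk _
      _ = _ := by rw [div_eq_mul_inv]; ring
  · rw [integral_const_mul, integral_add (i1.integrableOn.const_mul _) (i2.const_mul _), integral_const_mul, integral_const_mul]
    rw [v2]
    calc _ ≤ B * 60 * (8 / (a ^ 2 * L) * Real.pi + 4 / (2 * L) * (1 / a ^ 2 + 1 / a ^ 2)) := by
          have x1 : 1 / a ≤ 1 / a ^ 2 := by
            apply one_div_le_one_div_of_le (by positivity); nlinarith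
          have x2 : 2 * L ≤ L ^ 2 := by nlinarith
          gcongr
      _ = B * (480 * Real.pi + 240) / (a ^ 2 * L) := by field_simp; ring
      _ ≤ B * 2100 / (a ^ 2 * L) := by
          have := Real.pi_lt_d2
          gcongr; linarith

lemma part1 {q z : ℕ} [NeZero q] {C ℓ δ L : ℝ} (hC : 0 < C) (hℓ : 1 ≤ ℓ) (hδ0 : 0 < δ) (hδ1 : δ ≤ 1)
    (hL : 2 ≤ L)
    (hb : ∀ (β : (ZMod q)ˣ) (v : ℝ), |hE q z β v| ≤ (C / ℓ) / Nat.totient q * Real.exp (-(1 / (64 * ℓ) * v)))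
    (α : (ZMod q)ˣ) :
    ‖∫ t in (-1:ℝ)..1, tri t * Complex.exp (Complex.I * t * L) *
      (Lp (hEc q z α) 0 (δ + Complex.I * t) + (1 + (δ + Complex.I * t)) * Lp (hEc q z α) 1 (δ + Complex.I * t))‖ ≤
    10 ^ 8 * C * (ℓ / L) / Nat.totient q := by
  have hl0 : 0 < ℓ := by linarith
  have hφ := totient_pos' q
  set a : ℝ := 1 / (64 * ℓ) with hadef
  have ha : 0 < a := by positivity
  have ha1 : a ≤ 1 := by rw [hadef, div_le_one (by positivity)]; linarith
  have hL0 : 0 < L := by linarith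
  have hB : 0 ≤ (C / ℓ) / (Nat.totient q : ℝ) := by positivity
  have hre : ∀ t : ℝ, -a < ((δ:ℂ) + Complex.I * t).re := by intro t; simp; linarith
  have hline : Continuous (fun t : ℝ => (δ:ℂ) + Complex.I * t) := by fun_prop
  have hcont : ∀ (j : ℕ), Continuous (fun t : ℝ => Lp (hEc q z α) j (δ + Complex.I * t)) := by
    intro j
    rw [continuous_iff_continuousAt]
    intro t
    exact ContinuousAt.comp (f := fun t : ℝ => (δ:ℂ) + Complex.I * t)
        (Lp_hasDerivAt (hEc_measurable α) (hEc_bound hb α) j _ (hre t)).continuousAt hline.continuousAt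
  have hc0 := hcont 0
  have hc1 := hcont 1
  have ht := tri_continuous
  have e : (∫ t in (-1:ℝ)..1, tri t * Complex.exp (Complex.I * t * L) *
      (Lp (hEc q z α) 0 (δ + Complex.I * t) + (1 + (δ + Complex.I * t)) * Lp (hEc q z α) 1 (δ + Complex.I * t))) =
      (∫ t in (-1:ℝ)..1, tri t * Complex.exp (Complex.I * t * L) * Lp (hEc q z α) 0 (δ + Complex.I * t)) +
      ∫ t in (-1:ℝ)..1, (tri t * ((1 + δ) + Complex.I * t)) * Complex.exp (Complex.I * t * L) * Lp (hEc q z α) 1 (δ + Complex.I * t) := by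
    rw [← intervalIntegral.integral_add]
    · congr 1; ext t; ring
    · apply Continuous.intervalIntegrable; fun_prop
    · apply Continuous.intervalIntegrable; fun_prop
  rw [e]
  have k0 : ∀ y, ‖ker tri y‖ ≤ 60 / (1 + y ^ 2) := by
    intro y
    have := ker_lin_le 1 0 y
    simp only [zero_mul, add_zero, mul_one, norm_one, norm_zero] at this
    exact this.trans (by gcongr; norm_num)
  have k1 : ∀ y, ‖ker (fun t => tri t * ((1 + δ) + Complex.I * t)) y‖ ≤ 60 / (1 + y ^ 2) := by
    intro y
    have := ker_lin_le (1 + δ) Complex.I y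
    refine this.trans ?_
    gcongr
    have h1 := norm_add_le (1:ℂ) δ
    rw [norm_one, Complex.norm_real, Real.norm_of_nonneg hδ0.le] at h1
    rw [Complex.norm_I]; linarith
  have b0 := Lp_ker_le hB (hEc_measurable α) (hEc_bound hb α) 0 (by norm_num) ha ha1 hδ0 tri tri_continuous k0 hL
  have b1 := Lp_ker_le hB (hEc_measurable α) (hEc_bound hb α) 1 (by norm_num) ha ha1 hδ0
    (fun t => tri t * ((1 + δ) + Complex.I * t)) (by fun_prop) k1 hL
  refine (norm_add_le _ _).trans ((add_le_add b0 b1).trans ?_)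
  calc _ = (2 * 2100 * 4096) * (C * (ℓ / L) / Nat.totient q) := by rw [hadef]; field_simp; ring
    _ ≤ 10 ^ 8 * (C * (ℓ / L) / Nat.totient q) := by gcongr; norm_num
    _ = _ := by ring

end Gall

end

section

open Finset MeasureTheory
namespace Gall

lemma gX_Lambda_summable (q z : ℕ) [NeZero q] (χ : DirichletCharacter ℂ q) {s : ℂ} (hs : 1 < s.re) :
    LSeriesSummable (fun n => gX q z χ n * (ArithmeticFunction.vonMangoldt n : ℂ)) s := by
  have h := (ArithmeticFunction.LSeriesSummable_vonMangoldt hs).norm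
  refine Summable.of_norm_bounded h ?_
  intro n
  rcases eq_or_ne n 0 with rfl | hn
  · simp
  · rw [LSeries.term_of_ne_zero hn, LSeries.term_of_ne_zero hn, norm_div, norm_div, norm_mul]
    have := gX_norm_le q z χ n
    gcongr
    exact mul_le_of_le_one_left (norm_nonneg _) this

open Classical in
lemma cE_expand (q z : ℕ) [NeZero q] (hqz : q < z) (α : (ZMod q)ˣ) (n : ℕ) :
    ((cE q z α n : ℝ) : ℂ) = ∑ χ ∈ (univ : Finset (DirichletCharacter ℂ q)).erase 1,
      (χ ((α : ZMod q)⁻¹) / Nat.totient q) * gX q z χ n := by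
  have hφ : (Nat.totient q : ℂ) ≠ 0 := by exact_mod_cast (totient_pos' q).ne'
  have h := char_inversion α (fun β => ((cE q z β n : ℝ) : ℂ))
  simp only [sum_char_cE q z hqz] at h
  rw [eq_comm, ← mul_right_inj' hφ, ← h, Finset.mul_sum, ← Finset.add_sum_erase univ _ (Finset.mem_univ (1 : DirichletCharacter ℂ q))]
  simp only [if_true, mul_zero, zero_add]
  apply Finset.sum_congr rfl
  intro χ hχ
  rw [if_neg (Finset.mem_erase.1 hχ).1]
  field_simp

/-- coefficients of the progression minus its average -/
noncomputable def cL (q z : ℕ) (β : ZMod q) (n : ℕ) : ℂ := (cE q z β n : ℂ) * (ArithmeticFunction.vonMangoldt n : ℂ)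

open Classical in
lemma cL_eq (q z : ℕ) [NeZero q] (hqz : q < z) (α : (ZMod q)ˣ) :
    cL q z α = ∑ χ ∈ (univ : Finset (DirichletCharacter ℂ q)).erase 1,
      (χ ((α : ZMod q)⁻¹) / Nat.totient q) • (fun n => gX q z χ n * (ArithmeticFunction.vonMangoldt n : ℂ)) := by
  ext n
  unfold cL
  rw [cE_expand q z hqz α n, Finset.sum_mul, Finset.sum_apply]
  apply Finset.sum_congr rfl
  intro χ _
  simp only [Pi.smul_apply, smul_eq_mul]
  ring

lemma cL_summable (q z : ℕ) [NeZero q] (hqz : q < z) (α : (ZMod q)ˣ) {s : ℂ} (hs : 1 < s.re) :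
    LSeriesSummable (cL q z α) s := by
  classical
  rw [cL_eq q z hqz α]
  exact LSeriesSummable.sum (fun χ _ => (gX_Lambda_summable q z χ hs).smul _)

section
variable {q z : ℕ} [NeZero q] {B a : ℝ}

open Classical in
lemma FF1_inversion (hqz : q < z) (hb : ∀ (β : (ZMod q)ˣ) (v : ℝ), |hE q z β v| ≤ B / Nat.totient q * Real.exp (-(a * v)))
    (α : (ZMod q)ˣ) (w : ℂ) (hw : -a < w.re) :
    ∑ χ ∈ (univ : Finset (DirichletCharacter ℂ q)).erase 1, (χ ((α : ZMod q)⁻¹) / Nat.totient q) * FF1 q z χ w =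
      Lp (hEc q z α) 0 w + (1 + w) * Lp (hEc q z α) 1 w := by
  have hφ : (Nat.totient q : ℂ) ≠ 0 := by exact_mod_cast (totient_pos' q).ne'
  have h := char_inversion α (fun β => Lp (hEc q z β) 0 w + (1 + w) * Lp (hEc q z β) 1 w)
  have e : ∀ χ : DirichletCharacter ℂ q, ∑ β : (ZMod q)ˣ, χ β * (Lp (hEc q z β) 0 w + (1 + w) * Lp (hEc q z β) 1 w) =
      FF1 q z χ w := by
    intro χ
    unfold FF1
    rw [Lp_hX hb χ 0 w hw, Lp_hX hb χ 1 w hw, Finset.mul_sum, ← Finset.sum_add_distrib]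
    apply Finset.sum_congr rfl
    intro β _; ring
  simp only [e] at h
  have h1 : FF1 q z (1 : DirichletCharacter ℂ q) w = 0 := by
    unfold FF1 Lp
    rw [hX_one q z hqz]
    simp
  rw [← mul_right_inj' hφ, ← h, Finset.mul_sum, ← Finset.add_sum_erase univ _ (Finset.mem_univ (1 : DirichletCharacter ℂ q)), h1]
  simp only [mul_zero, zero_add]
  apply Finset.sum_congr rfl
  intro χ hχ
  field_simp

open Classical in
lemma cL_LSeries (hqz : q < z) (hb : ∀ (β : (ZMod q)ˣ) (v : ℝ), |hE q z β v| ≤ B / Nat.totient q * Real.exp (-(a * v)))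
    (ha : 0 < a) (α : (ZMod q)ˣ) (w : ℂ) (hw : 0 < w.re) :
    LSeries (cL q z α) (1 + w) = -(Lp (hEc q z α) 0 w + (1 + w) * Lp (hEc q z α) 1 w) +
      ∑ χ ∈ (univ : Finset (DirichletCharacter ℂ q)).erase 1, (χ ((α : ZMod q)⁻¹) / Nat.totient q) * RR q z χ w := by
  have hs : 1 < (1 + w).re := by simpa using hw
  rw [cL_eq q z hqz α, LSeries_sum (fun χ _ => (gX_Lambda_summable q z χ hs).smul _),
    ← FF1_inversion hqz hb α w (by linarith), ← Finset.sum_neg_distrib, ← Finset.sum_add_distrib]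
  apply Finset.sum_congr rfl
  intro χ hχ
  obtain ⟨h0, h1⟩ := LSeries_Lambda hqz hb χ (Finset.mem_erase.1 hχ).1 w hw ha
  rw [LSeries_smul, h1]
  unfold RR
  field_simp
  ring

end

open Classical in
lemma cL_main {q z : ℕ} [NeZero q] {C K ℓ δ L : ℝ} (hqz : q < z) (hC : 0 < C) (hK : 1 ≤ K) (hℓ : 1 ≤ ℓ) (hδ0 : 0 < δ) (hδ1 : δ ≤ 1)
    (hL : 2 ≤ L)
    (hb : ∀ (β : (ZMod q)ˣ) (v : ℝ), |hE q z β v| ≤ (C / ℓ) / Nat.totient q * Real.exp (-(1 / (64 * ℓ) * v)))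
    (hF : ∀ χ : DirichletCharacter ℂ q, χ ≠ 1 → ∀ t : ℝ, |t| ≤ 1 → 1 ≤ K * ‖FF q z χ (δ + Complex.I * t)‖)
    (α : (ZMod q)ˣ) :
    ∃ S : ℂ, HasSum (fun n => LSeries.term (cL q z α) (1 + δ) n * ker tri (L - Real.log n)) S ∧
      ‖S‖ ≤ (10 ^ 12 * K ^ 2 * C ^ 2 + 10 ^ 8 * C) * (ℓ / L) / Nat.totient q := by
  have hl0 : 0 < ℓ := by linarith
  have hφ := totient_pos' q
  have ha : 0 < 1 / (64 * ℓ) := by positivity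
  have hs : 1 < ((1:ℂ) + δ).re := by simpa using hδ0
  refine ⟨_, LSeries_kernel (cL_summable q z hqz α hs) tri tri_continuous L, ?_⟩
  have hre : ∀ t : ℝ, 0 < ((δ:ℂ) + Complex.I * t).re := by intro t; simpa using hδ0
  have hre' : ∀ t : ℝ, -(1 / (64 * ℓ)) < ((δ:ℂ) + Complex.I * t).re := fun t => by have := hre t; linarith
  have hline : Continuous (fun t : ℝ => (δ:ℂ) + Complex.I * t) := by fun_prop
  have hcont : ∀ (j : ℕ), Continuous (fun t : ℝ => Lp (hEc q z α) j (δ + Complex.I * t)) := by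
    intro j
    rw [continuous_iff_continuousAt]
    intro t
    exact ContinuousAt.comp (f := fun t : ℝ => (δ:ℂ) + Complex.I * t)
        (Lp_hasDerivAt (hEc_measurable α) (hEc_bound hb α) j _ (hre' t)).continuousAt hline.continuousAt
  have hc0 := hcont 0
  have hc1 := hcont 1
  have ht := tri_continuous
  have hR : ∀ χ ∈ (univ : Finset (DirichletCharacter ℂ q)).erase 1, Continuous (fun t : ℝ => RR q z χ (δ + Complex.I * t)) := by
    intro χ hχ
    rw [continuous_iff_continuousAt]
    intro t
    exact ContinuousAt.comp (f := fun t : ℝ => (δ:ℂ) + Complex.I * t)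
      (RR_hasDerivAt hb χ _ (hre' t) (LSeries_Lambda hqz hb χ (Finset.mem_erase.1 hχ).1 _ (hre t) ha).1).continuousAt
      hline.continuousAt
  have e : (∫ t in (-1:ℝ)..1, tri t * Complex.exp (Complex.I * t * L) * LSeries (cL q z α) (1 + δ + Complex.I * t)) =
      -(∫ t in (-1:ℝ)..1, tri t * Complex.exp (Complex.I * t * L) *
      (Lp (hEc q z α) 0 (δ + Complex.I * t) + (1 + (δ + Complex.I * t)) * Lp (hEc q z α) 1 (δ + Complex.I * t))) +
      ∑ χ ∈ (univ : Finset (DirichletCharacter ℂ q)).erase 1, (χ ((α : ZMod q)⁻¹) / Nat.totient q) *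
        ∫ t in (-1:ℝ)..1, tri t * RR q z χ (δ + Complex.I * t) * Complex.exp (Complex.I * L * t) := by
    have e1 : ∀ t : ℝ, tri t * Complex.exp (Complex.I * t * L) * LSeries (cL q z α) (1 + δ + Complex.I * t) =
      -(tri t * Complex.exp (Complex.I * t * L) *
      (Lp (hEc q z α) 0 (δ + Complex.I * t) + (1 + (δ + Complex.I * t)) * Lp (hEc q z α) 1 (δ + Complex.I * t))) +
      ∑ χ ∈ (univ : Finset (DirichletCharacter ℂ q)).erase 1, (χ ((α : ZMod q)⁻¹) / Nat.totient q) *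
        (tri t * RR q z χ (δ + Complex.I * t) * Complex.exp (Complex.I * L * t)) := by
      intro t
      rw [add_assoc, cL_LSeries hqz hb ha α _ (hre t), mul_add, mul_neg, Finset.mul_sum]
      congr 1
      apply Finset.sum_congr rfl
      intro χ _
      rw [show Complex.I * L * t = Complex.I * t * L by ring]
      ring
    simp_rw [e1]
    have hi : ∀ χ ∈ (univ : Finset (DirichletCharacter ℂ q)).erase 1, IntervalIntegrable (fun t : ℝ => (χ ((α : ZMod q)⁻¹) / Nat.totient q) *
        (tri t * RR q z χ (δ + Complex.I * t) * Complex.exp (Complex.I * L * t))) volume (-1) 1 := by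
      intro χ hχ
      have := hR χ hχ
      apply Continuous.intervalIntegrable; fun_prop
    rw [intervalIntegral.integral_add, intervalIntegral.integral_neg, intervalIntegral.integral_finsetSum hi]
    · simp_rw [intervalIntegral.integral_const_mul]
    · apply Continuous.intervalIntegrable; fun_prop
    · have h9 := IntervalIntegrable.sum _ hi
      simpa only [Finset.sum_fn] using h9
  rw [e]
  have p1 := part1 hC hℓ hδ0 hδ1 hL hb α
  have p2 := part2 hK hℓ hδ0 hδ1 (show 0 < L by linarith) hb hF
  refine (norm_add_le _ _).trans ?_
  rw [norm_neg]
  have p3 : ‖∑ χ ∈ (univ : Finset (DirichletCharacter ℂ q)).erase 1, (χ ((α : ZMod q)⁻¹) / Nat.totient q) *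
        ∫ t in (-1:ℝ)..1, tri t * RR q z χ (δ + Complex.I * t) * Complex.exp (Complex.I * L * t)‖ ≤
      10 ^ 12 * K ^ 2 * C ^ 2 * (ℓ / L) / Nat.totient q := by
    refine (norm_sum_le _ _).trans ?_
    refine le_trans ?_ (div_le_div_of_nonneg_right p2 hφ.le)
    rw [Finset.sum_div]
    apply Finset.sum_le_sum
    intro χ _
    rw [norm_mul, norm_div, Complex.norm_natCast, div_mul_eq_mul_div]
    gcongr
    exact mul_le_of_le_one_left (norm_nonneg _) (χ.norm_le_one _)
  calc _ ≤ _ := add_le_add p1 p3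
    _ = _ := by ring

/-- Real form of the main analytic estimate. -/
noncomputable def wt (δ L : ℝ) (n : ℕ) : ℝ :=
  ArithmeticFunction.vonMangoldt n * (n:ℝ) ^ (-(1 + δ)) * kk (L - Real.log n)

lemma cL_main_real {q z : ℕ} [NeZero q] {C K ℓ δ L : ℝ} (hqz : q < z) (hC : 0 < C) (hK : 1 ≤ K) (hℓ : 1 ≤ ℓ) (hδ0 : 0 < δ) (hδ1 : δ ≤ 1)
    (hL : 2 ≤ L)
    (hb : ∀ (β : (ZMod q)ˣ) (v : ℝ), |hE q z β v| ≤ (C / ℓ) / Nat.totient q * Real.exp (-(1 / (64 * ℓ) * v)))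
    (hF : ∀ χ : DirichletCharacter ℂ q, χ ≠ 1 → ∀ t : ℝ, |t| ≤ 1 → 1 ≤ K * ‖FF q z χ (δ + Complex.I * t)‖)
    (α : (ZMod q)ˣ) :
    ∃ S : ℝ, HasSum (fun n => cE q z α n * wt δ L n) S ∧
      |S| ≤ (10 ^ 12 * K ^ 2 * C ^ 2 + 10 ^ 8 * C) * (ℓ / L) / Nat.totient q := by
  obtain ⟨S, h1, h2⟩ := cL_main hqz hC hK hℓ hδ0 hδ1 hL hb hF α
  have e : ∀ n, LSeries.term (cL q z α) (1 + δ) n * ker tri (L - Real.log n) = ((cE q z α n * wt δ L n : ℝ) : ℂ) := by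
    intro n
    rw [ker_tri]
    unfold wt cL
    rcases eq_or_ne n 0 with rfl | hn
    · simp
    · rw [LSeries.term_of_ne_zero hn]
      push_cast
      rw [Complex.ofReal_cpow (Nat.cast_nonneg n)]
      push_cast
      rw [Complex.cpow_neg]
      ring
  simp_rw [e] at h1
  refine ⟨S.re, ?_, (Complex.abs_re_le_norm S).trans h2⟩
  have := Complex.hasSum_re h1
  simpa using this

end Gall

end

section

open Finset MeasureTheory
namespace Gall

lemma far_sum (ε : ℝ) (hε : 0 < ε) : ∃ V : ℝ, 3 ≤ V ∧ ∀ L : ℝ, ∀ J : Finset ℕ,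
    (∀ j ∈ J, V - 1 ≤ |L - j|) → ∑ j ∈ J, 1 / (1 + (L - j) ^ 2) ≤ ε := by
  have hs : Summable (fun k : ℤ => 1 / (k:ℝ) ^ 2) := Real.summable_one_div_int_pow.2 (by norm_num)
  obtain ⟨s, hs⟩ := summable_iff_vanishing_norm.1 hs (ε / 3) (by positivity)
  obtain ⟨M, hM⟩ : ∃ M : ℕ, ∀ k ∈ s, k.natAbs ≤ M :=
    ⟨s.sup Int.natAbs, fun k hk => Finset.le_sup (f := Int.natAbs) hk⟩
  refine ⟨M + 3, by linarith [(Nat.cast_nonneg M : (0:ℝ) ≤ M)], ?_⟩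
  intro L J hJ
  have hfl := Int.floor_le L
  have hfl' := Int.lt_floor_add_one L
  set m := ⌊L⌋ with hm
  have hfar : ∀ j ∈ J, (M:ℝ) + 1 ≤ |(j:ℝ) - m| := by
    intro j hj
    have h1 := hJ j hj
    have h2 : |L - j| ≤ |(j:ℝ) - m| + |L - m| := by
      have : L - j = -(j - m) + (L - m) := by ring
      rw [this]; refine (abs_add_le _ _).trans ?_
      rw [abs_neg]
    have h3 : |L - m| ≤ 1 := by rw [abs_le]; constructor <;> linarith
    linarith
  have hinj : Set.InjOn (fun j : ℕ => (j:ℤ) - m) J := by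
    intro a _ b _ h
    simp at h; exact h
  have h1 := hs (J.image (fun j : ℕ => (j:ℤ) - m)) (by
    rw [Finset.disjoint_left]
    intro k hk hks
    obtain ⟨j, hj, rfl⟩ := Finset.mem_image.1 hk
    have h1 := hfar j hj
    have h2 := hM _ hks
    have h3 : |(j:ℝ) - m| = ((((j:ℤ) - m).natAbs : ℕ) : ℝ) := by
      rw [Nat.cast_natAbs]; push_cast; rfl
    rw [h3] at h1
    have h4 : ((((j:ℤ) - m).natAbs : ℕ) : ℝ) ≤ M := by exact_mod_cast h2
    linarith)
  rw [Finset.sum_image hinj] at h1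
  have h2 := (le_abs_self _).trans h1.le
  calc ∑ j ∈ J, 1 / (1 + (L - j) ^ 2) ≤ ∑ j ∈ J, 3 * (1 / ((((j:ℤ) - m : ℤ)):ℝ) ^ 2) := by
        apply Finset.sum_le_sum
        intro j hj
        have h3 := hfar j hj
        have h0 : (0:ℝ) ≤ M := Nat.cast_nonneg M
        have h4 : 1 ≤ ((j:ℝ) - m) ^ 2 := by
          rw [← sq_abs]; nlinarith
        push_cast
        rw [mul_one_div, div_le_div_iff₀ (by positivity) (by positivity)]
        nlinarith [sq_nonneg (2 * (L - j) + ((j:ℝ) - m)), sq_nonneg (L - j - (L - m))]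
    _ = 3 * ∑ j ∈ J, 1 / ((((j:ℤ) - m : ℤ)):ℝ) ^ 2 := by rw [Finset.mul_sum]
    _ ≤ ε := by linarith

lemma block_sum {f b : ℕ → ℝ} {P : ℕ → Prop} (hb : ∀ j : ℕ, ∀ s : Finset ℕ, (∀ n ∈ s, P n ∧ Real.exp j ≤ n ∧ (n:ℝ) < Real.exp (j+1)) →
      ∑ n ∈ s, f n ≤ b j)
    (s : Finset ℕ) (h : ∀ n ∈ s, P n ∧ n ≠ 0) :
    ∑ n ∈ s, f n ≤ ∑ j ∈ s.image (fun n : ℕ => ⌊Real.log n⌋₊), b j := by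
  rw [← Finset.sum_fiberwise_of_maps_to (g := fun n : ℕ => ⌊Real.log n⌋₊) (t := s.image (fun n : ℕ => ⌊Real.log n⌋₊))
    (fun n hn => Finset.mem_image_of_mem _ hn)]
  apply Finset.sum_le_sum
  intro j _
  apply hb
  intro n hn
  rw [Finset.mem_filter] at hn
  obtain ⟨hP, h0⟩ := h n hn.1
  have hn1 : (1:ℝ) ≤ n := by exact_mod_cast Nat.one_le_iff_ne_zero.2 h0
  have hl : 0 ≤ Real.log n := Real.log_nonneg hn1
  refine ⟨hP, ?_, ?_⟩
  · rw [← Real.le_log_iff_exp_le (by linarith), ← hn.2]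
    exact Nat.floor_le hl
  · rw [← Real.log_lt_iff_lt_exp (by linarith), ← hn.2]
    exact Nat.lt_floor_add_one _

lemma block_primes : ∃ C : ℝ, 0 < C ∧ ∀ (q : ℕ) [NeZero q] (α : (ZMod q)ˣ) (j : ℕ), 2 ≤ j → (q:ℝ) ^ 2 ≤ Real.exp (j + 1) →
    ∀ s : Finset ℕ, (∀ n ∈ s, n.Prime ∧ (n : ZMod q) = α ∧ Real.exp j ≤ n ∧ (n:ℝ) < Real.exp (j+1)) →
    ∑ n ∈ s, Real.log n / n ≤ C / Nat.totient q := by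
  obtain ⟨C, hC, hBT⟩ := SS_BT
  refine ⟨12 * C, by positivity, ?_⟩
  intro q _ α j hj hq s hs
  have hφ := totient_pos' q
  have hj' : (2:ℝ) ≤ j := by exact_mod_cast hj
  set u := Real.exp (j + 1) with hu
  set r := Real.exp (((j:ℝ) + 1) / 2) with hr
  have hr2 : r * r = u := by rw [hr, hu, ← Real.exp_add]; congr 1; ring
  have hr3 : 2 ≤ r := by
    have := Real.add_one_le_exp (((j:ℝ) + 1) / 2)
    linarith
  set W := ⌊r⌋₊ with hW
  have hWr : (W:ℝ) ≤ r := Nat.floor_le (by linarith)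
  have hW2 : 2 ≤ W := Nat.le_floor (by exact_mod_cast hr3)
  have hW1 : r < W + 1 := Nat.lt_floor_add_one r
  have hWu : (W:ℝ) ≤ u := by nlinarith
  have hW0 : (0:ℝ) < W := by positivity
  have hlW : ((j:ℝ) + 1) / 4 ≤ Real.log W := by
    rw [Real.le_log_iff_exp_le hW0]
    have h1 : Real.exp (((j:ℝ) + 1) / 4) * Real.exp (((j:ℝ) + 1) / 4) = r := by
      rw [← Real.exp_add, hr]; congr 1; ring
    have h2 := Real.add_one_le_exp (((j:ℝ) + 1) / 4)
    nlinarith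
  have hcard : (s.card : ℝ) ≤ C * (u / (Nat.totient q * Real.log W)) := by
    refine le_trans ?_ (hBT q (α : ZMod q) W u (by exact_mod_cast hW2) hq hWu)
    refine le_trans ?_ (NN_SS q W α u).1
    unfold NN
    rw [Nat.cast_le]
    apply Finset.card_le_card
    intro n hn
    obtain ⟨hp, hα, h1, h2⟩ := hs n hn
    classical
    rw [Finset.mem_filter, Finset.mem_Icc]
    refine ⟨⟨hp.one_lt.le, Nat.le_floor h2.le⟩, ⟨hp.one_lt, ?_⟩, hα⟩
    intro p pp hpW hdvd
    have hpn : p = n := (Nat.prime_dvd_prime_iff_eq pp hp).1 hdvd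
    subst hpn
    have h3 : r ≤ Real.exp j := by
      rw [hr]; apply Real.exp_le_exp.2; linarith
    have h4 : (p:ℝ) < W := by exact_mod_cast hpW
    linarith
  have hterm : ∀ n ∈ s, Real.log n / n ≤ (j + 1) / Real.exp j := by
    intro n hn
    obtain ⟨hp, hα, h1, h2⟩ := hs n hn
    have hn0 : (0:ℝ) < n := by exact_mod_cast hp.pos
    have h3 : Real.log n ≤ j + 1 := by
      rw [Real.log_le_iff_le_exp hn0]; exact h2.le
    gcongr
  have h1 := Finset.sum_le_card_nsmul s _ _ hterm
  rw [nsmul_eq_mul] at h1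
  have hej := Real.exp_pos (j:ℝ)
  have hu3 : u ≤ 3 * Real.exp j := by
    rw [hu, Real.exp_add, mul_comm]
    have := Real.exp_one_lt_d9
    gcongr; linarith
  calc _ ≤ _ := h1
    _ ≤ C * ((3 * Real.exp j) / (Nat.totient q * (((j:ℝ) + 1) / 4))) * ((j + 1) / Real.exp j) := by
        gcongr
        refine hcard.trans ?_
        gcongr
    _ = _ := by field_simp; norm_num

lemma nonprime_summable : ∃ M : ℝ, 0 < M ∧ ∀ s : Finset ℕ, (∀ n ∈ s, ¬ n.Prime ∧ n ≠ 0) →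
    ∑ n ∈ s, ArithmeticFunction.vonMangoldt n * (n:ℝ) ^ (-(3/4) : ℝ) ≤ M := by
  obtain ⟨C, hC⟩ := Chebyshev.psi_sub_theta_le_mul_sqrt
  set C' := |C| + 1 with hC'
  have hgeo : Summable (fun j : ℕ => C' * Real.exp (1/2) * (Real.exp (-(1/4))) ^ j) := by
    apply Summable.mul_left
    apply summable_geometric_of_lt_one (Real.exp_pos _).le
    rw [Real.exp_lt_one_iff]; norm_num
  refine ⟨(∑' j : ℕ, C' * Real.exp (1/2) * (Real.exp (-(1/4))) ^ j) + 1, ?_, ?_⟩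
  · have : 0 ≤ ∑' j : ℕ, C' * Real.exp (1/2) * (Real.exp (-(1/4))) ^ j := tsum_nonneg (fun j => by positivity)
    linarith
  intro s hs
  refine (block_sum (b := fun j : ℕ => C' * Real.exp (1/2) * (Real.exp (-(1/4))) ^ j) (P := fun n => ¬ n.Prime) ?_ s hs).trans ?_
  · intro j t ht
    have h0 := Chebyshev.psi_sub_theta_eq_sum_not_prime (Real.exp (j + 1))
    have h1 := hC (Real.exp (j + 1))
    have h2 : ∑ n ∈ t, ArithmeticFunction.vonMangoldt n ≤ C' * Real.exp ((j + 1) / 2) := by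
      have h3 : ∑ n ∈ t, ArithmeticFunction.vonMangoldt n ≤ Chebyshev.psi (Real.exp (j+1)) - Chebyshev.theta (Real.exp (j + 1)) := by
        rw [h0]
        apply Finset.sum_le_sum_of_subset_of_nonneg
        · intro n hn
          obtain ⟨a, b, c⟩ := ht n hn
          rw [Finset.mem_filter, Finset.mem_Ioc]
          have hn0 : (0:ℝ) < n := (Real.exp_pos _).trans_le b
          exact ⟨⟨by exact_mod_cast hn0, Nat.le_floor c.le⟩, a⟩
        · intro n _ _; exact ArithmeticFunction.vonMangoldt_nonneg
      have h4 : √(Real.exp ((j:ℝ) + 1)) = Real.exp ((j + 1) / 2) := by rw [Real.exp_half]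
      rw [h4] at h1
      have h5 : C * Real.exp (((j:ℝ) + 1) / 2) ≤ C' * Real.exp ((j + 1) / 2) := by
        gcongr; rw [hC']; linarith [le_abs_self C]
      linarith
    calc _ ≤ ∑ n ∈ t, ArithmeticFunction.vonMangoldt n * Real.exp (-(3/4) * j) := by
          apply Finset.sum_le_sum
          intro n hn
          obtain ⟨a, b, c⟩ := ht n hn
          have hn0 : (0:ℝ) < n := (Real.exp_pos _).trans_le b
          apply mul_le_mul_of_nonneg_left _ ArithmeticFunction.vonMangoldt_nonneg
          rw [Real.rpow_def_of_pos hn0]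
          apply Real.exp_le_exp.2
          have := (Real.le_log_iff_exp_le hn0).2 b
          linarith
      _ = (∑ n ∈ t, ArithmeticFunction.vonMangoldt n) * Real.exp (-(3/4) * j) := by rw [Finset.sum_mul]
      _ ≤ (C' * Real.exp ((j + 1) / 2)) * Real.exp (-(3/4) * j) := by gcongr
      _ = _ := by
          rw [← Real.exp_nat_mul, mul_assoc, mul_assoc, ← Real.exp_add, ← Real.exp_add]
          congr 2; ring
  · have := hgeo.sum_le_tsum (s.image (fun n : ℕ => ⌊Real.log n⌋₊)) (fun j _ => by positivity)
    linarith

end Gall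

end

section

open Finset MeasureTheory
namespace Gall

lemma wt_nonneg (δ L : ℝ) (n : ℕ) : 0 ≤ wt δ L n := by
  unfold wt
  have := kk_nonneg (L - Real.log n)
  have := ArithmeticFunction.vonMangoldt_nonneg (n := n)
  positivity

lemma wt_summable {δ : ℝ} (hδ : 0 < δ) (L : ℝ) : Summable (wt δ L) := by
  have hs : 1 < ((1:ℂ) + δ).re := by simpa using hδ
  have h := (ArithmeticFunction.LSeriesSummable_vonMangoldt hs).norm
  refine Summable.of_norm_bounded h ?_
  intro n
  rw [Real.norm_of_nonneg (wt_nonneg δ L n)]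
  rcases eq_or_ne n 0 with rfl | hn
  · unfold wt; simp
  · rw [LSeries.norm_term_eq, if_neg hn, Complex.norm_real, Real.norm_of_nonneg ArithmeticFunction.vonMangoldt_nonneg]
    unfold wt
    have e : (1 + (δ:ℂ)).re = 1 + δ := by simp
    rw [e, Real.rpow_neg (Nat.cast_nonneg n), div_eq_mul_inv]
    apply mul_le_of_le_one_right _ (kk_le_one _)
    have := ArithmeticFunction.vonMangoldt_nonneg (n := n)
    positivity

lemma theta_diff : ∃ X : ℝ, 16 ≤ X ∧ ∀ x : ℝ, X ≤ x → x / 10 ≤ Chebyshev.theta x - Chebyshev.theta (x / 4) := by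
  have h1 := (isLittleO_log_rpow_atTop (r := 1/2) (by norm_num)).bound (c := 1/100) (by norm_num)
  obtain ⟨X, hX⟩ := Filter.eventually_atTop.1 h1
  refine ⟨max X 100, le_max_of_le_right (by norm_num), ?_⟩
  intro x hx
  have hx1 : X ≤ x := (le_max_left _ _).trans hx
  have hx2 : 100 ≤ x := (le_max_right _ _).trans hx
  have h2 := hX x hx1
  rw [Real.norm_of_nonneg (Real.log_nonneg (by linarith)), Real.norm_of_nonneg (by positivity), ← Real.sqrt_eq_rpow] at h2
  have h3 := Chebyshev.theta_ge' (x := x) (by linarith)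
  have h4 := Chebyshev.theta_le_log4_mul_x (x := x / 4) (by linarith)
  have h5 : Real.log 4 = 2 * Real.log 2 := by
    rw [show (4:ℝ) = 2 ^ 2 by norm_num, Real.log_pow]; norm_num
  have h6 : √x * √x = x := Real.mul_self_sqrt (by linarith)
  have hs : 10 ≤ √x := by
    rw [show (10:ℝ) = √100 by rw [show (100:ℝ) = 10 ^ 2 by norm_num, Real.sqrt_sq (by norm_num)]]
    exact Real.sqrt_le_sqrt hx2
  have h7 : Real.log (x + 2) ≤ 2 * Real.log x := by
    rw [← Real.log_rpow (by linarith)]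
    apply Real.log_le_log (by linarith)
    rw [Real.rpow_two]; nlinarith
  have h8 : 2 * √x * Real.log x ≤ x / 50 := by nlinarith
  have h9 : Real.log (x + 2) ≤ x / 50 := by nlinarith
  have := Real.log_two_gt_d9
  have := Real.log_two_lt_d9
  rw [h5] at h4
  nlinarith

lemma T_lower : ∃ L0 : ℝ, 4 ≤ L0 ∧ ∀ (L : ℝ) (z : ℕ), L0 ≤ L → (z:ℝ) ≤ Real.exp L / 4 →
    ∃ s : Finset ℕ, (∀ n ∈ s, Rough z n) ∧ 1 / 100 ≤ ∑ n ∈ s, wt (1 / L) L n := by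
  obtain ⟨X, hX, hth⟩ := theta_diff
  refine ⟨max 4 (Real.log X), le_max_left _ _, ?_⟩
  intro L z hL hz
  have hL4 : 4 ≤ L := (le_max_left _ _).trans hL
  have hXL : X ≤ Real.exp L := (Real.log_le_iff_le_exp (by linarith)).1 ((le_max_right _ _).trans hL)
  set x := Real.exp L with hx
  have hx16 : 16 ≤ x := hX.trans hXL
  have h1 := hth x hXL
  refine ⟨(Ioc ⌊x / 4⌋₊ ⌊x⌋₊).filter Nat.Prime, ?_, ?_⟩
  · intro n hn
    rw [Finset.mem_filter, Finset.mem_Ioc] at hn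
    refine ⟨hn.2.one_lt, ?_⟩
    intro p pp hpz hd
    have := (Nat.prime_dvd_prime_iff_eq pp hn.2).1 hd
    subst this
    have h2 := (Nat.floor_lt (by linarith)).1 hn.1.1
    have h3 : (p:ℝ) < z := by exact_mod_cast hpz
    linarith
  · have e : Chebyshev.theta x - Chebyshev.theta (x / 4) = ∑ p ∈ (Ioc ⌊x / 4⌋₊ ⌊x⌋₊).filter Nat.Prime, Real.log p := by
      unfold Chebyshev.theta
      have hle : ⌊x / 4⌋₊ ≤ ⌊x⌋₊ := Nat.floor_le_floor (by linarith)
      rw [← Finset.Ioc_union_Ioc_eq_Ioc (Nat.zero_le _) hle, Finset.filter_union, Finset.sum_union]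
      · ring
      · apply Finset.disjoint_filter_filter
        rw [Finset.disjoint_left]
        intro a ha hb
        rw [Finset.mem_Ioc] at ha hb
        omega
    have hterm : ∀ n ∈ (Ioc ⌊x / 4⌋₊ ⌊x⌋₊).filter Nat.Prime, Real.log n * (1 / (9 * x)) ≤ wt (1 / L) L n := by
      intro n hn
      rw [Finset.mem_filter, Finset.mem_Ioc] at hn
      obtain ⟨⟨a, b⟩, hp⟩ := hn
      have hn0 : (0:ℝ) < n := by exact_mod_cast hp.pos
      have a' := (Nat.floor_lt (by linarith)).1 a
      have b' := (Nat.le_floor_iff (by linarith)).1 b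
      have hlog0 : 0 ≤ Real.log n := Real.log_natCast_nonneg n
      have hlog1 : Real.log n ≤ L := by rw [Real.log_le_iff_le_exp hn0]; exact b'
      have hlog2 : L - 2 ≤ Real.log n := by
        rw [Real.le_log_iff_exp_le hn0, Real.exp_sub]
        refine le_trans ?_ a'.le
        apply div_le_div_of_nonneg_left (by linarith) (by norm_num)
        have := Real.quadratic_le_exp_of_nonneg (x := 2) (by norm_num)
        linarith
      unfold wt
      rw [ArithmeticFunction.vonMangoldt_apply_prime hp, mul_assoc]
      apply mul_le_mul_of_nonneg_left _ hlog0
      have hk := kk_lower (y := L - Real.log n) (by rw [abs_le]; constructor <;> linarith)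
      have hpow : 1 / (3 * x) ≤ (n:ℝ) ^ (-(1 + 1 / L)) := by
        rw [Real.rpow_def_of_pos hn0]
        have h3 : -(L + 1) ≤ Real.log n * -(1 + 1 / L) := by
          have : Real.log n * (1 + 1 / L) ≤ L * (1 + 1 / L) := by gcongr
          have e2 : L * (1 + 1 / L) = L + 1 := by field_simp
          linarith
        refine le_trans ?_ (Real.exp_le_exp.2 h3)
        rw [Real.exp_neg, Real.exp_add, ← hx, one_div]
        apply inv_anti₀ (by positivity)
        have := Real.exp_one_lt_d9
        nlinarith
      calc 1 / (9 * x) = 1 / (3 * x) * (1 / 3) := by field_simp; norm_num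
        _ ≤ _ := by gcongr
    refine le_trans ?_ (Finset.sum_le_sum hterm)
    rw [← Finset.sum_mul, ← e]
    calc (1:ℝ) / 100 ≤ (x / 10) * (1 / (9 * x)) := by
          have : (x / 10) * (1 / (9 * x)) = 1 / 90 := by field_simp; norm_num
          rw [this]; norm_num
      _ ≤ _ := by gcongr

lemma wt_le {δ : ℝ} (hδ : 0 < δ) (L : ℝ) {n : ℕ} (hn : n ≠ 0) :
    wt δ L n ≤ ArithmeticFunction.vonMangoldt n / n * kk (L - Real.log n) := by
  unfold wt
  have h1 : (1:ℝ) ≤ n := by exact_mod_cast Nat.one_le_iff_ne_zero.2 hn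
  have h2 : (n:ℝ) ^ (-(1 + δ)) ≤ (n:ℝ)⁻¹ := by
    rw [← Real.rpow_neg_one]
    exact Real.rpow_le_rpow_of_exponent_le h1 (by linarith)
  rw [div_eq_mul_inv]
  have := kk_nonneg (L - Real.log n)
  have := ArithmeticFunction.vonMangoldt_nonneg (n := n)
  gcongr

open Classical in
lemma upper_A (ε : ℝ) (hε : 0 < ε) : ∃ V : ℝ, 3 ≤ V ∧ ∃ Z0 : ℕ, 21 ≤ Z0 ∧ ∀ (q : ℕ) [NeZero q] (α : (ZMod q)ˣ) (z : ℕ),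
    q ^ 8 ≤ z → Z0 ≤ z → ∀ δ L : ℝ, 0 < δ → V ≤ L → ∀ s : Finset ℕ, (∀ n ∈ s, Rough z n ∧ (n : ZMod q) = α) →
    ∑ n ∈ s, wt δ L n ≤ ε / Nat.totient q +
      Nat.card {p : ℕ | p.Prime ∧ (p : ℝ) ≤ Real.exp (L + V) ∧ (p : ZMod q) = α} * ((L + V) * (Real.exp V / Real.exp L)) := by
  obtain ⟨C, hC, hbl⟩ := block_primes
  obtain ⟨M, hM, hnp⟩ := nonprime_summable
  obtain ⟨V, hV, hfar⟩ := far_sum (ε / (30 * C)) (by positivity)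
  refine ⟨V, hV, max 21 ⌈(2 * M / ε) ^ 8⌉₊, le_max_left _ _, ?_⟩
  intro q _ α z hqz hZ δ L hδ hL s hs
  have hφ := totient_pos' q
  have hz21 : 21 ≤ z := (le_max_left _ _).trans hZ
  have hz0 : (0:ℝ) < z := by positivity
  have hq1 : (1:ℝ) ≤ q := by exact_mod_cast Nat.one_le_iff_ne_zero.2 (NeZero.ne q)
  have hφq : (Nat.totient q : ℝ) ≤ q := by exact_mod_cast Nat.totient_le q
  have hne : ∀ n ∈ s, n ≠ 0 := fun n hn => by have := (hs n hn).1.1; omega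
  have hge : ∀ n ∈ s, (z:ℝ) ≤ n := fun n hn => by exact_mod_cast (hs n hn).1.le
  rw [← Finset.sum_filter_add_sum_filter_not s Nat.Prime,
    ← Finset.sum_filter_add_sum_filter_not (s.filter Nat.Prime) (fun n : ℕ => V < |L - Real.log n|)]
  -- non-primes
  have b1 : ∑ n ∈ s.filter (fun n => ¬ n.Prime), wt δ L n ≤ ε / 2 / Nat.totient q := by
    have hz8 : (2 * M / ε) ≤ (z:ℝ) ^ (1/8 : ℝ) := by
      have h1 : (2 * M / ε) ^ 8 ≤ z := by
        refine (Nat.le_ceil _).trans ?_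
        exact_mod_cast (le_max_right _ _).trans hZ
      calc 2 * M / ε = ((2 * M / ε) ^ 8) ^ (1/8 : ℝ) := by
            rw [← Real.rpow_natCast, ← Real.rpow_mul (by positivity)]; norm_num
        _ ≤ _ := by gcongr
    have hq8 : (q:ℝ) ≤ (z:ℝ) ^ (1/8 : ℝ) := by
      have h1 : (q:ℝ) ^ 8 ≤ z := by exact_mod_cast hqz
      calc (q:ℝ) = ((q:ℝ) ^ 8) ^ (1/8 : ℝ) := by
            rw [← Real.rpow_natCast, ← Real.rpow_mul (by positivity)]; norm_num
        _ ≤ _ := by gcongr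
    have hzz : (z:ℝ) ^ (1/4 : ℝ) = (z:ℝ) ^ (1/8 : ℝ) * (z:ℝ) ^ (1/8 : ℝ) := by
      rw [← Real.rpow_add hz0]; norm_num
    have hz4 : (z:ℝ) ^ (-(1/4) : ℝ) ≤ ε / (2 * M) / Nat.totient q := by
      rw [Real.rpow_neg hz0.le, hzz, div_div, inv_le_comm₀ (by positivity) (by positivity), inv_div]
      calc 2 * M * (Nat.totient q : ℝ) / ε = (2 * M / ε) * Nat.totient q := by ring
        _ ≤ _ := by
            apply mul_le_mul hz8 (hφq.trans hq8) hφ.le (by positivity)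
    calc _ ≤ ∑ n ∈ s.filter (fun n => ¬ n.Prime), ArithmeticFunction.vonMangoldt n * (n:ℝ) ^ (-(3/4) : ℝ) * (z:ℝ) ^ (-(1/4) : ℝ) := by
          apply Finset.sum_le_sum
          intro n hn
          have hn' := (Finset.mem_filter.1 hn).1
          have hn0 : (0:ℝ) < n := by exact_mod_cast Nat.pos_of_ne_zero (hne n hn')
          refine (wt_le hδ L (hne n hn')).trans ?_
          have hL0 := ArithmeticFunction.vonMangoldt_nonneg (n := n)
          refine (mul_le_of_le_one_right (by positivity) (kk_le_one _)).trans ?_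
          rw [div_eq_mul_inv, mul_assoc]
          apply mul_le_mul_of_nonneg_left _ hL0
          have e : (n:ℝ)⁻¹ = (n:ℝ) ^ (-(3/4) : ℝ) * (n:ℝ) ^ (-(1/4) : ℝ) := by
            rw [← Real.rpow_add hn0, ← Real.rpow_neg_one]; norm_num
          rw [e]
          apply mul_le_mul_of_nonneg_left _ (by positivity)
          exact Real.rpow_le_rpow_of_nonpos hz0 (hge n hn') (by norm_num)
      _ = (∑ n ∈ s.filter (fun n => ¬ n.Prime), ArithmeticFunction.vonMangoldt n * (n:ℝ) ^ (-(3/4) : ℝ)) * (z:ℝ) ^ (-(1/4) : ℝ) := by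
          rw [Finset.sum_mul]
      _ ≤ M * (ε / (2 * M) / Nat.totient q) := by
          gcongr
          apply hnp
          intro n hn
          exact ⟨(Finset.mem_filter.1 hn).2, hne n (Finset.mem_filter.1 hn).1⟩
      _ = _ := by field_simp
  -- far primes
  have b2 : ∑ n ∈ (s.filter Nat.Prime).filter (fun n : ℕ => V < |L - Real.log n|), wt δ L n ≤ ε / 2 / Nat.totient q := by
    refine (block_sum (b := fun j : ℕ => 15 * (1 / (1 + (L - j) ^ 2)) * (C / Nat.totient q))
      (P := fun n => n ∈ s ∧ n.Prime) ?_ _ ?_).trans ?_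
    · intro j t ht
      rcases t.eq_empty_or_nonempty with rfl | ⟨m, hm⟩
      · simp only [Finset.sum_empty]; positivity
      · obtain ⟨⟨hms, -⟩, -, hm2⟩ := ht m hm
        have hzj : (z:ℝ) < Real.exp (j + 1) := (hge m hms).trans_lt hm2
        have hj : 2 ≤ j := by
          by_contra hlt
          have h1 : (j:ℝ) + 1 ≤ 2 := by exact_mod_cast (by omega : j + 1 ≤ 2)
          have h2 : Real.exp ((j:ℝ) + 1) ≤ Real.exp 2 := Real.exp_le_exp.2 h1
          have h3 : Real.exp 2 = Real.exp 1 * Real.exp 1 := by rw [← Real.exp_add]; norm_num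
          have h4 := Real.exp_one_lt_d9
          have h5 := Real.exp_pos 1
          have h6 : (21:ℝ) ≤ z := by exact_mod_cast hz21
          nlinarith
        have hqj : (q:ℝ) ^ 2 ≤ Real.exp (j + 1) := by
          have h1 : (q:ℝ) ^ 8 ≤ z := by exact_mod_cast hqz
          have h2 : (q:ℝ) ^ 2 ≤ (q:ℝ) ^ 8 := pow_le_pow_right₀ hq1 (by norm_num)
          linarith
        have h1 := hbl q α j hj hqj t (fun n hn => ⟨(ht n hn).1.2, (hs n (ht n hn).1.1).2, (ht n hn).2⟩)
        calc _ ≤ ∑ n ∈ t, 15 * (1 / (1 + (L - j) ^ 2)) * (Real.log n / n) := by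
              apply Finset.sum_le_sum
              intro n hn
              obtain ⟨⟨hns, hp⟩, hn1, hn2⟩ := ht n hn
              have hn0 : (0:ℝ) < n := by exact_mod_cast hp.pos
              refine (wt_le hδ L (hne n hns)).trans ?_
              rw [ArithmeticFunction.vonMangoldt_apply_prime hp, mul_comm]
              have hlog0 : 0 ≤ Real.log n := Real.log_natCast_nonneg n
              apply mul_le_mul_of_nonneg_right _ (by positivity)
              refine (kk_le _).trans ?_
              have l1 : (j:ℝ) ≤ Real.log n := (Real.le_log_iff_exp_le hn0).2 hn1
              have l2 : Real.log n ≤ j + 1 := (Real.log_le_iff_le_exp hn0).2 hn2.le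
              rw [mul_one_div, div_le_div_iff₀ (by positivity) (by positivity)]
              have l3 : (L - j) ^ 2 ≤ 2 * (L - Real.log n) ^ 2 + 2 * (Real.log n - j) ^ 2 := by
                nlinarith [sq_nonneg ((L - Real.log n) - (Real.log n - j))]
              have l4 : (Real.log n - j) ^ 2 ≤ 1 := by nlinarith
              nlinarith [sq_nonneg (L - Real.log n)]
          _ = 15 * (1 / (1 + (L - j) ^ 2)) * ∑ n ∈ t, (Real.log n / n) := by rw [Finset.mul_sum]
          _ ≤ _ := by gcongr
    · intro n hn
      have h1 := (Finset.mem_filter.1 (Finset.mem_filter.1 hn).1)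
      exact ⟨h1, hne n h1.1⟩
    · rw [← Finset.sum_mul, ← Finset.mul_sum]
      have h1 := hfar L (((s.filter Nat.Prime).filter (fun n : ℕ => V < |L - Real.log n|)).image (fun n : ℕ => ⌊Real.log n⌋₊)) (by
        intro j hj
        obtain ⟨n, hn, rfl⟩ := Finset.mem_image.1 hj
        have h1 := (Finset.mem_filter.1 hn).2
        have hlog0 : 0 ≤ Real.log n := Real.log_natCast_nonneg n
        have f1 := Nat.floor_le hlog0
        have f2 := Nat.lt_floor_add_one (Real.log n)
        have f3 : |L - Real.log n| ≤ |L - (⌊Real.log n⌋₊ : ℝ)| + |(⌊Real.log n⌋₊ : ℝ) - Real.log n| := abs_sub_le _ _ _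
        have f4 : |(⌊Real.log n⌋₊ : ℝ) - Real.log n| ≤ 1 := by rw [abs_le]; constructor <;> linarith
        linarith)
      calc _ ≤ 15 * (ε / (30 * C)) * (C / Nat.totient q) := by gcongr
        _ = _ := by field_simp; norm_num
  -- near primes
  have b3 : ∑ n ∈ (s.filter Nat.Prime).filter (fun n : ℕ => ¬ V < |L - Real.log n|), wt δ L n ≤
      Nat.card {p : ℕ | p.Prime ∧ (p : ℝ) ≤ Real.exp (L + V) ∧ (p : ZMod q) = α} * ((L + V) * (Real.exp V / Real.exp L)) := by
    have hprop : ∀ n ∈ (s.filter Nat.Prime).filter (fun n : ℕ => ¬ V < |L - Real.log n|),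
        n.Prime ∧ (n : ZMod q) = α ∧ Real.exp (L - V) ≤ n ∧ (n:ℝ) ≤ Real.exp (L + V) := by
      intro n hn
      obtain ⟨hn1, hn2⟩ := Finset.mem_filter.1 hn
      obtain ⟨hn3, hp⟩ := Finset.mem_filter.1 hn1
      have hn0 : (0:ℝ) < n := by exact_mod_cast hp.pos
      have := abs_le.1 (not_lt.1 hn2)
      refine ⟨hp, (hs n hn3).2, ?_, ?_⟩
      · rw [← Real.le_log_iff_exp_le hn0]; linarith
      · rw [← Real.log_le_iff_le_exp hn0]; linarith
    have hterm : ∀ n ∈ (s.filter Nat.Prime).filter (fun n : ℕ => ¬ V < |L - Real.log n|),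
        wt δ L n ≤ (L + V) * (Real.exp V / Real.exp L) := by
      intro n hn
      obtain ⟨hp, -, h1, h2⟩ := hprop n hn
      have hn0 : (0:ℝ) < n := by exact_mod_cast hp.pos
      refine (wt_le hδ L hp.ne_zero).trans ?_
      rw [ArithmeticFunction.vonMangoldt_apply_prime hp]
      have hlog0 : 0 ≤ Real.log n := Real.log_natCast_nonneg n
      refine (mul_le_of_le_one_right (by positivity) (kk_le_one _)).trans ?_
      rw [div_eq_mul_inv]
      have l2 : Real.log n ≤ L + V := (Real.log_le_iff_le_exp hn0).2 h2
      have l3 : (n:ℝ)⁻¹ ≤ Real.exp V / Real.exp L := by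
        rw [← Real.exp_sub, inv_le_comm₀ hn0 (Real.exp_pos _), ← Real.exp_neg, neg_sub]
        exact h1
      gcongr
      linarith
    have h1 := Finset.sum_le_card_nsmul _ _ _ hterm
    rw [nsmul_eq_mul] at h1
    refine h1.trans ?_
    apply mul_le_mul_of_nonneg_right _ (mul_nonneg (by linarith) (by positivity))
    rw [Nat.cast_le, ← Nat.card_eq_finsetCard]
    have hfin : {p : ℕ | p.Prime ∧ (p : ℝ) ≤ Real.exp (L + V) ∧ (p : ZMod q) = α}.Finite := by
      apply (Set.finite_Iic ⌊Real.exp (L + V)⌋₊).subset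
      intro p hp
      exact Nat.le_floor hp.2.1
    apply Nat.card_mono hfin
    intro n hn
    obtain ⟨hp, h0, h1, h2⟩ := hprop n hn
    exact ⟨hp, h2, h0⟩
  have e : ε / (Nat.totient q : ℝ) = ε / 2 / Nat.totient q + ε / 2 / Nat.totient q := by ring
  rw [e]
  linarith

end Gall

end

section

open Finset MeasureTheory
namespace Gall

open Classical in
/-- From the analytic estimate to a lower bound for the number of primes, for one modulus. -/
lemma progression_lower {q z : ℕ} [NeZero q] (α : (ZMod q)ˣ) {δ L S η U : ℝ} (hδ : 0 < δ)
    (hS : HasSum (fun n => cE q z α n * wt δ L n) S)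
    {s : Finset ℕ} (hs : ∀ n ∈ s, Rough z n) (hT : η ≤ ∑ n ∈ s, wt δ L n)
    (hU : ∀ t : Finset ℕ, (∀ n ∈ t, Rough z n ∧ (n : ZMod q) = α) → ∑ n ∈ t, wt δ L n ≤ U) :
    η / Nat.totient q - |S| ≤ U := by
  have hφ := totient_pos' q
  set fA : ℕ → ℝ := fun n => if Rough z n ∧ (n : ZMod q) = α then wt δ L n else 0 with hfA
  set fT : ℕ → ℝ := fun n => if Rough z n then wt δ L n else 0 with hfT
  have w0 := wt_nonneg δ L
  have sA : Summable fA := by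
    refine Summable.of_nonneg_of_le (fun n => ?_) (fun n => ?_) (wt_summable hδ L)
    · simp only [hfA]; split_ifs; exacts [w0 n, le_rfl]
    · simp only [hfA]; split_ifs; exacts [le_rfl, w0 n]
  have sT : Summable fT := by
    refine Summable.of_nonneg_of_le (fun n => ?_) (fun n => ?_) (wt_summable hδ L)
    · simp only [hfT]; split_ifs; exacts [w0 n, le_rfl]
    · simp only [hfT]; split_ifs; exacts [le_rfl, w0 n]
  have e : ∀ n, cE q z α n * wt δ L n = fA n - (1 / (Nat.totient q : ℝ)) * fT n := by
    intro n
    simp only [hfA, hfT]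
    unfold cE
    by_cases h1 : Rough z n
    · by_cases h2 : (n : ZMod q) = α
      · simp only [h1, h2, and_self, if_true]; ring
      · simp only [h1, h2, and_false, if_true, if_false]; ring
    · simp [h1]
  have hS2 : S = ∑' n, fA n - (1 / (Nat.totient q : ℝ)) * ∑' n, fT n := by
    rw [← hS.tsum_eq]
    simp_rw [e]
    rw [(sA.tsum_sub (sT.mul_left _)), tsum_mul_left]
  have hT2 : η ≤ ∑' n, fT n := by
    refine hT.trans ?_
    have h1 : ∑ n ∈ s, wt δ L n = ∑ n ∈ s, fT n := by
      apply Finset.sum_congr rfl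
      intro n hn
      simp only [hfT, if_pos (hs n hn)]
    rw [h1]
    apply sT.sum_le_tsum
    intro n _
    simp only [hfT]; split_ifs; exacts [w0 n, le_rfl]
  have hA2 : ∑' n, fA n ≤ U := by
    apply sA.tsum_le_of_sum_le
    intro t
    simp only [hfA]
    rw [← Finset.sum_filter]
    exact hU _ (fun n hn => (Finset.mem_filter.1 hn).2)
  have h3 : η / (Nat.totient q : ℝ) ≤ (1 / (Nat.totient q : ℝ)) * ∑' n, fT n := by
    rw [div_eq_mul_inv, mul_comm, ← one_div]
    gcongr
  have := neg_abs_le S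
  linarith

set_option maxHeartbeats 4000000 in
lemma final (C₂ : ℝ) (hC₂ : 0 < C₂) :
    ∃ D : ℝ, 1 ≤ D ∧ ∃ c > (0 : ℝ), ∀ (q : ℕ) [NeZero q], 2 ≤ q →
      (∀ χ : DirichletCharacter ℂ q, ∀ s : ℂ, 1 - C₂ / Real.log (q * (|s.im| + 1)) < s.re →
        DirichletCharacter.LFunction χ s ≠ 0) →
      ∀ a : ℕ, Nat.Coprime a q → ∀ x : ℝ, (q : ℝ) ^ D ≤ x →
        c * (x / (Nat.totient q * Real.log x)) ≤
          Nat.card {p : ℕ | p.Prime ∧ (p : ℝ) ≤ x ∧ p % q = a % q} := by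
  obtain ⟨C, hC, hEb⟩ := hE_bound
  obtain ⟨K, hK, hFF⟩ := FF_inv C hC
  obtain ⟨L0, hL0, hTl⟩ := T_lower
  obtain ⟨V, hV, Z0, hZ0, hUp⟩ := upper_A (1 / 400) (by norm_num)
  set C' : ℝ := 10 ^ 12 * K ^ 2 * C ^ 2 + 10 ^ 8 * C with hC'
  have hC'0 : 0 < C' := by positivity
  set k : ℕ := 8 + ⌈1 / C₂⌉₊ with hk
  have hkC : 1 ≤ C₂ * k := by
    have h1 : 1 / C₂ ≤ k := by
      rw [hk]; push_cast
      have := Nat.le_ceil (1 / C₂); linarith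
    rw [div_le_iff₀ hC₂] at h1; linarith
  have hk8 : 8 ≤ k := by omega
  set R : ℝ := 256 + 400 * C' + L0 + V with hR
  set k1 : ℝ := k * (1 + Real.log Z0 / Real.log 2) with hk1
  have hlog2 : 0 < Real.log 2 := Real.log_pos (by norm_num)
  have hZ0' : (21:ℝ) ≤ Z0 := by exact_mod_cast hZ0
  have hlZ : 0 ≤ Real.log Z0 := Real.log_nonneg (by linarith)
  have hk8' : (8:ℝ) ≤ k := by exact_mod_cast hk8
  have hk1' : 1 ≤ k1 := by
    have : 0 ≤ Real.log Z0 / Real.log 2 := by positivity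
    rw [hk1]; nlinarith
  refine ⟨R * k1 + V / Real.log 2, ?_, 1 / 200 / Real.exp (2 * V), by positivity, ?_⟩
  · have : 0 < V / Real.log 2 := by have : 0 < V := by linarith
                                    positivity
    nlinarith
  intro q _ hq2 hgood a ha x hx
  have hφ := totient_pos' q
  have hq2' : (2:ℝ) ≤ q := by exact_mod_cast hq2
  have hlq : Real.log 2 ≤ Real.log q := Real.log_le_log (by norm_num) hq2'
  have hlq0 : 0 < Real.log q := by linarith
  set z : ℕ := (Z0 * q) ^ k with hz
  set ℓ : ℝ := Real.log z with hℓ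
  have hℓe : ℓ = k * (Real.log Z0 + Real.log q) := by
    rw [hℓ, hz]; push_cast
    rw [Real.log_pow, Real.log_mul (by linarith) (by linarith)]
  have hℓk1 : ℓ ≤ k1 * Real.log q := by
    rw [hℓe, hk1, mul_assoc]
    apply mul_le_mul_of_nonneg_left _ (by positivity)
    have : Real.log Z0 ≤ Real.log Z0 / Real.log 2 * Real.log q := by
      rw [div_mul_eq_mul_div, le_div_iff₀ hlog2]
      gcongr
    linarith
  have hlog2' := Real.log_two_gt_d9
  have hℓ1 : 1 ≤ ℓ := by
    rw [hℓe]; nlinarith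
  have hℓ0 : 0 < ℓ := by linarith
  have hZq : 1 ≤ Z0 * q := Nat.one_le_iff_ne_zero.2 (by positivity)
  have hqz8 : q ^ 8 ≤ z := by
    rw [hz]
    calc q ^ 8 ≤ (Z0 * q) ^ 8 := Nat.pow_le_pow_left (Nat.le_mul_of_pos_left q (by omega)) 8
      _ ≤ _ := Nat.pow_le_pow_right hZq hk8
  have hqz : q < z := by
    refine lt_of_lt_of_le ?_ hqz8
    calc q = q ^ 1 := (pow_one q).symm
      _ < q ^ 8 := Nat.pow_lt_pow_right (by omega) (by norm_num)
  have hZz : Z0 ≤ z := by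
    rw [hz]
    calc Z0 ≤ Z0 * q := Nat.le_mul_of_pos_right _ (by omega)
      _ = (Z0 * q) ^ 1 := (pow_one _).symm
      _ ≤ _ := Nat.pow_le_pow_right hZq (by omega)
  have hz0 : (0:ℝ) < z := by
    have : 0 < z := by omega
    exact_mod_cast this
  have hx0 : 0 < x := lt_of_lt_of_le (Real.rpow_pos_of_pos (by linarith) _) hx
  have hlx : (R * k1 + V / Real.log 2) * Real.log q ≤ Real.log x := by
    rw [← Real.log_rpow (by linarith)]
    exact Real.log_le_log (Real.rpow_pos_of_pos (by linarith) _) hx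
  set L : ℝ := Real.log x - V with hL
  have hR0 : 0 < R := by rw [hR]; linarith
  have hLR : R * ℓ ≤ L := by
    have h1 : R * ℓ ≤ R * (k1 * Real.log q) := by gcongr
    have h2 : V ≤ V / Real.log 2 * Real.log q := by
      rw [div_mul_eq_mul_div, le_div_iff₀ hlog2]
      gcongr
    rw [hL]
    nlinarith
  have hRL : R ≤ L := le_trans (by nlinarith) hLR
  have hL256 : 256 * ℓ ≤ L := by
    refine le_trans ?_ hLR
    apply mul_le_mul_of_nonneg_right _ hℓ0.le
    rw [hR]; linarith
  have hL400 : 400 * C' * ℓ ≤ L := by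
    refine le_trans ?_ hLR
    apply mul_le_mul_of_nonneg_right _ hℓ0.le
    rw [hR]; linarith
  have hLpos : 0 < L := by linarith
  have hLV : V ≤ L := by linarith
  have hLL0 : L0 ≤ L := by linarith
  have hexpL : Real.exp (L + V) = x := by rw [hL, sub_add_cancel, Real.exp_log hx0]
  have hzexp : (z:ℝ) ≤ Real.exp L / 4 := by
    rw [le_div_iff₀ (by norm_num)]
    have h1 : (z:ℝ) = Real.exp ℓ := by rw [hℓ, Real.exp_log hz0]
    have h4 : (4:ℝ) ≤ Real.exp 3 := by
      have := Real.add_one_le_exp (3:ℝ); linarith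
    calc (z:ℝ) * 4 ≤ Real.exp ℓ * Real.exp 3 := by rw [h1]; gcongr
      _ = Real.exp (ℓ + 3) := by rw [Real.exp_add]
      _ ≤ _ := Real.exp_le_exp.2 (by linarith)
  have hb : ∀ (β : (ZMod q)ˣ) (v : ℝ), |hE q z β v| ≤ (C / ℓ) / Nat.totient q * Real.exp (-(1 / (64 * ℓ) * v)) := by
    intro β v
    have hq4 : (q:ℝ) ^ 4 ≤ z := by
      have h1 : (q:ℝ) ^ 8 ≤ z := by exact_mod_cast hqz8
      exact (pow_le_pow_right₀ (by linarith) (by norm_num)).trans h1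
    have h := ((hEb q β z hq2 hq4 v)).2
    rw [div_div, mul_comm ℓ]
    exact h
  have hδ0 : 0 < 1 / L := by positivity
  have hδ1 : 1 / L ≤ 1 / (256 * ℓ) := one_div_le_one_div_of_le (by positivity) hL256
  have hF : ∀ χ : DirichletCharacter ℂ q, χ ≠ 1 → ∀ t : ℝ, |t| ≤ 1 → 1 ≤ K * ‖FF q z χ (((1 / L : ℝ) : ℂ) + Complex.I * t)‖ := by
    intro χ hχ t ht
    refine hFF q z hqz hℓ1 hb χ hχ ?_ (1 / L) t hδ0 hδ1 ht
    intro w hw hwi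
    apply hgood
    have hre : (1 + w).re = 1 + w.re := by simp
    have him : (1 + w).im = w.im := by simp
    rw [hre, him]
    have hab := abs_nonneg w.im
    have h1 : Real.log (q * (|w.im| + 1)) ≤ ℓ / k := by
      rw [hℓe, mul_div_cancel_left₀ _ (by positivity), ← Real.log_mul (by linarith) (by linarith)]
      apply Real.log_le_log (by positivity)
      nlinarith
    have h2 : 0 < Real.log (q * (|w.im| + 1)) := Real.log_pos (by nlinarith)
    have h3 : 1 / (128 * ℓ) ≤ C₂ / Real.log (q * (|w.im| + 1)) := by
      calc 1 / (128 * ℓ) ≤ 1 / ℓ := one_div_le_one_div_of_le hℓ0 (by linarith)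
        _ ≤ C₂ * k / ℓ := by gcongr
        _ = C₂ / (ℓ / k) := by field_simp
        _ ≤ _ := by gcongr
    linarith
  obtain ⟨s, hs1, hs2⟩ := hTl L z hLL0 hzexp
  set α : (ZMod q)ˣ := ZMod.unitOfCoprime a ha with hα
  obtain ⟨S, hS1, hS2⟩ := cL_main_real (L := L) hqz hC hK hℓ1 hδ0 (by rw [div_le_one hLpos]; linarith) (by linarith) hb hF α
  have hmain := progression_lower α hδ0 hS1 hs1 hs2
    (fun t ht => hUp q α z hqz8 hZz (1 / L) L hδ0 hLV t ht)
  have hset : {p : ℕ | p.Prime ∧ (p : ℝ) ≤ Real.exp (L + V) ∧ (p : ZMod q) = α} =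
      {p : ℕ | p.Prime ∧ (p : ℝ) ≤ x ∧ p % q = a % q} := by
    ext p
    simp only [Set.mem_setOf_eq, hexpL, hα, ZMod.coe_unitOfCoprime, ZMod.natCast_eq_natCast_iff']
  rw [hset] at hmain
  have hS3 : |S| ≤ 1 / 400 / Nat.totient q := by
    refine hS2.trans ?_
    apply div_le_div_of_nonneg_right _ hφ.le
    rw [← hC', mul_div_assoc', div_le_iff₀ hLpos]
    linarith
  set N : ℝ := (Nat.card {p : ℕ | p.Prime ∧ (p : ℝ) ≤ x ∧ p % q = a % q} : ℝ) with hN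
  have hlogx : L + V = Real.log x := by rw [hL]; ring
  have hlogx0 : 0 < Real.log x := by linarith
  have hw : (L + V) * (Real.exp V / Real.exp L) = Real.log x * Real.exp (2 * V) / x := by
    rw [hlogx, ← hexpL, mul_div_assoc, ← Real.exp_sub, ← Real.exp_sub]
    congr 2; ring
  rw [hw] at hmain
  have hfin : 1 / 200 / (Nat.totient q : ℝ) ≤ N * (Real.log x * Real.exp (2 * V) / x) := by
    have e1 : (1:ℝ) / 100 / Nat.totient q = 1 / 400 / Nat.totient q + 1 / 400 / Nat.totient q + 1 / 200 / Nat.totient q := by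
      ring
    linarith
  have he := Real.exp_pos (2 * V)
  calc 1 / 200 / Real.exp (2 * V) * (x / (Nat.totient q * Real.log x)) =
        (1 / 200 / (Nat.totient q : ℝ)) * (x / (Real.log x * Real.exp (2 * V))) := by field_simp
    _ ≤ (N * (Real.log x * Real.exp (2 * V) / x)) * (x / (Real.log x * Real.exp (2 * V))) := by gcongr
    _ = N := by field_simp

end Gall

end

/-- Gallagher: For a good modulus `q`, one has
`π(x;q,a) ≫ x/(φ(q) log x)` uniformly for `(a,q)=1` and `x ≥ q^D`, where `D` depends
only on `C₂`. -/
theorem stmt13 (C₂ : ℝ) (hC₂ : 0 < C₂) :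
    ∃ D : ℝ, 1 ≤ D ∧ ∃ c > (0 : ℝ), ∀ (q : ℕ) [NeZero q], 2 ≤ q → IsGoodModulus C₂ q →
      ∀ a : ℕ, Nat.Coprime a q → ∀ x : ℝ, (q : ℝ) ^ D ≤ x →
        c * (x / (Nat.totient q * Real.log x)) ≤
          Nat.card {p : ℕ | p.Prime ∧ (p : ℝ) ≤ x ∧ p % q = a % q} := by
  exact Gall.final C₂ hC₂
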